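/- For every ε>0 there is a constant C_ε such that the following holds for all N: if A ⊆ {f ∈ F₂[x] : deg f < N} is a set such that A−A contains no polynomial of the form r−1 with r prime (irreducible and nonconstant), then |A| ≤ C_ε · 2^{(7/8+ε)N}. -/

import Mathlib

open Polynomial
open scoped Classical

noncomputable section

abbrev F2 := ZMod 2
abbrev Kinf := LaurentSeries F2
def polyToK (f : F2[X]) : Kinf :=
  ∑ i ∈ f.support, HahnSeries.single (-(i : ℤ)) (f.coeff i)
def ordK (a : Kinf) : WithBot ℤ := if a = 0 then ⊥ else (↑(-a.order) : WithBot ℤ)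
def eKr (a : Kinf) : ℝ := (-1 : ℝ) ^ ((a.coeff 1).val)
def eK (a : Kinf) : ℂ := ((eKr a : ℝ) : ℂ)
def InT (θ : Kinf) : Prop := ordK θ ≤ ((-1 : ℤ) : WithBot ℤ)
def GN (N : ℕ) : Finset F2[X] :=
  Set.Finite.toFinset (s := {f : F2[X] | f.degree < (N : ℕ)}) (by
    have h : {f : F2[X] | f.degree < (N : ℕ)} = ↑(Polynomial.degreeLT F2 N) := by
      ext f
      simp [Polynomial.mem_degreeLT]
    rw [h]
    have : Finite (Polynomial.degreeLT F2 N) :=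
      Finite.of_equiv _ (Polynomial.degreeLTEquiv F2 N).symm.toEquiv
    exact (Polynomial.degreeLT F2 N : Set F2[X]).toFinite)
def ratK (u s : F2[X]) : Kinf := polyToK u * (polyToK s)⁻¹

/-- τ(f): the number of divisors of `f`. -/
def tau (f : F2[X]) : ℕ := ((GN (f.natDegree + 1)).filter (fun g => g ∣ f)).card

/-- φ(f): the number of invertible residues modulo `f`. -/
def phi (f : F2[X]) : ℕ := ((GN f.natDegree).filter (fun g => IsCoprime g f)).card

/-- ω(f): the number of (irreducible nonconstant, i.e. prime) divisors of `f`. -/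
def omegaP (f : F2[X]) : ℕ :=
  ((GN (f.natDegree + 1)).filter (fun r => Irreducible r ∧ r ∣ f)).card

/-- The Möbius function on `F₂[x]`. -/
def mu (f : F2[X]) : ℤ := if Squarefree f then (-1) ^ (omegaP f) else 0

/-- The set of invertible residues modulo `s` (canonical representatives of
`(F₂[x]/(s))^×`, i.e. polynomials of degree `< deg s` coprime to `s`). -/
def residues (s : F2[X]) : Finset F2[X] := (GN s.natDegree).filter (fun t => IsCoprime t s)

/-- `α(s) = μ(s)/φ(s)`. -/
def alphaA (s : F2[X]) : ℝ := (mu s : ℝ) / (phi s : ℝ)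

/-- `α'(s) = ∏_{r | s prime} 3/(2^{deg r}+3)` for `s` squarefree, `0` otherwise. -/
def alphaB (s : F2[X]) : ℝ :=
  if Squarefree s then
    ∏ r ∈ (GN (s.natDegree + 1)).filter (fun r => Irreducible r ∧ r ∣ s),
      (3 : ℝ) / ((2 : ℝ) ^ r.natDegree + 3)
  else 0

/-- `Λ_M(f) = Σ_{s ∈ G_M} α(s) Σ_{t ∈ (F₂[x]/(s))^×} e(f t s⁻¹)`. -/
def LambdaM (M : ℕ) (f : F2[X]) : ℝ :=
  ∑ s ∈ GN M, alphaA s * ∑ t ∈ residues s, eKr (polyToK f * ratK t s)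

/-- `H_M(f) = Σ_{s ∈ G_M} α'(s) Σ_{t ∈ (F₂[x]/(s))^×} e(f t s⁻¹)`. -/
def HM (M : ℕ) (f : F2[X]) : ℝ :=
  ∑ s ∈ GN M, alphaB s * ∑ t ∈ residues s, eKr (polyToK f * ratK t s)

/-- `Λ'(f) = deg f` if `f` is prime, `0` otherwise. -/
def LambdaP (f : F2[X]) : ℝ := if Irreducible f then (f.natDegree : ℝ) else 0

/-- `Ψ(f) = Λ'(f+1) H_Q(f) 1_{f ∈ G_N}`. -/
def Psi (N Q : ℕ) (f : F2[X]) : ℝ :=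
  LambdaP (f + 1) * HM Q f * (if f ∈ GN N then 1 else 0)

/-- `Ψ'(f) = Λ_R(f+1) H_Q(f) 1_{f ∈ G_N}`. -/
def Psi' (N R Q : ℕ) (f : F2[X]) : ℝ :=
  LambdaM R (f + 1) * HM Q f * (if f ∈ GN N then 1 else 0)

/-- `Λ_r(f)` for a single prime `r`. -/
def Lambda_r (r f : F2[X]) : ℝ :=
  if r ∣ f then 0 else (2 : ℝ) ^ r.natDegree / ((2 : ℝ) ^ r.natDegree - 1)

/-- `τ²_r(f)` for a single prime `r`. -/
def tauSq_r (r f : F2[X]) : ℝ :=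
  if r ∣ f then 4 * (2 : ℝ) ^ r.natDegree / ((2 : ℝ) ^ r.natDegree + 3)
  else (2 : ℝ) ^ r.natDegree / ((2 : ℝ) ^ r.natDegree + 3)

/-- `˜Λ_M(f) = ∏_{r ∈ G_M prime} Λ_r(f)`. -/
def LambdaTilde (M : ℕ) (f : F2[X]) : ℝ :=
  ∏ r ∈ (GN M).filter (fun r => Irreducible r), Lambda_r r f

/-- `˜H_M(f) = ∏_{r ∈ G_M prime} τ²_r(f)`. -/
def HTilde (M : ℕ) (f : F2[X]) : ℝ :=
  ∏ r ∈ (GN M).filter (fun r => Irreducible r), tauSq_r r f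

/-- The element of `K∞` determined by a rational function (with `x ↦ t⁻¹`). -/
def ratToK (l : RatFunc F2) : Kinf := polyToK l.num * (polyToK l.denom)⁻¹

/-- `c : F₂(x)/F₂[x] → ℝ` (encoded on the canonical representatives
`λ = num/denom` in lowest terms with `deg num < deg denom`) is the system of Fourier
coefficients of `F : F₂[x] → ℝ`, i.e. `F(f) = Σ_λ c(λ) e(λ f)`. -/
def IsFourierCoeffs (F : F2[X] → ℝ) (c : RatFunc F2 → ℝ) : Prop :=
  (Function.support c).Finite ∧
  (∀ l : RatFunc F2, c l ≠ 0 → (l.num).degree < (l.denom).degree) ∧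
  ∀ f : F2[X], F f = ∑ᶠ l : RatFunc F2, c l * eKr (ratToK l * polyToK f)

/-- The canonical representative (mod `F₂[x]`) of a rational function. -/
def fracRat (l : RatFunc F2) : RatFunc F2 :=
  l - algebraMap F2[X] (RatFunc F2) (l.num / l.denom)

/-- `c(n, η)` from the statement of the exponential sum estimate for `Λ'`. -/
def cFun (n : ℕ) (η : Kinf) : ℝ :=
  if ordK η < ((-(n : ℤ) - 1 : ℤ) : WithBot ℤ) then 1
  else if ordK η = ((-(n : ℤ) - 1 : ℤ) : WithBot ℤ) then -1
  else 0

/-- The class `C_B(X)` (with explicit implied constant `Cst`): functions whose Fourier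
coefficients are supported on `λ` with squarefree denominator of degree `≤ X` and satisfy
`|c(λ)| ≤ Cst · τ(denom λ)^B / 2^{deg (denom λ)}`. -/
def InClassC (B X : ℕ) (Cst : ℝ) (F : F2[X] → ℝ) : Prop :=
  ∃ c : RatFunc F2 → ℝ, IsFourierCoeffs F c ∧
    (∀ l : RatFunc F2, c l ≠ 0 → Squarefree l.denom ∧ (l.denom).natDegree ≤ X) ∧
    (∀ l : RatFunc F2, |c l| ≤ Cst * (tau l.denom : ℝ) ^ B / 2 ^ (l.denom).natDegree)

/-- The fractional part `‖θ‖` of `θ ∈ K∞`: keep exactly the coefficients of `x^{-n}`, `n ≥ 1`. -/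
def fracK (θ : Kinf) : Kinf :=
  ⟨fun n => if 1 ≤ n then θ.coeff n else 0, by
    apply θ.isPWO_support'.mono
    intro n hn
    simp only [Function.mem_support, ne_eq] at hn ⊢
    intro h
    apply hn
    split_ifs
    · exact h
    · rfl⟩

set_option linter.unusedSectionVars false

namespace Sark

/-! ## Order bounds for Laurent series -/

def ge {k : Type*} [Field k] (x : LaurentSeries k) (a : ℤ) : Prop := ∀ n < a, x.coeff n = 0

section ge
variable {k : Type*} [Field k]

lemma ge_iff (x : LaurentSeries k) (a : ℤ) : ge x a ↔ (a : WithTop ℤ) ≤ x.orderTop := by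
  rw [HahnSeries.le_orderTop_iff_forall]
  simp [ge]

lemma ge.mono {x : LaurentSeries k} {a b : ℤ} (h : ge x a) (hb : b ≤ a) : ge x b :=
  fun n hn => h n (by omega)

lemma ge.add {x y : LaurentSeries k} {a : ℤ} (h : ge x a) (h' : ge y a) : ge (x + y) a :=
  fun n hn => by simp [h n hn, h' n hn]

lemma ge_zero (a : ℤ) : ge (0 : LaurentSeries k) a := fun n _ => by simp

lemma ge.sum {ι : Type*} {s : Finset ι} {f : ι → LaurentSeries k} {a : ℤ}
    (h : ∀ i ∈ s, ge (f i) a) : ge (∑ i ∈ s, f i) a := by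
  induction s using Finset.induction_on with
  | empty => simpa using ge_zero a
  | insert i s hi ih =>
    rw [Finset.sum_insert hi]
    exact (h i (by simp)).add (ih fun j hj => h j (by simp [hj]))

lemma ge.mul {x y : LaurentSeries k} {a b : ℤ} (h : ge x a) (h' : ge y b) : ge (x * y) (a + b) := by
  rw [ge_iff] at *
  rw [WithTop.coe_add]
  exact (add_le_add h h').trans HahnSeries.orderTop_add_le_mul

lemma ge_one : ge (1 : LaurentSeries k) 0 := by
  rw [ge_iff]; simp

lemma ge.pow {x : LaurentSeries k} {a : ℤ} (h : ge x a) (n : ℕ) : ge (x ^ n) (n * a) := by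
  induction n with
  | zero => simpa using ge_one
  | succ n ih =>
    rw [pow_succ]
    convert ih.mul h using 1
    push_cast; ring

lemma ge.prod {ι : Type*} {s : Finset ι} {f : ι → LaurentSeries k} {a : ι → ℤ}
    (h : ∀ i ∈ s, ge (f i) (a i)) : ge (∏ i ∈ s, f i) (∑ i ∈ s, a i) := by
  induction s using Finset.induction_on with
  | empty => simpa using ge_one
  | insert i s hi ih =>
    rw [Finset.prod_insert hi, Finset.sum_insert hi]
    exact (h i (by simp)).mul (ih fun j hj => h j (by simp [hj]))

lemma ge.le_order {x : LaurentSeries k} {a : ℤ} (h : ge x a) (hx : x ≠ 0) : a ≤ x.order := by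
  rw [HahnSeries.le_order_iff_forall hx]; exact h

lemma ge_order (x : LaurentSeries k) : ge x x.order :=
  fun _ hn => HahnSeries.coeff_eq_zero_of_lt_order hn

lemma ge.smul {x : LaurentSeries k} {a : ℤ} (h : ge x a) (c : k) : ge (c • x) a :=
  fun n hn => by simp [h n hn]

/-- the variable at infinity -/
def tinv (k : Type*) [Field k] : LaurentSeries k := HahnSeries.single (-1) 1

lemma tinv_pow (n : ℕ) : (tinv k) ^ n = HahnSeries.single (-(n : ℤ)) 1 := by
  simp [tinv, HahnSeries.single_pow]

/-- a polynomial as a Laurent series at infinity -/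
def evInf (p : k[X]) : LaurentSeries k := p.eval₂ HahnSeries.C (tinv k)

lemma aeval_tinv_coeff (p : k[X]) (n : ℤ) :
    (evInf p).coeff n = if n ≤ 0 then p.coeff (-n).toNat else 0 := by
  rw [evInf, eval₂_eq_sum_range, HahnSeries.coeff_sum]
  have key : ∀ j : ℕ, (HahnSeries.C (p.coeff j) * (tinv k) ^ j).coeff n = if n = -(j : ℤ) then p.coeff j else 0 := by
    intro j
    rw [tinv_pow, HahnSeries.C_mul_eq_smul, HahnSeries.coeff_smul, HahnSeries.coeff_single]
    split_ifs <;> simp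
  refine (Finset.sum_congr rfl fun j _ => key j).trans ?_
  split_ifs with h
  · rw [Finset.sum_eq_single (-n).toNat]
    · rw [if_pos (by omega)]
    · intro j _ hj
      rw [if_neg (by omega)]
    · intro hj
      rw [Polynomial.coeff_eq_zero_of_natDegree_lt (by simp at hj; omega)]; simp
  · apply Finset.sum_eq_zero
    intro j hj
    rw [if_neg (by omega)]

lemma ge_aeval (p : k[X]) : ge (evInf p) (-(p.natDegree : ℤ)) := by
  intro n hn
  rw [aeval_tinv_coeff, if_pos (by omega)]
  exact Polynomial.coeff_eq_zero_of_natDegree_lt (by omega)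

lemma aeval_tinv_natDegree_le {p : k[X]} {a : ℕ} (h : ge (evInf p) (-(a : ℤ))) :
    p.natDegree ≤ a := by
  rw [Polynomial.natDegree_le_iff_coeff_eq_zero]
  intro n hn
  have := h (-(n : ℤ)) (by omega)
  rw [aeval_tinv_coeff, if_pos (by omega)] at this
  simpa using this

lemma aeval_tinv_eq_zero {p : k[X]} (h : ge (evInf p) 1) : p = 0 := by
  ext n
  have := h (-(n : ℤ)) (by omega)
  rw [aeval_tinv_coeff, if_pos (by omega)] at this
  simpa using this

end ge
end Sark

namespace Sark

structure StepData (k B G : Type) [Field k] [CommRing B] [Algebra k B] [Algebra k[X] B]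
    [Group G] [Fintype G] where
  act : G →* (B →ₐ[k[X]] B)
  iot : B →+* LaurentSeries k
  iot_inj : Function.Injective iot
  iot_poly : ∀ p : k[X], iot (algebraMap k[X] B p) = evInf p
  norm_poly : ∀ b : B, ∃ p : k[X], algebraMap k[X] B p = ∏ g, act g b
  beta : Fin (Fintype.card G) → B
  beta_ind : LinearIndependent k[X] beta

variable {k B G : Type} [Field k] [CommRing B] [IsDomain B] [Algebra k B]
  [Algebra k[X] B] [IsScalarTower k k[X] B] [Group G] [Fintype G]

namespace StepData
variable (S : StepData k B G)


lemma act_inj (g : G) : Function.Injective (S.act g) := by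
  apply Function.LeftInverse.injective (g := S.act g⁻¹)
  intro b
  rw [← AlgHom.mul_apply, ← map_mul]; simp

lemma iot_smul (c : k) (b : B) : S.iot (c • b) = c • S.iot b := by
  have : c • b = algebraMap k[X] B (C c) * b := by
    rw [← Algebra.smul_def, ← Polynomial.algebraMap_eq, algebraMap_smul]
  rw [this, map_mul, S.iot_poly, evInf, eval₂_C, HahnSeries.C_mul_eq_smul]

lemma act_smul (g : G) (c : k) (b : B) : S.act g (c • b) = c • S.act g b := by
  have : ∀ b : B, c • b = (C c : k[X]) • b := fun b => by
    rw [← Polynomial.algebraMap_eq, algebraMap_smul]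
  rw [this, this, map_smul]

def cf (g : G) (n : ℤ) : B →ₗ[k] k where
  toFun b := (S.iot (S.act g b)).coeff n
  map_add' := by intros; simp
  map_smul' := by intros; simp [S.act_smul, S.iot_smul]

lemma exists_c0 : ∃ c0 : ℕ, ∀ g i, ge (S.iot (S.act g (S.beta i))) (-(c0 : ℤ)) := by
  refine ⟨∑ g, ∑ i, (S.iot (S.act g (S.beta i))).order.natAbs, fun g i => (ge_order _).mono ?_⟩
  have h1 : (S.iot (S.act g (S.beta i))).order.natAbs ≤ ∑ i, (S.iot (S.act g (S.beta i))).order.natAbs :=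
    Finset.single_le_sum (f := fun i => (S.iot (S.act g (S.beta i))).order.natAbs) (by simp) (Finset.mem_univ i)
  have h2 : ∑ i, (S.iot (S.act g (S.beta i))).order.natAbs ≤ ∑ g, ∑ i, (S.iot (S.act g (S.beta i))).order.natAbs :=
    Finset.single_le_sum (f := fun g => ∑ i, (S.iot (S.act g (S.beta i))).order.natAbs) (by simp) (Finset.mem_univ g)
  omega

def par (n : ℕ) : (Fin (Fintype.card G) → degreeLT k n) →ₗ[k] B where
  toFun p := ∑ i, (p i : k[X]) • S.beta i
  map_add' p q := by simp [add_smul, Finset.sum_add_distrib]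
  map_smul' c p := by simp [Finset.smul_sum]

lemma par_inj (n : ℕ) : Function.Injective (S.par n) := by
  rw [injective_iff_map_eq_zero]
  intro p hp
  have := Fintype.linearIndependent_iff.1 S.beta_ind (fun i => (p i : k[X])) hp
  ext i : 2
  simpa using this i

lemma exists_V : ∃ C1 : ℕ, ∀ m : ℕ, ∃ V : Submodule k B, FiniteDimensional k V ∧
    m ≤ Module.finrank k V + C1 ∧ ∀ b ∈ V, ge (S.iot b) (-(m : ℤ)) ∧
      ∀ g, g ≠ 1 → ge (S.iot (S.act g b)) 0 := by
  obtain ⟨c0, hc0⟩ := S.exists_c0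
  refine ⟨Fintype.card G * c0, fun m => ?_⟩
  by_cases hm : m < c0
  · refine ⟨⊥, inferInstance, ?_, ?_⟩
    · have : 1 ≤ Fintype.card G := Fintype.card_pos
      nlinarith
    · intro b hb
      rw [Submodule.mem_bot] at hb
      subst hb
      simp [ge_zero]
  push Not at hm
  set cond : (Fin (Fintype.card G) → degreeLT k (m - c0)) →ₗ[k] ({g : G // g ≠ 1} × Fin m → k) :=
    LinearMap.pi fun x => (S.cf x.1 (-((x.2 : ℕ) : ℤ) - 1)).comp (S.par (m - c0)) with hcond
  have hfin : FiniteDimensional k (degreeLT k (m - c0)) :=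
    (degreeLTEquiv k (m - c0)).symm.finiteDimensional
  have hpar : ∀ p g, ge (S.iot (S.act g (S.par (m - c0) p))) (-(m : ℤ)) := by
    intro p g
    have : S.iot (S.act g (S.par (m - c0) p)) =
        ∑ i, evInf (p i : k[X]) * S.iot (S.act g (S.beta i)) := by
      simp [par, Algebra.smul_def, S.iot_poly]
    rw [this]
    apply ge.sum
    intro i _
    by_cases h0 : (p i : k[X]) = 0
    · rw [h0]; simp [evInf, ge_zero]
    refine ((ge_aeval _).mul (hc0 g i)).mono ?_
    have h1 := mem_degreeLT.1 (p i).2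
    rw [degree_eq_natDegree h0] at h1
    have h2 : (p i : k[X]).natDegree < m - c0 := by exact_mod_cast h1
    omega
  refine ⟨(LinearMap.ker cond).map (S.par (m - c0)), inferInstance, ?_, ?_⟩
  · rw [← (Submodule.equivMapOfInjective (S.par (m - c0)) (S.par_inj _) (LinearMap.ker cond)).finrank_eq]
    have h1 := LinearMap.finrank_range_add_finrank_ker cond
    have h2 : Module.finrank k (LinearMap.range cond) ≤ (Fintype.card G - 1) * m := by
      refine (Submodule.finrank_le _).trans ?_
      rw [Module.finrank_fintype_fun_eq_card, Fintype.card_prod, Fintype.card_fin]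
      simp [Fintype.card_subtype_compl]
    have h3 : Module.finrank k (Fin (Fintype.card G) → degreeLT k (m - c0)) =
        Fintype.card G * (m - c0) := by
      rw [Module.finrank_pi_fintype]
      simp [(degreeLTEquiv k (m - c0)).finrank_eq]
    rw [h3] at h1
    obtain ⟨D, hD⟩ : ∃ D, Fintype.card G = D + 1 := ⟨_, (Nat.succ_pred_eq_of_pos Fintype.card_pos).symm⟩
    generalize Module.finrank k (LinearMap.range cond) = r1 at h1 h2
    generalize Module.finrank k (LinearMap.ker cond) = r2 at h1 ⊢
    rw [hD] at h1 h2 ⊢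
    simp only [Nat.add_sub_cancel] at h2
    have h4 : c0 + (m - c0) = m := by omega
    generalize m - c0 = r at h1 h4
    subst h4
    nlinarith
  · rintro _ ⟨p, hp, rfl⟩
    refine ⟨by simpa using hpar p 1, fun g hg n hn => ?_⟩
    by_cases hn' : n < -(m : ℤ)
    · exact hpar p g n hn'
    · have h1 : cond p = 0 := hp
      have h2 := congrFun h1 (⟨g, hg⟩, ⟨(-n - 1).toNat, by omega⟩)
      simp only [hcond, LinearMap.pi_apply, LinearMap.comp_apply, Pi.zero_apply] at h2
      have h3 : (-(((-n - 1).toNat : ℕ) : ℤ) - 1) = n := by omega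
      rw [h3] at h2
      exact h2

end StepData
end Sark

namespace Sark

variable {k B G : Type} [Field k] [CommRing B] [IsDomain B] [Algebra k B]
  [Algebra k[X] B] [IsScalarTower k k[X] B] [Group G] [Fintype G]

namespace StepData
variable (S : StepData k B G)

lemma act_one (b : B) : S.act 1 b = b := by simp

lemma act_mul (g h : G) (b : B) : S.act (g * h) b = S.act g (S.act h b) := by simp

lemma norm_ge {b : B} {a : G → ℤ} (h : ∀ g, ge (S.iot (S.act g b)) (a g)) {p : k[X]}
    (hp : algebraMap k[X] B p = ∏ g, S.act g b) : ge (evInf p) (∑ g, a g) := by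
  rw [← S.iot_poly, hp, map_prod]
  exact ge.prod fun g _ => h g

lemma norm_ne {b : B} (hb : b ≠ 0) {p : k[X]}
    (hp : algebraMap k[X] B p = ∏ g, S.act g b) : p ≠ 0 := by
  rintro rfl
  rw [map_zero, eq_comm, Finset.prod_eq_zero_iff] at hp
  obtain ⟨g, _, hg⟩ := hp
  exact hb ((map_eq_zero_iff _ (S.act_inj g)).1 hg)

lemma norm_ge' {b : B} {a : ℤ} (h1 : ge (S.iot b) a) (h : ∀ g, g ≠ 1 → ge (S.iot (S.act g b)) 0)
    {p : k[X]} (hp : algebraMap k[X] B p = ∏ g, S.act g b) : ge (evInf p) a := by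
  have := S.norm_ge (b := b) (a := fun g => if g = 1 then a else 0) (fun g => by
    split_ifs with hg
    · subst hg; simpa using h1
    · exact h g hg) hp
  simpa using this

lemma order_nonpos {b : B} (hb : b ≠ 0) (h : ∀ g, g ≠ 1 → ge (S.iot (S.act g b)) 0) :
    (S.iot b).order ≤ 0 := by
  obtain ⟨p, hp⟩ := S.norm_poly b
  by_contra hc
  exact S.norm_ne hb hp (aeval_tinv_eq_zero ((S.norm_ge' (ge_order _) h hp).mono (by omega)))

lemma eq_zero_of_ge {b : B} (h1 : ge (S.iot b) 1) (h : ∀ g, g ≠ 1 → ge (S.iot (S.act g b)) 0) :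
    b = 0 := by
  obtain ⟨p, hp⟩ := S.norm_poly b
  by_contra hb
  exact S.norm_ne hb hp (aeval_tinv_eq_zero (S.norm_ge' h1 h hp))

lemma exists_J (V : Submodule k B) [FiniteDimensional k V] (m : ℕ)
    (hV : ∀ b ∈ V, ge (S.iot b) (-(m : ℤ)) ∧ ∀ g, g ≠ 1 → ge (S.iot (S.act g b)) 0) :
    ∃ (J : Finset ℤ) (s : ℤ → B), (∀ j ∈ J, s j ∈ V ∧ s j ≠ 0 ∧ (S.iot (s j)).order = j) ∧
      Module.finrank k V ≤ J.card := by
  set J : Finset ℤ := (Finset.Icc (-(m : ℤ)) 0).filter fun j => ∃ b ∈ V, b ≠ 0 ∧ (S.iot b).order = j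
  have hJ : ∀ j ∈ J, ∃ b ∈ V, b ≠ 0 ∧ (S.iot b).order = j := fun j hj => (Finset.mem_filter.1 hj).2
  choose! s hs using hJ
  refine ⟨J, s, hs, ?_⟩
  set f : V →ₗ[k] (J → k) := LinearMap.pi fun j => (S.cf 1 j).comp V.subtype with hf
  have hinj : Function.Injective f := by
    rw [injective_iff_map_eq_zero]
    intro v hv
    by_contra hne
    have hb : (v : B) ≠ 0 := by simpa using hne
    have hb' : S.iot (v : B) ≠ 0 := by
      rw [Ne, map_eq_zero_iff _ S.iot_inj]; exact hb
    have hmem : (S.iot (v : B)).order ∈ J := by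
      rw [Finset.mem_filter, Finset.mem_Icc]
      exact ⟨⟨(hV v v.2).1.le_order hb', S.order_nonpos hb (hV v v.2).2⟩, v, v.2, hb, rfl⟩
    have := congrFun hv ⟨_, hmem⟩
    simp only [hf, LinearMap.pi_apply, LinearMap.comp_apply, Pi.zero_apply, cf] at this
    simp at this
    exact hb' this
  have := LinearMap.finrank_le_finrank_of_injective hinj
  simpa using this

/-- the auxiliary linear map -/
def zmap [Fintype k] [CharP B 2] (e n : ℕ) (he : Fintype.card k ^ e = 2 ^ n) (J : Finset ℤ)
    (V : Submodule k B) (s' : ℤ → B) : (J → V) →ₗ[k] B where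
  toFun u := ∑ j, (u j : B) ^ (2 ^ n) * s' j
  map_add' u v := by
    simp only [Pi.add_apply, Submodule.coe_add, add_pow_char_pow, add_mul, Finset.sum_add_distrib]
  map_smul' c u := by
    have hc : c ^ (2 ^ n) = c := by rw [← he]; exact FiniteField.pow_card_pow e c
    simp only [Pi.smul_apply, Submodule.coe_smul, _root_.smul_pow, hc, smul_mul_assoc, Finset.smul_sum,
      RingHom.id_apply]

lemma exists_ker [Fintype k] [CharP B 2] (e n : ℕ) (he : Fintype.card k ^ e = 2 ^ n)
    (Vl Vm : Submodule k B) [FiniteDimensional k Vl] (l m : ℕ)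
    (hVl : ∀ b ∈ Vl, ge (S.iot b) (-(l : ℤ)) ∧ ∀ g, g ≠ 1 → ge (S.iot (S.act g b)) 0)
    (hVm : ∀ b ∈ Vm, ge (S.iot b) (-(m : ℤ)) ∧ ∀ g, g ≠ 1 → ge (S.iot (S.act g b)) 0)
    (J : Finset ℤ) (s : ℤ → B) (hs : ∀ j ∈ J, s j ∈ Vm) (τ : G)
    (hdim : l * 2 ^ n + m + 1 + (m + 1) < J.card * Module.finrank k Vl) :
    ∃ u : J → Vl, u ≠ 0 ∧ ∑ j, (u j : B) ^ (2 ^ n) * S.act τ (s j) = 0 := by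
  set Z := zmap e n he J Vl (fun j => S.act τ (s j)) with hZ
  set f : (J → Vl) →ₗ[k] ((Fin (l * 2 ^ n + m + 1) → k) × (Fin (m + 1) → k)) :=
    ((LinearMap.pi fun i : Fin (l * 2 ^ n + m + 1) => (S.cf 1 (-((i : ℕ) : ℤ)))).comp Z).prod
      ((LinearMap.pi fun i : Fin (m + 1) => (S.cf τ⁻¹ (-((i : ℕ) : ℤ)))).comp Z) with hf
  have hk : LinearMap.ker f ≠ ⊥ := by
    apply LinearMap.ker_ne_bot_of_finrank_lt
    rw [Module.finrank_prod, Module.finrank_fin_fun, Module.finrank_fin_fun, Module.finrank_pi_fintype]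
    simpa using hdim
  obtain ⟨u, hu, hu0⟩ := Submodule.exists_mem_ne_zero_of_ne_bot hk
  refine ⟨u, hu0, ?_⟩
  have hu1 : f u = 0 := hu
  have hg : ∀ g, ge (S.iot (S.act g (Z u))) ((if g = 1 then -((l * 2 ^ n : ℕ) : ℤ) else 0) +
      if g = τ⁻¹ then -(m : ℤ) else 0) := by
    intro g
    simp only [hZ, zmap, LinearMap.coe_mk, AddHom.coe_mk, map_sum, map_mul, map_pow]
    apply ge.sum
    intro j _
    apply ge.mul
    · split_ifs with h
      · subst h
        have := ((hVl _ (u j).2).1).pow (2 ^ n)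
        rw [act_one]
        refine this.mono (le_of_eq ?_)
        push_cast; ring
      · have := ((hVl _ (u j).2).2 g h).pow (2 ^ n)
        simpa using this
    · rw [← act_mul]
      split_ifs with h
      · subst h
        have := (hVm _ (hs _ j.2)).1
        simpa using this
      · exact (hVm _ (hs _ j.2)).2 _ (fun h' => h (eq_inv_of_mul_eq_one_left h'))
  have h1 : ge (S.iot (Z u)) 1 := by
    intro i hi
    by_cases hi' : -((l * 2 ^ n + m : ℕ) : ℤ) ≤ i
    · have h2 := congrFun (congrArg Prod.fst hu1) ⟨(-i).toNat, by omega⟩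
      have h3 : (-((((-i).toNat : ℕ)) : ℤ)) = i := by omega
      change (S.iot (S.act 1 (Z u))).coeff (-((((-i).toNat : ℕ)) : ℤ)) = 0 at h2
      rwa [h3, act_one] at h2
    · have := hg 1
      rw [act_one] at this
      refine this i ?_
      rw [if_pos rfl]
      split_ifs <;> push_cast at * <;> omega
  apply S.eq_zero_of_ge h1
  intro g hg1 n hn
  by_cases hgt : g = τ⁻¹
  · by_cases hn' : -(m : ℤ) ≤ n
    · have h2 := congrFun (congrArg Prod.snd hu1) ⟨(-n).toNat, by omega⟩
      have h3 : (-((((-n).toNat : ℕ)) : ℤ)) = n := by omega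
      change (S.iot (S.act τ⁻¹ (Z u))).coeff (-((((-n).toNat : ℕ)) : ℤ)) = 0 at h2
      rwa [h3, ← hgt] at h2
    · refine hg g n ?_
      rw [if_neg hg1, if_pos hgt]; omega
  · refine hg g n ?_
    rw [if_neg hg1, if_neg hgt]; omega

lemma w_ne_zero (J : Finset ℤ) (s : ℤ → B) (hs : ∀ j ∈ J, s j ≠ 0 ∧ (S.iot (s j)).order = j)
    (V : Submodule k B) (l Q : ℕ) (hlQ : l < Q)
    (hV : ∀ b ∈ V, ge (S.iot b) (-(l : ℤ)) ∧ ∀ g, g ≠ 1 → ge (S.iot (S.act g b)) 0)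
    (u : J → V) (hu : u ≠ 0) : ∑ j, (u j : B) * s j ^ Q ≠ 0 := by
  have hne : (Finset.univ.filter fun j : J => u j ≠ 0).Nonempty := by
    obtain ⟨j, hj⟩ := Function.ne_iff.1 hu
    exact ⟨j, by simpa using hj⟩
  obtain ⟨j0, hj0, hmin⟩ := Finset.exists_min_image _ (fun j : J => (j : ℤ)) hne
  have hj0' : (u j0 : B) ≠ 0 := by simpa using hj0
  have hi0 : S.iot (u j0 : B) ≠ 0 := by rw [Ne, map_eq_zero_iff _ S.iot_inj]; exact hj0'
  have hs0 : S.iot (s j0) ≠ 0 := by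
    rw [Ne, map_eq_zero_iff _ S.iot_inj]; exact (hs _ j0.2).1
  set o := (S.iot ((u j0 : B) * s j0 ^ Q)).order with ho
  have hne0 : S.iot ((u j0 : B) * s j0 ^ Q) ≠ 0 := by
    rw [map_mul, map_pow]; exact mul_ne_zero hi0 (pow_ne_zero _ hs0)
  have ho' : o ≤ Q * (j0 : ℤ) := by
    rw [ho, map_mul, map_pow, HahnSeries.order_mul hi0 (pow_ne_zero _ hs0), HahnSeries.order_pow,
      (hs _ j0.2).2]
    have := S.order_nonpos hj0' (hV _ (u j0).2).2
    simp only [nsmul_eq_mul]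
    omega
  intro hz
  have h1 : (S.iot (∑ j, (u j : B) * s j ^ Q)).coeff o = 0 := by rw [hz]; simp
  rw [map_sum, HahnSeries.coeff_sum, Finset.sum_eq_single j0] at h1
  · rw [ho, HahnSeries.coeff_order_eq_zero] at h1
    exact hne0 h1
  · intro j _ hj
    by_cases huj : u j = 0
    · simp [huj]
    have hlt : (j0 : ℤ) < j := lt_of_le_of_ne (hmin j (by simpa using huj)) (fun h => hj (Subtype.ext h.symm))
    have h2 := ((hV _ (u j).2).1).mul ((ge_order (S.iot (s j))).pow Q)
    rw [← map_pow, ← map_mul, (hs _ j.2).2] at h2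
    apply h2
    have : (Q : ℤ) * (j0 + 1) ≤ Q * j := by
      apply mul_le_mul_of_nonneg_left (by omega) (by positivity)
    have : (l : ℤ) < Q := by exact_mod_cast hlQ
    linarith
  · simp

end StepData
end Sark

namespace Sark

variable {k B G : Type} [Field k] [CommRing B] [IsDomain B] [Algebra k B]
  [Algebra k[X] B] [IsScalarTower k k[X] B] [Group G] [Fintype G]

lemma pow_dvd_of_powerSeries {W : Type} [Field W] (p : W[X]) (α : W) (D : ℕ)
    (h : (PowerSeries.X : PowerSeries W) ^ D ∣ ((p.comp (X + C α) : W[X]) : PowerSeries W)) :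
    (X - C α) ^ D ∣ p := by
  have h1 : (X : W[X]) ^ D ∣ p.comp (X + C α) := by
    rw [PowerSeries.X_pow_dvd_iff] at h
    rw [Polynomial.X_pow_dvd_iff]
    intro m hm
    simpa using h m hm
  obtain ⟨r, hr⟩ := h1
  refine ⟨r.comp (X - C α), ?_⟩
  have := congrArg (fun q : W[X] => q.comp (X - C α)) hr
  simpa [comp_assoc] using this

lemma card_le_of_pow_dvd {W : Type} [Field W] (p : W[X]) (hp : p ≠ 0) (T : Finset W) (D : ℕ)
    (h : ∀ α ∈ T, (X - C α) ^ D ∣ p) : D * T.card ≤ p.natDegree := by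
  have h1 : ∏ α ∈ T, (X - C α) ^ D ∣ p := by
    apply Finset.prod_dvd_of_coprime _ h
    intro a _ b _ hab
    exact (pairwise_coprime_X_sub_C (Function.injective_id) hab).pow
  have h2 := natDegree_le_of_dvd h1 hp
  rw [natDegree_prod_of_monic _ _ (fun α _ => (monic_X_sub_C α).pow D)] at h2
  simpa [natDegree_pow, mul_comm] using h2

namespace StepData
variable (S : StepData k B G)

theorem stepanov [Fintype k] [CharP k 2] : ∃ C0 e0 : ℕ, ∀ e n : ℕ, e0 ≤ e →
    Fintype.card k ^ e = 2 ^ n → ∀ τ : G, (∀ g, τ * g = g * τ) →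
    ∀ (W : Type) [Field W] [Algebra k W] (T : Finset W),
    (∀ α ∈ T, ∃ ρ : B →+* PowerSeries W,
      (∀ p : k[X], ρ (algebraMap k[X] B p) =
        (((p.map (algebraMap k W)).comp (X + C α) : W[X]) : PowerSeries W)) ∧
      ∀ b, (PowerSeries.constantCoeff (ρ b)) ^ (2 ^ n * 2 ^ n) =
        PowerSeries.constantCoeff (ρ (S.act τ b))) →
    Fintype.card G * T.card ≤ 2 ^ n * 2 ^ n + C0 * 2 ^ n := by
  obtain ⟨C1, hC1⟩ := S.exists_V
  set C2 := 2 * C1 + 4 with hC2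
  refine ⟨C2 + 1, (1 + C1) * (C2 + 1) + 2 * C2 + 10, ?_⟩
  intro e n hen hkn τ hτ W _ _ T hT
  set P := 2 ^ n with hP
  have hPe : e ≤ P := by
    rw [← hkn]
    exact (Nat.lt_pow_self (Fintype.one_lt_card)).le
  have hPbig : (1 + C1) * (C2 + 1) + 2 * C2 + 10 ≤ P := hen.trans hPe
  haveI : CharP B 2 := charP_of_injective_algebraMap (algebraMap k B).injective 2
  haveI : CharP W 2 := charP_of_injective_algebraMap (algebraMap k W).injective 2
  obtain ⟨Vl, hlf, hld, hl⟩ := hC1 (P - 1)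
  obtain ⟨Vm, hmf, hmd, hm⟩ := hC1 (P + C2)
  obtain ⟨J, s, hs, hJ⟩ := S.exists_J Vm (P + C2) hm
  obtain ⟨u, hu0, hu⟩ := S.exists_ker e n hkn Vl Vm (P - 1) (P + C2) hl hm J s
    (fun j hj => (hs j hj).1) τ (by
      rw [← hP]
      have h1 : P ≤ Module.finrank k Vl + C1 + 1 := by omega
      have h2 : P + C1 + 4 ≤ J.card := by omega
      have h3 : (P - 1) * P + P = P * P := by
        obtain ⟨r, hr⟩ : ∃ r, P = r + 1 := ⟨P - 1, by omega⟩
        rw [hr]; simp; ring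
      have h4 : P - C1 - 1 ≤ Module.finrank k Vl := by omega
      obtain ⟨r, hr⟩ : ∃ r, P = r + C1 + 1 := ⟨P - C1 - 1, by
        have : C1 + 1 ≤ P := by nlinarith
        omega⟩
      have h4 : r ≤ Module.finrank k Vl := by omega
      have h5 : (P + C1 + 4) * r ≤ J.card * Module.finrank k Vl := Nat.mul_le_mul h2 h4
      nlinarith)
  rw [← hP] at hu
  set w := ∑ j, (u j : B) * s j ^ P with hw
  have hw0 : w ≠ 0 := S.w_ne_zero J s (fun j hj => (hs j hj).2) Vl (P - 1) P (by omega) hl u hu0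
  obtain ⟨p, hp⟩ := S.norm_poly w
  have hp0 : p ≠ 0 := S.norm_ne hw0 hp
  have hdeg : p.natDegree ≤ (P - 1) + (P + C2) * P := by
    apply aeval_tinv_natDegree_le
    refine S.norm_ge' ?_ ?_ hp
    · rw [hw, map_sum]
      apply ge.sum
      intro j _
      rw [map_mul, map_pow]
      refine ((hl _ (u j).2).1.mul ((hm _ (hs _ j.2).1).1.pow P)).mono (le_of_eq ?_)
      push_cast; ring
    · intro g hg
      rw [hw, map_sum, map_sum]
      apply ge.sum
      intro j _
      rw [map_mul, map_pow, map_mul, map_pow]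
      have := ((hl _ (u j).2).2 g hg).mul (((hm _ (hs _ j.2).1).2 g hg).pow P)
      simpa using this
  have hdvd : ∀ α ∈ T, (X - C α) ^ (Fintype.card G) ∣ p.map (algebraMap k W) := by
    intro α hα
    obtain ⟨ρ, hρ, hρF⟩ := hT α hα
    apply pow_dvd_of_powerSeries
    rw [← hρ, hp, map_prod, ← Finset.card_univ, ← Finset.prod_const]
    apply Finset.prod_dvd_prod_of_dvd
    intro g _
    rw [PowerSeries.X_dvd_iff]
    have h1 : (PowerSeries.constantCoeff (ρ (S.act g w))) ^ P = 0 := by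
      have h2 : S.act g (∑ j, (u j : B) ^ P * S.act τ (s j)) = 0 := by rw [hu, map_zero]
      have h3 : (PowerSeries.constantCoeff (ρ (S.act g w))) ^ P =
          PowerSeries.constantCoeff (ρ (S.act g (∑ j, (u j : B) ^ P * S.act τ (s j)))) := by
        simp only [hw, map_sum, map_mul, map_pow]
        rw [hP, sum_pow_char_pow, ← hP]
        refine Finset.sum_congr rfl fun j _ => ?_
        rw [mul_pow, ← pow_mul, hρF, ← act_mul, ← act_mul, hτ]
      rw [h3, h2]; simp
    exact pow_eq_zero_iff (by positivity) |>.1 h1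
  have hfin := card_le_of_pow_dvd (p.map (algebraMap k W))
    ((Polynomial.map_ne_zero_iff (algebraMap k W).injective).2 hp0) T _ hdvd
  rw [natDegree_map] at hfin
  calc _ ≤ _ := hfin
    _ ≤ _ := hdeg
    _ ≤ _ := by
      have : P - 1 ≤ P := Nat.sub_le _ _
      nlinarith

end StepData
end Sark

namespace Sark

variable {ι : Type} [Fintype ι] [DecidableEq ι]

/-- entrywise squaring -/
def sq {S : Type*} [CommRing S] [CharP S 2] : Matrix ι ι S →+* Matrix ι ι S := (frobenius S 2).mapMatrix

lemma sq_apply {S : Type*} [CommRing S] [CharP S 2] (Y : Matrix ι ι S) (i j : ι) :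
    sq Y i j = (Y i j) ^ 2 := rfl

lemma map_sq {S T : Type*} [CommRing S] [CharP S 2] [CommRing T] [CharP T 2] (f : S →+* T)
    (Y : Matrix ι ι S) : f.mapMatrix (sq Y) = sq (f.mapMatrix Y) := by
  ext i j; simp [sq_apply]

lemma det_sq {S : Type*} [CommRing S] [CharP S 2] (Y : Matrix ι ι S) :
    (sq Y).det = Y.det ^ 2 := by
  rw [sq, ← RingHom.map_det]; rfl

def z2 (S : Type*) [CommRing S] [CharP S 2] : ZMod 2 →+* S := ZMod.castHom dvd_rfl S

lemma z2_comp {S T : Type*} [CommRing S] [CharP S 2] [CommRing T] [CharP T 2] (f : S →+* T) :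
    f.comp (z2 S) = z2 T := RingHom.ext_zmod _ _

/-- matrices over `F_2` viewed over `S` -/
def zm (S : Type*) [CommRing S] [CharP S 2] : Matrix ι ι (ZMod 2) →+* Matrix ι ι S := (z2 S).mapMatrix

lemma map_zm {S T : Type*} [CommRing S] [CharP S 2] [CommRing T] [CharP T 2] (f : S →+* T)
    (c : Matrix ι ι (ZMod 2)) : f.mapMatrix (zm S c) = zm T c := by
  ext i j
  change f (z2 S (c i j)) = z2 T (c i j)
  rw [← z2_comp f]; rfl

lemma zm_inj {S : Type*} [CommRing S] [CharP S 2] [Nontrivial S] :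
    Function.Injective (zm (ι := ι) S) := by
  intro a b h
  ext i j
  have := congrFun (congrFun h i) j
  exact (z2 S).injective this

lemma sq_zm {S : Type*} [CommRing S] [CharP S 2] (c : Matrix ι ι (ZMod 2)) :
    sq (zm S c) = zm S c := by
  ext i j
  change (z2 S (c i j)) ^ 2 = z2 S (c i j)
  rw [← map_pow]
  congr 1
  generalize c i j = x
  revert x; decide

lemma exists_zm {S : Type*} [CommRing S] [IsDomain S] [CharP S 2] (c : Matrix ι ι S) (h : sq c = c) :
    ∃ c' : Matrix ι ι (ZMod 2), zm S c' = c := by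
  have : ∀ i j, ∃ x : ZMod 2, z2 S x = c i j := by
    intro i j
    have h1 : c i j ^ 2 = c i j := congrFun (congrFun h i) j
    have h2 : c i j * (c i j - 1) = 0 := by ring_nf; rw [h1]; ring
    rcases mul_eq_zero.1 h2 with h3 | h3
    · exact ⟨0, by simp [h3]⟩
    · exact ⟨1, by simp [sub_eq_zero.1 h3]⟩
  choose c' hc' using this
  exact ⟨c', by ext i j; exact hc' i j⟩

lemma sol_ratio {S : Type*} [Field S] [CharP S 2] {A Y Y' : Matrix ι ι S} (hY : sq Y = A * Y)
    (hY' : sq Y' = A * Y') (hdet : Y.det ≠ 0) : ∃ c : Matrix ι ι (ZMod 2), Y' = Y * zm S c := by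
  have hu : IsUnit Y.det := isUnit_iff_ne_zero.2 hdet
  have h1 : Y * (Y⁻¹ * Y') = Y' := Matrix.mul_nonsing_inv_cancel_left _ _ hu
  obtain ⟨c, hc⟩ := exists_zm (Y⁻¹ * Y') (by
    have h2 : sq Y * sq (Y⁻¹ * Y') = sq Y * (Y⁻¹ * Y') := by
      rw [← map_mul, h1, hY', hY, Matrix.mul_assoc, h1]
    have h3 : IsUnit (sq Y).det := by rw [det_sq]; exact hu.pow 2
    have h4 := congrArg (fun Z => (sq Y)⁻¹ * Z) h2
    simpa [Matrix.nonsing_inv_mul_cancel_left _ _ h3] using h4)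
  exact ⟨c, by rw [hc, h1]⟩

lemma sol_det {S : Type*} [CommRing S] [IsDomain S] [CharP S 2] {A Y : Matrix ι ι S} (hY : sq Y = A * Y)
    (hdet : Y.det ≠ 0) : Y.det = A.det := by
  have := congrArg Matrix.det hY
  rw [det_sq, Matrix.det_mul, pow_two] at this
  exact mul_right_cancel₀ hdet this

/-! ### power series solutions -/

lemma coeff_sq {W : Type*} [CommRing W] [CharP W 2] (f : PowerSeries W) (n : ℕ) :
    PowerSeries.coeff n (f ^ 2) = if 2 ∣ n then (PowerSeries.coeff (n / 2) f) ^ 2 else 0 := by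
  have h : f ^ 2 = PowerSeries.map (frobenius W 2) (PowerSeries.expand 2 two_ne_zero f) :=
    (MvPowerSeries.map_frobenius_expand 2 two_ne_zero (f := f)).symm
  rw [h, PowerSeries.coeff_map, PowerSeries.coeff_expand]
  split_ifs <;> simp [frobenius_def]

def solSeq {W : Type} [CommRing W] [CharP W 2] (A0 A1 Z0 : Matrix ι ι W) : ℕ → Matrix ι ι W
  | 0 => Z0
  | n + 1 => A0⁻¹ * ((if 2 ∣ (n + 1) then sq (solSeq A0 A1 Z0 ((n + 1) / 2)) else 0)
      - A1 * solSeq A0 A1 Z0 n)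

def solMat {W : Type} [CommRing W] [CharP W 2] (A0 A1 Z0 : Matrix ι ι W) :
    Matrix ι ι (PowerSeries W) :=
  Matrix.of fun i j => PowerSeries.mk fun n => solSeq A0 A1 Z0 n i j

instance charP_powerSeries {W : Type} [CommRing W] [Nontrivial W] [CharP W 2] : CharP (PowerSeries W) 2 :=
  charP_of_injective_ringHom (f := PowerSeries.C (R := W)) PowerSeries.C_injective 2

lemma solMat_sol {W : Type} [Field W] [CharP W 2] (A0 A1 Z0 : Matrix ι ι W)
    (hA0 : IsUnit A0.det) (hZ : sq Z0 = A0 * Z0) :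
    sq (solMat A0 A1 Z0) = (PowerSeries.C.mapMatrix A0 + (PowerSeries.X : PowerSeries W) • PowerSeries.C.mapMatrix A1) *
      solMat A0 A1 Z0 := by
  ext i j n
  rw [sq_apply, coeff_sq, Matrix.mul_apply, map_sum]
  have hc : ∀ l, PowerSeries.coeff n ((PowerSeries.C.mapMatrix A0 + (PowerSeries.X : PowerSeries W) •
      PowerSeries.C.mapMatrix A1) i l * solMat A0 A1 Z0 l j) =
      A0 i l * solSeq A0 A1 Z0 n l j + A1 i l * (if n = 0 then 0 else solSeq A0 A1 Z0 (n - 1) l j) := by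
    intro l
    simp only [Matrix.add_apply, RingHom.mapMatrix_apply, Matrix.map_apply, Matrix.smul_apply, smul_eq_mul,
      add_mul, map_add, PowerSeries.coeff_C_mul, solMat, Matrix.of_apply, PowerSeries.coeff_mk]
    congr 1
    rw [mul_comm PowerSeries.X, mul_assoc, PowerSeries.coeff_C_mul]
    rcases n with _ | n
    · simp
    · simp [PowerSeries.coeff_succ_X_mul]
  rw [Finset.sum_congr rfl fun l _ => hc l, Finset.sum_add_distrib]
  simp only [solMat, Matrix.of_apply, PowerSeries.coeff_mk]
  rcases n with _ | n
  · have := congrFun (congrFun hZ i) j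
    rw [sq_apply, Matrix.mul_apply] at this
    simpa [solSeq] using this
  · have h1 : A0 * solSeq A0 A1 Z0 (n + 1) + A1 * solSeq A0 A1 Z0 n =
        if 2 ∣ (n + 1) then sq (solSeq A0 A1 Z0 ((n + 1) / 2)) else 0 := by
      conv_lhs => rw [solSeq]
      rw [Matrix.mul_nonsing_inv_cancel_left _ _ hA0]; simp
    have h2 := congrFun (congrFun h1 i) j
    rw [Matrix.add_apply, Matrix.mul_apply, Matrix.mul_apply] at h2
    simp only [Nat.add_eq_zero_iff, one_ne_zero, and_false, if_false, Nat.add_sub_cancel]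
    rw [h2]
    split_ifs <;> simp [sq_apply]

lemma solSeq_comm {W : Type} [CommRing W] [CharP W 2] (A0 A1 Z0 : Matrix ι ι W) (a : Matrix ι ι (ZMod 2))
    (h0 : Commute (zm W a) A0⁻¹) (h1 : Commute (zm W a) A1) (hZ : Commute (zm W a) Z0) (n : ℕ) :
    Commute (zm W a) (solSeq A0 A1 Z0 n) := by
  induction n using Nat.strong_induction_on with
  | _ n ih =>
    rcases n with _ | n
    · simpa [solSeq] using hZ
    · rw [solSeq]
      refine h0.mul_right (Commute.sub_right ?_ (h1.mul_right (ih n (by omega))))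
      split_ifs
      · have := (ih ((n + 1) / 2) (by omega)).map (sq (S := W) (ι := ι))
        rwa [sq_zm] at this
      · exact Commute.zero_right _

lemma solMat_comm {W : Type} [Field W] [CharP W 2] (A0 A1 Z0 : Matrix ι ι W) (a : Matrix ι ι (ZMod 2))
    (h0 : Commute (zm W a) A0⁻¹) (h1 : Commute (zm W a) A1) (hZ : Commute (zm W a) Z0) :
    Commute (zm (PowerSeries W) a) (solMat A0 A1 Z0) := by
  have h := solSeq_comm A0 A1 Z0 a h0 h1 hZ
  rw [← map_zm PowerSeries.C]
  ext i j n
  have h2 := congrFun (congrFun (h n) i) j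
  simp only [Matrix.mul_apply, RingHom.mapMatrix_apply, Matrix.map_apply, map_sum, PowerSeries.coeff_C_mul,
    PowerSeries.coeff_mul_C, solMat, Matrix.of_apply, PowerSeries.coeff_mk] at h2 ⊢
  exact h2

end Sark

namespace Sark

variable {ι : Type} [Fintype ι] [DecidableEq ι]

lemma sol_integral {O F : Type} [CommRing O] [Field F] [Algebra O F] [CharP F 2]
    (A : Matrix ι ι O) (Y : Matrix ι ι F) (hY : sq Y = (algebraMap O F).mapMatrix A * Y) (i j : ι) :
    IsIntegral O (Y i j) := by
  let P : Finset ι → F := fun S => ∏ l ∈ S, Y l j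
  let N : Submodule O F := Submodule.span O (Set.range P)
  have hmem : ∀ n : ℕ, ∀ S : Finset ι, S.card = n → ∀ l, Y l j * P S ∈ N := by
    intro n
    induction n with
    | zero =>
      intro S hS l
      rw [Finset.card_eq_zero.1 hS]
      exact Submodule.subset_span ⟨{l}, by simp [P]⟩
    | succ n ih =>
      intro S hS l
      by_cases hl : l ∈ S
      · have h1 : P S = Y l j * P (S.erase l) := (Finset.mul_prod_erase S (fun l => Y l j) hl).symm
        have h2 : Y l j * Y l j = ∑ l', algebraMap O F (A l l') * Y l' j := by
          have := congrFun (congrFun hY l) j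
          rw [sq_apply, Matrix.mul_apply, pow_two] at this
          exact this
        rw [h1, ← mul_assoc, h2, Finset.sum_mul]
        refine Submodule.sum_mem _ fun l' _ => ?_
        rw [mul_assoc, ← Algebra.smul_def]
        exact Submodule.smul_mem _ _ (ih _ (by rw [Finset.card_erase_of_mem hl, hS]; rfl) l')
      · exact Submodule.subset_span ⟨insert l S, by simp [P, Finset.prod_insert hl]⟩
  refine isIntegral_of_smul_mem_submodule N ?_ ?_ (Y i j) ?_
  · intro h
    have : (1 : F) ∈ N := Submodule.subset_span ⟨∅, by simp [P]⟩
    rw [h] at this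
    exact one_ne_zero ((Submodule.mem_bot O).1 this)
  · exact Submodule.fg_span (Set.finite_range P)
  · intro n hn
    induction hn using Submodule.span_induction with
    | mem x hx => obtain ⟨S, rfl⟩ := hx; exact hmem _ S rfl i
    | zero => simp
    | add x y _ _ hx hy => rw [smul_add]; exact N.add_mem hx hy
    | smul a x _ hx => rw [smul_comm]; exact N.smul_mem a hx

def entries {F : Type} (Y : Matrix ι ι F) : Set F := Set.range fun p : ι × ι => Y p.1 p.2

section
variable {O K F : Type} [CommRing O] [Field K] [Field F] [Algebra O K] [Algebra K F] [Algebra O F]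
  [IsScalarTower O K F] [CharP F 2] (A : Matrix ι ι O) (Y : Matrix ι ι F)

lemma sol_finite
    (hY : sq Y = (algebraMap O F).mapMatrix A * Y) (htop : IntermediateField.adjoin K (entries Y) = ⊤) : FiniteDimensional K F := by
  haveI : Finite (entries Y) := Set.finite_range _
  have h := IntermediateField.finiteDimensional_adjoin (K := K) (S := entries Y) (by
    rintro x ⟨p, rfl⟩
    exact (sol_integral A Y hY p.1 p.2).tower_top)
  rw [htop] at h
  exact Module.Finite.equiv (IntermediateField.topEquiv (F := K) (E := F)).toLinearEquiv

lemma sol_sep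
    (hY : sq Y = (algebraMap O F).mapMatrix A * Y) (hdet : Y.det ≠ 0) (htop : IntermediateField.adjoin K (entries Y) = ⊤) : Algebra.IsSeparable K F := by
  have hfin := sol_finite A Y hY htop
  have hadj : Algebra.adjoin K (entries Y) = ⊤ := by
    rw [← IntermediateField.adjoin_toSubalgebra_of_isAlgebraic, htop]
    · rfl
    · intro x _; exact Algebra.IsAlgebraic.isAlgebraic x
  rw [← Algebra.FormallyUnramified.iff_isSeparable, Algebra.formallyUnramified_iff]
  have hD : KaehlerDifferential.D K F = 0 := by
    refine Derivation.ext_of_adjoin_eq_top _ hadj ?_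
    rintro _ ⟨⟨r, j⟩, rfl⟩
    simp only [Derivation.coe_zero, Pi.zero_apply]
    set D := KaehlerDifferential.D K F
    have h1 : ∀ i, ∑ l, algebraMap O F (A i l) • D (Y l j) = 0 := by
      intro i
      have := congrArg D (congrFun (congrFun hY i) j)
      rw [sq_apply, Matrix.mul_apply, map_sum, pow_two, Derivation.leibniz] at this
      rw [← two_smul F, CharTwo.two_eq_zero, zero_smul] at this
      rw [this]
      refine Finset.sum_congr rfl fun l _ => ?_
      rw [Derivation.leibniz]
      change _ = _ + Y l j • D (algebraMap O F (A i l))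
      rw [IsScalarTower.algebraMap_apply O K F, Derivation.map_algebraMap, smul_zero, add_zero]
      simp [IsScalarTower.algebraMap_apply O K F]
    have hdA : ((algebraMap O F).mapMatrix A).det ≠ 0 := by
      rw [← sol_det hY hdet]; exact hdet
    set B := (algebraMap O F).mapMatrix A
    have h2 : B.det • D (Y r j) = 0 := by
      have : ∑ i, B.adjugate r i • ∑ l, B i l • D (Y l j) = 0 := by
        refine Finset.sum_eq_zero fun i _ => ?_
        have := h1 i
        rw [show ∑ l, B i l • D (Y l j) = 0 from this, smul_zero]
      simp only [Finset.smul_sum, smul_smul] at this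
      rw [Finset.sum_comm] at this
      simp only [← Finset.sum_smul] at this
      have h3 : ∀ l, ∑ i, B.adjugate r i * B i l = if r = l then B.det else 0 := by
        intro l
        rw [← Matrix.mul_apply, Matrix.adjugate_mul, Matrix.smul_apply, Matrix.one_apply]
        simp
      simp only [h3, ite_smul, zero_smul] at this
      simpa using this
    exact (smul_eq_zero.1 h2).resolve_left hdA
  have h2 := KaehlerDifferential.span_range_derivation K F
  rw [hD] at h2
  have h3 : (⊤ : Submodule F (KaehlerDifferential K F)) = ⊥ := by
    rw [← h2, Submodule.span_eq_bot]
    rintro x ⟨y, rfl⟩; rfl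
  exact (Submodule.subsingleton_iff F).1 (subsingleton_of_bot_eq_top h3.symm)

/-- two homs agreeing on `O` differ by a matrix over `F_2` on `Y` -/
lemma hom_ratio
    (hY : sq Y = (algebraMap O F).mapMatrix A * Y) (hdet : Y.det ≠ 0) {E : Type} [Field E] [CharP E 2] (f g : F →+* E)
    (hfg : ∀ x, f (algebraMap O F x) = g (algebraMap O F x)) :
    ∃ c, f.mapMatrix Y = g.mapMatrix Y * zm E c := by
  have hg : sq (g.mapMatrix Y) = g.mapMatrix ((algebraMap O F).mapMatrix A) * g.mapMatrix Y := by
    rw [← map_sq, hY, map_mul]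
  have hf : sq (f.mapMatrix Y) = g.mapMatrix ((algebraMap O F).mapMatrix A) * f.mapMatrix Y := by
    rw [← map_sq, hY, map_mul]
    congr 1
    ext i j; exact hfg _
  refine sol_ratio hg hf ?_
  rw [← RingHom.map_det]
  simpa using hdet

lemma fieldRange_le_of_entries
    (htop : IntermediateField.adjoin K (entries Y) = ⊤) {E : Type} [Field E] [Algebra K E] (f : F →ₐ[K] E) (L : IntermediateField K E)
    (h : ∀ i j, f (Y i j) ∈ L) : f.fieldRange ≤ L := by
  rw [AlgHom.fieldRange_eq_map, ← htop, IntermediateField.adjoin_map, IntermediateField.adjoin_le_iff]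
  rintro _ ⟨_, ⟨p, rfl⟩, rfl⟩
  exact h _ _

lemma sol_normal
    (hY : sq Y = (algebraMap O F).mapMatrix A * Y) (hdet : Y.det ≠ 0) (htop : IntermediateField.adjoin K (entries Y) = ⊤) : Normal K F := by
  have hfin := sol_finite A Y hY htop
  let Ω' := AlgebraicClosure F
  let i0 : F →ₐ[K] Ω' := IsScalarTower.toAlgHom K F Ω'
  haveI : IsAlgClosure K Ω' := ⟨inferInstance, Algebra.IsAlgebraic.trans K F Ω'⟩
  haveI : Normal K Ω' := IsAlgClosure.normal K Ω'
  haveI : CharP Ω' 2 := charP_of_injective_algebraMap (algebraMap F Ω').injective 2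
  have h : Normal K i0.fieldRange := by
    rw [IntermediateField.normal_iff_forall_fieldRange_le]
    intro σ
    let e : F ≃ₐ[K] i0.fieldRange := AlgEquiv.ofInjectiveField i0
    have h1 : σ.fieldRange = (σ.comp e.toAlgHom).fieldRange := by
      ext x
      constructor
      · rintro ⟨y, rfl⟩; exact ⟨e.symm y, by simp⟩
      · rintro ⟨y, rfl⟩; exact ⟨e y, rfl⟩
    rw [h1]
    apply fieldRange_le_of_entries Y htop
    obtain ⟨c, hc⟩ := hom_ratio A Y hY hdet (σ.comp e.toAlgHom).toRingHom i0.toRingHom (by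
      intro x
      rw [IsScalarTower.algebraMap_apply O K F]
      simp)
    intro i j
    have := congrFun (congrFun hc i) j
    change (σ.comp e.toAlgHom) (Y i j) = _ at this
    rw [this, Matrix.mul_apply]
    refine sum_mem fun l _ => mul_mem ⟨Y i l, rfl⟩ ?_
    refine ⟨z2 F (c l j), ?_⟩
    rw [← map_zm i0.toRingHom]; rfl
  have e1 : i0.fieldRange ≃ₐ[K] F := (AlgEquiv.ofInjectiveField i0).symm
  exact Normal.of_algEquiv e1

lemma sol_galois
    (hY : sq Y = (algebraMap O F).mapMatrix A * Y) (hdet : Y.det ≠ 0) (htop : IntermediateField.adjoin K (entries Y) = ⊤) : IsGalois K F :=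
  haveI := sol_sep A Y hY hdet htop
  haveI := sol_normal A Y hY hdet htop
  ⟨⟩

lemma exists_cmat
    (hY : sq Y = (algebraMap O F).mapMatrix A * Y) (hdet : Y.det ≠ 0) (σ : F ≃ₐ[K] F) : ∃ c, (σ : F →+* F).mapMatrix Y = Y * zm F c := by
  have := hom_ratio A Y hY hdet (σ : F →+* F) (RingHom.id F) (by
    intro x; rw [IsScalarTower.algebraMap_apply O K F]; simp)
  simpa using this

lemma algHom_ext_of_entries
    (htop : IntermediateField.adjoin K (entries Y) = ⊤) {E : Type} [Field E] [Algebra K E] (f g : F →ₐ[K] E)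
    (h : ∀ i j, f (Y i j) = g (Y i j)) : f = g := by
  have : (⊤ : IntermediateField K F) ≤ IntermediateField.adjoin K (entries Y) := htop.ge
  ext x
  have hx := this (IntermediateField.mem_top (x := x))
  induction hx using IntermediateField.adjoin_induction with
  | mem x hx => obtain ⟨p, rfl⟩ := hx; exact h _ _
  | algebraMap x => simp
  | add x y _ _ hx hy => simp [hx, hy]
  | inv x _ hx => simp [hx]
  | mul x y _ _ hx hy => simp [hx, hy]

end
end Sark

namespace Sark

variable {ι : Type} [Fintype ι] [DecidableEq ι]

lemma lift_integral {R B W : Type} [CommRing R] [CommRing B] [Algebra R B] [Algebra.IsIntegral R B]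
    [Field W] [IsAlgClosed W] (hinj : Function.Injective (algebraMap R B)) (g : R →+* W) :
    ∃ π : B →+* W, ∀ x, π (algebraMap R B x) = g x := by
  have hP : (RingHom.ker g).IsPrime := RingHom.ker_isPrime g
  obtain ⟨Q, -, hQ, hQP⟩ := Ideal.exists_ideal_over_prime_of_isIntegral (S := B) (RingHom.ker g) ⊥ (by
    rw [← RingHom.ker_eq_comap_bot, (RingHom.injective_iff_ker_eq_bot _).1 hinj]; exact bot_le)
  letI : Algebra (R ⧸ RingHom.ker g) (B ⧸ Q) := Ideal.Quotient.algebraQuotientOfLEComap hQP.ge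
  letI : Algebra (R ⧸ RingHom.ker g) W := (RingHom.kerLift g).toAlgebra
  have hi1 : Function.Injective (algebraMap (R ⧸ RingHom.ker g) (B ⧸ Q)) := by
    rw [injective_iff_map_eq_zero]
    intro x hx
    obtain ⟨x, rfl⟩ := Ideal.Quotient.mk_surjective x
    change (Ideal.Quotient.mk Q) (algebraMap R B x) = 0 at hx
    rw [Ideal.Quotient.eq_zero_iff_mem] at hx ⊢
    rw [← hQP]; exact hx
  have hi2 : Function.Injective (algebraMap (R ⧸ RingHom.ker g) W) := RingHom.kerLift_injective g
  haveI : Module.IsTorsionFree (R ⧸ RingHom.ker g) (B ⧸ Q) := Module.isTorsionFree_iff_algebraMap_injective.2 hi1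
  haveI : Module.IsTorsionFree (R ⧸ RingHom.ker g) W := Module.isTorsionFree_iff_algebraMap_injective.2 hi2
  haveI : Algebra.IsIntegral (R ⧸ RingHom.ker g) (B ⧸ Q) := by
    refine ⟨fun x => ?_⟩
    obtain ⟨x, rfl⟩ := Ideal.Quotient.mk_surjective x
    exact (Algebra.IsIntegral.isIntegral (R := R) x).map_of_comp_eq (Ideal.Quotient.mk (RingHom.ker g))
      (Ideal.Quotient.mk Q) rfl
  haveI : Algebra.IsAlgebraic (R ⧸ RingHom.ker g) (B ⧸ Q) := inferInstance
  let l : (B ⧸ Q) →ₐ[R ⧸ RingHom.ker g] W := IsAlgClosed.lift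
  refine ⟨l.toRingHom.comp (Ideal.Quotient.mk Q), fun x => ?_⟩
  exact l.commutes (Ideal.Quotient.mk _ x)

def Amat {k : Type} [Field k] (m : Matrix ι ι k) : Matrix ι ι k[X] :=
  (X : k[X]) • (1 : Matrix ι ι k[X]) + (C : k →+* k[X]).mapMatrix m

/-- `A^{(2^{n-1})} ⋯ A^{(2)} A` -/
def Ap {S : Type} [CommRing S] [CharP S 2] (M : Matrix ι ι S) : ℕ → Matrix ι ι S
  | 0 => 1
  | n + 1 => (sq^[n] M) * Ap M n

lemma Ap_sol {S : Type} [CommRing S] [CharP S 2] {M Z : Matrix ι ι S} (h : sq Z = M * Z) (n : ℕ) :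
    sq^[n] Z = Ap M n * Z := by
  induction n with
  | zero => simp [Ap]
  | succ n ih =>
    rw [Function.iterate_succ_apply, h, iterate_map_mul, ih, Ap, mul_assoc]

lemma sq_iter_apply {S : Type} [CommRing S] [CharP S 2] (M : Matrix ι ι S) (n : ℕ) (i j : ι) :
    sq^[n] M i j = M i j ^ 2 ^ n := by
  induction n with
  | zero => simp
  | succ n ih => rw [Function.iterate_succ_apply', sq_apply, ih, ← pow_mul, pow_succ]

section
variable {k K F W : Type} [Field k] [Field K] [Field F] [Algebra k[X] K] [IsFractionRing k[X] K]
  [Algebra K F] [Algebra k[X] F] [IsScalarTower k[X] K F] [CharP F 2] [CharP k 2]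
  (m : Matrix ι ι k) (Y : Matrix ι ι F)
  [Field W] [IsAlgClosed W] [CharP W 2] [Algebra k W]

def shiftHom (k : Type) {W : Type} [Field k] [Field W] [Algebra k W] (α : W) : k[X] →+* PowerSeries W :=
  (Polynomial.coeToPowerSeries.ringHom).comp ((compRingHom (X + C α)).comp (mapRingHom (algebraMap k W)))

lemma shiftHom_apply (α : W) (p : k[X]) : shiftHom k α p =
    (((p.map (algebraMap k W)).comp (X + C α) : W[X]) : PowerSeries W) := rfl

lemma shiftHom_inj (α : W) : Function.Injective (shiftHom k α) := by
  rw [injective_iff_map_eq_zero]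
  intro p hp
  rw [shiftHom_apply, Polynomial.coe_eq_zero_iff] at hp
  have h2 := congrArg (fun q : W[X] => q.comp (X - C α)) hp
  simp only [comp_assoc, add_comp, X_comp, C_comp, sub_add_cancel, comp_X, zero_comp] at h2
  exact (Polynomial.map_eq_zero _).1 h2

lemma shiftHom_X (α : W) : shiftHom k α X = PowerSeries.X + PowerSeries.C α := by
  simp [shiftHom_apply]

lemma shiftHom_C (α : W) (c : k) : shiftHom k α (C c) = PowerSeries.C (algebraMap k W c) := by
  simp [shiftHom_apply]

lemma shiftHom_Amat (α : W) : (shiftHom k α).mapMatrix (Amat m) =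
    PowerSeries.C.mapMatrix (α • 1 + (algebraMap k W).mapMatrix m) + (PowerSeries.X : PowerSeries W) •
      PowerSeries.C.mapMatrix (1 : Matrix ι ι W) := by
  rw [Amat, map_add, map_add, map_one]
  have h1 : (shiftHom k α).mapMatrix ((X : k[X]) • (1 : Matrix ι ι k[X])) =
      (PowerSeries.C.mapMatrix (α • (1 : Matrix ι ι W))) + (PowerSeries.X : PowerSeries W) •
      (1 : Matrix ι ι (PowerSeries W)) := by
    ext i j : 2
    simp only [RingHom.mapMatrix_apply, Matrix.map_apply, Matrix.smul_apply, Matrix.add_apply, Matrix.one_apply,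
      smul_eq_mul, mul_ite, mul_one, mul_zero]
    split_ifs
    · rw [shiftHom_X, add_comm]
    · simp
  have h2 : (shiftHom k α).mapMatrix ((C : k →+* k[X]).mapMatrix m) =
      PowerSeries.C.mapMatrix ((algebraMap k W).mapMatrix m) := by
    exact Matrix.ext fun i j => shiftHom_C α (m i j)
  rw [h1, h2]; abel

lemma constCoeff_shiftHom_Amat (α : W) : (PowerSeries.constantCoeff (R := W)).mapMatrix
    ((shiftHom k α).mapMatrix (Amat m)) = α • 1 + (algebraMap k W).mapMatrix m := by
  rw [shiftHom_Amat]
  ext i j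
  simp only [map_one, map_add, Matrix.add_apply, RingHom.mapMatrix_apply, Matrix.map_apply, Matrix.smul_apply,
    smul_eq_mul, PowerSeries.constantCoeff_C, PowerSeries.constantCoeff_X, map_mul, zero_mul, add_zero]

lemma exists_local
    (hY : sq Y = (algebraMap k[X] F).mapMatrix (Amat m) * Y) (hdet : Y.det ≠ 0) (htop : IntermediateField.adjoin K (entries Y) = ⊤) (α : W) (hα : (α • 1 + (algebraMap k W).mapMatrix m).det ≠ 0) :
    ∃ f : F →+* LaurentSeries W, ∀ p : k[X], f (algebraMap k[X] F p) =
      HahnSeries.ofPowerSeries ℤ W (shiftHom k α p) := by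
  have hfin := sol_finite (Amat m) Y hY htop
  set M := α • 1 + (algebraMap k W).mapMatrix m with hM
  -- a solution over `W`
  have hinjF : Function.Injective (algebraMap k[X] F) := by
    rw [IsScalarTower.algebraMap_eq k[X] K F]
    exact (algebraMap K F).injective.comp (IsFractionRing.injective k[X] K)
  obtain ⟨Z0, hZ0, hdZ0⟩ : ∃ Z0 : Matrix ι ι W, sq Z0 = M * Z0 ∧ Z0.det ≠ 0 := by
    obtain ⟨π, hπ⟩ := lift_integral (R := k[X]) (B := integralClosure k[X] F) (W := W)
      (fun x y h => hinjF (congrArg Subtype.val h))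
      ((PowerSeries.constantCoeff (R := W)).comp (shiftHom k α))
    let YB : Matrix ι ι (integralClosure k[X] F) := Matrix.of fun i j => ⟨Y i j, sol_integral (Amat m) Y hY i j⟩
    have hYB : ∀ i j, YB i j ^ 2 = ∑ l, algebraMap k[X] (integralClosure k[X] F) (Amat m i l) * YB l j := by
      intro i j
      apply Subtype.ext
      have := congrFun (congrFun hY i) j
      rw [sq_apply, Matrix.mul_apply] at this
      simpa [YB] using this
    have hYBd : YB.det = algebraMap k[X] (integralClosure k[X] F) (Amat m).det := by
      apply Subtype.ext
      have h1 : ((YB.det : integralClosure k[X] F) : F) = Y.det := by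
        change (integralClosure k[X] F).val.toRingHom YB.det = _
        rw [RingHom.map_det]; rfl
      rw [h1, sol_det hY hdet, ← RingHom.map_det]; rfl
    refine ⟨π.mapMatrix YB, ?_, ?_⟩
    · ext i j
      rw [sq_apply, Matrix.mul_apply, RingHom.mapMatrix_apply, Matrix.map_apply, ← map_pow, hYB, map_sum]
      refine Finset.sum_congr rfl fun l _ => ?_
      rw [map_mul, hπ, hM, ← constCoeff_shiftHom_Amat]; rfl
    · rw [← RingHom.map_det, hYBd, hπ, RingHom.map_det, ← RingHom.mapMatrix_comp]
      change ((PowerSeries.constantCoeff (R := W)).mapMatrix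
        ((shiftHom k α).mapMatrix (Amat m))).det ≠ 0
      rw [constCoeff_shiftHom_Amat]; exact hα
  -- lift to power series
  have hsol := solMat_sol M 1 Z0 (isUnit_iff_ne_zero.2 hα) hZ0
  rw [← shiftHom_Amat] at hsol
  let E := LaurentSeries W
  let sh : k[X] →+* E := (HahnSeries.ofPowerSeries ℤ W).comp (shiftHom k α)
  have hsh : Function.Injective sh := HahnSeries.ofPowerSeries_injective.comp (shiftHom_inj α)
  let KE : K →+* E := IsFractionRing.lift hsh
  have hKE : ∀ p, KE (algebraMap k[X] K p) = sh p := fun p => IsFractionRing.lift_algebraMap hsh p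
  haveI : CharP E 2 := charP_of_injective_ringHom (f := HahnSeries.ofPowerSeries ℤ W)
    HahnSeries.ofPowerSeries_injective 2
  letI : Algebra K E := KE.toAlgebra
  let Ec := AlgebraicClosure E
  haveI : CharP Ec 2 := charP_of_injective_algebraMap (algebraMap E Ec).injective 2
  let g : F →ₐ[K] Ec := IsAlgClosed.lift
  let Yh : Matrix ι ι Ec := (algebraMap E Ec).mapMatrix ((HahnSeries.ofPowerSeries ℤ W).mapMatrix (solMat M 1 Z0))
  have hYh : sq Yh = (algebraMap E Ec).mapMatrix (sh.mapMatrix (Amat m)) * Yh := by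
    change sq ((algebraMap E Ec).mapMatrix ((HahnSeries.ofPowerSeries ℤ W).mapMatrix (solMat M 1 Z0))) = _
    rw [← map_sq, ← map_sq, hsol, map_mul, map_mul]
    rfl
  have hgY : sq (g.toRingHom.mapMatrix Y) = (algebraMap E Ec).mapMatrix (sh.mapMatrix (Amat m)) *
      (g.toRingHom.mapMatrix Y) := by
    rw [← map_sq, hY, map_mul]
    congr 1
    ext i j
    change g (algebraMap k[X] F (Amat m i j)) = algebraMap E Ec (sh (Amat m i j))
    rw [IsScalarTower.algebraMap_apply k[X] K F, AlgHom.commutes, IsScalarTower.algebraMap_apply K E Ec]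
    congr 1
    exact hKE _
  have hYhd : Yh.det ≠ 0 := by
    change ((algebraMap E Ec).mapMatrix ((HahnSeries.ofPowerSeries ℤ W).mapMatrix (solMat M 1 Z0))).det ≠ 0
    rw [← RingHom.map_det, ← RingHom.map_det]
    intro h
    have h1 : (solMat M 1 Z0).det = 0 := by
      apply HahnSeries.ofPowerSeries_injective (Γ := ℤ)
      apply (algebraMap E Ec).injective
      rw [h]; simp
    apply hdZ0
    have h2 := congrArg (PowerSeries.constantCoeff (R := W)) h1
    rw [RingHom.map_det, map_zero] at h2
    rw [← h2]
    congr 1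
    ext i j
    simp [solMat, solSeq, ← PowerSeries.coeff_zero_eq_constantCoeff_apply]
  obtain ⟨c, hc⟩ := sol_ratio hYh hgY hYhd
  let i0 : E →ₐ[K] Ec := IsScalarTower.toAlgHom K E Ec
  have hle : g.fieldRange ≤ i0.fieldRange := by
    apply fieldRange_le_of_entries Y htop
    intro i j
    have := congrFun (congrFun hc i) j
    change g (Y i j) = _ at this
    rw [this, Matrix.mul_apply]
    refine sum_mem fun l _ => mul_mem ⟨_, rfl⟩ ⟨z2 E (c l j), ?_⟩
    rw [← map_zm i0.toRingHom]; rfl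
  let e : E ≃ₐ[K] i0.fieldRange := AlgEquiv.ofInjectiveField i0
  let f : F →ₐ[K] E := (e.symm.toAlgHom.comp (IntermediateField.inclusion hle)).comp g.rangeRestrict
  refine ⟨f.toRingHom, fun p => ?_⟩
  change f _ = sh p
  rw [IsScalarTower.algebraMap_apply k[X] K F, AlgHom.commutes]
  exact hKE p

lemma exists_frob
    (hY : sq Y = (algebraMap k[X] F).mapMatrix (Amat m) * Y) (hdet : Y.det ≠ 0) (htop : IntermediateField.adjoin K (entries Y) = ⊤) (e : ℕ) (hk : ∀ x : k, x ^ 2 ^ e = x) (α : W) (hQ : α ^ 2 ^ e = α)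
    (hα : (α • 1 + (algebraMap k W).mapMatrix m).det ≠ 0) :
    ∃ σ : F ≃ₐ[K] F, ∃ ρ : integralClosure k[X] F →+* PowerSeries W,
      (∀ p, ρ (algebraMap k[X] _ p) = shiftHom k α p) ∧
      (∀ b b' : integralClosure k[X] F, (b' : F) = σ b →
        PowerSeries.constantCoeff (ρ b') = PowerSeries.constantCoeff (ρ b) ^ 2 ^ e) ∧
      (∀ a : Matrix ι ι (ZMod 2), Commute (zm F a) Y →
        Ap (α • 1 + (algebraMap k W).mapMatrix m) e = zm W a →
        (σ : F →+* F).mapMatrix Y = Y * zm F a) := by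
  have hfin := sol_finite (Amat m) Y hY htop
  have hnorm := sol_normal (Amat m) Y hY hdet htop
  obtain ⟨f, hf⟩ := exists_local m Y hY hdet htop α hα
  let E := LaurentSeries W
  haveI : CharP E 2 := charP_of_injective_ringHom (f := HahnSeries.ofPowerSeries ℤ W)
    HahnSeries.ofPowerSeries_injective 2
  let fr : PowerSeries W →+* PowerSeries W := PowerSeries.map (iterateFrobenius W 2 e)
  have hfr : Function.Injective fr := PowerSeries.map_injective _ (RingHom.injective _)
  have hfr0 : ∀ x, PowerSeries.constantCoeff (fr x) = PowerSeries.constantCoeff x ^ 2 ^ e := by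
    intro x
    rw [← PowerSeries.coeff_zero_eq_constantCoeff_apply, PowerSeries.coeff_map,
      PowerSeries.coeff_zero_eq_constantCoeff_apply, iterateFrobenius_def]
  have hfrsh : ∀ p, fr (shiftHom k α p) = shiftHom k α p := by
    have : fr.comp (shiftHom k α) = shiftHom k α := by
      apply Polynomial.ringHom_ext
      · intro c
        rw [RingHom.comp_apply, shiftHom_C]
        simp only [fr, PowerSeries.map_C, iterateFrobenius_def]
        rw [← map_pow, hk]
      · rw [RingHom.comp_apply, shiftHom_X]
        simp only [fr, map_add, PowerSeries.map_C, iterateFrobenius_def, PowerSeries.map_X, hQ]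
    exact fun p => congrArg (fun h => h p) this
  let ψ : E →+* E := IsFractionRing.map (K := E) (L := E) hfr
  have hψ : ∀ x, ψ (HahnSeries.ofPowerSeries ℤ W x) = HahnSeries.ofPowerSeries ℤ W (fr x) := by
    intro x
    exact IsLocalization.map_eq _ x
  letI : Algebra F E := f.toAlgebra
  letI : Algebra K E := (f.comp (algebraMap K F)).toAlgebra
  haveI : IsScalarTower K F E := IsScalarTower.of_algebraMap_eq' rfl
  have hKcomm : ψ.comp (algebraMap K E) = algebraMap K E := by
    apply IsFractionRing.injective_comp_algebraMap (A := k[X])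
    refine RingHom.ext fun p => ?_
    change ψ (f (algebraMap K F (algebraMap k[X] K p))) = f (algebraMap K F (algebraMap k[X] K p))
    rw [← IsScalarTower.algebraMap_apply, hf, hψ, hfrsh]
  let ψA : E →ₐ[K] E := { ψ with commutes' := fun r => congrArg (fun h => h r) hKcomm }
  let σ : F ≃ₐ[K] F := ψA.restrictNormal' F
  have hσ : ∀ x, f (σ x) = ψ (f x) := fun x => AlgHom.restrictNormal_commutes ψA F x
  have hintg : ∀ b : integralClosure k[X] F, ∃ y : PowerSeries W, HahnSeries.ofPowerSeries ℤ W y = f b := by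
    intro b
    have h1 : IsIntegral (PowerSeries W) (f b : E) := by
      refine IsIntegral.map_of_comp_eq (R := k[X]) (shiftHom k α) f ?_ b.2
      exact RingHom.ext fun p => (hf p).symm
    obtain ⟨y, hy⟩ := (IsIntegrallyClosed.isIntegral_iff (R := PowerSeries W)).1 h1
    exact ⟨y, hy⟩
  choose r hr using hintg
  have hinj := HahnSeries.ofPowerSeries_injective (Γ := ℤ) (R := W)
  let ρ : integralClosure k[X] F →+* PowerSeries W :=
    { toFun := r
      map_one' := hinj (by rw [hr]; simp)
      map_zero' := hinj (by rw [hr]; simp)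
      map_mul' := fun x y => hinj (by rw [map_mul, hr, hr, hr]; simp)
      map_add' := fun x y => hinj (by rw [map_add, hr, hr, hr]; simp) }
  have hρ : ∀ b, HahnSeries.ofPowerSeries ℤ W (ρ b) = f b := hr
  have hρσ : ∀ b b' : integralClosure k[X] F, (b' : F) = σ b → ρ b' = fr (ρ b) := by
    intro b b' h
    apply hinj
    rw [hρ, ← hψ, hρ, h, hσ]
  refine ⟨σ, ρ, ?_, ?_, ?_⟩
  · intro p
    apply hinj
    rw [hρ, ← hf]; rfl
  · intro b b' h
    rw [hρσ b b' h, hfr0]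
  · intro a ha hAp
    obtain ⟨c, hc⟩ := exists_cmat (Amat m) Y hY hdet σ
    rw [hc]
    let YB : Matrix ι ι (integralClosure k[X] F) := Matrix.of fun i j => ⟨Y i j, sol_integral (Amat m) Y hY i j⟩
    let Yp : Matrix ι ι (PowerSeries W) := ρ.mapMatrix YB
    have hYp : (HahnSeries.ofPowerSeries ℤ W).mapMatrix Yp = f.mapMatrix Y := by
      exact Matrix.ext fun i j => hρ _
    have hmi : ∀ A B : Matrix ι ι (PowerSeries W), (HahnSeries.ofPowerSeries ℤ W).mapMatrix A =
        (HahnSeries.ofPowerSeries ℤ W).mapMatrix B → A = B := by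
      intro A B h
      exact Matrix.ext fun i j => hinj (congrFun (congrFun h i) j)
    have h1 : fr.mapMatrix Yp = Yp * zm _ c := by
      apply hmi
      rw [map_mul, hYp, map_zm, ← map_zm f, ← map_mul, ← hc]
      refine Matrix.ext fun i j => ?_
      change HahnSeries.ofPowerSeries ℤ W (fr (ρ (YB i j))) = f (σ (Y i j))
      rw [← hψ, hρ, hσ]; rfl
    have h2 : Commute (zm (PowerSeries W) a) Yp := by
      apply hmi
      rw [map_mul, map_mul, hYp, map_zm, ← map_zm f, ← map_mul, ← map_mul, ha]
    have h3 : sq Yp = (shiftHom k α).mapMatrix (Amat m) * Yp := by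
      apply hmi
      rw [map_sq, map_mul, hYp, ← map_sq, hY, map_mul]
      congr 1
      exact Matrix.ext fun i j => hf _
    let cc := PowerSeries.constantCoeff (R := W)
    set M := α • 1 + (algebraMap k W).mapMatrix m with hM
    let Z := cc.mapMatrix Yp
    have h4 : sq Z = M * Z := by
      change sq (cc.mapMatrix Yp) = _
      rw [← map_sq, h3, map_mul, constCoeff_shiftHom_Amat]
    have h5 : Commute (zm W a) Z := by
      have := h2.map cc.mapMatrix
      rwa [map_zm] at this
    have h6 : sq^[e] Z = Z * zm W c := by
      have := congrArg cc.mapMatrix h1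
      rw [map_mul, map_zm] at this
      change _ = cc.mapMatrix Yp * zm W c
      rw [← this]
      ext i j
      rw [sq_iter_apply]
      exact (hfr0 _).symm
    rw [Ap_sol h4, hAp, h5] at h6
    have hYpd : Yp.det = ((shiftHom k α).mapMatrix (Amat m)).det := by
      refine sol_det h3 ?_
      intro h
      have := congrArg (HahnSeries.ofPowerSeries ℤ W) h
      rw [RingHom.map_det, hYp, ← RingHom.map_det, map_zero] at this
      exact hdet (f.injective (by rw [this, map_zero]))
    have h7 : IsUnit Z.det := by
      have := congrArg cc hYpd
      rw [RingHom.map_det, RingHom.map_det] at this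
      change IsUnit ((cc.mapMatrix Yp).det)
      rw [this, constCoeff_shiftHom_Amat]
      exact isUnit_iff_ne_zero.2 hα
    have h8 := congrArg (fun T => Z⁻¹ * T) h6
    simp only [Matrix.nonsing_inv_mul_cancel_left _ _ h7] at h8
    rw [zm_inj h8]
end
end Sark

namespace Sark

variable {ι : Type} [Fintype ι] [DecidableEq ι]

def ThmA {k : Type} [Field k] [Fintype k] [CharP k 2] (m : Matrix ι ι k) : Prop :=
  ∃ (D : Finset (Matrix ι ι (ZMod 2))) (C0 e0 : ℕ), 1 ∈ D ∧ (∀ a ∈ D, ∀ b ∈ D, a * b ∈ D) ∧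
    ∀ (W : Type) [Field W] [IsAlgClosed W] [CharP W 2] [Algebra k W] (e n : ℕ), e0 ≤ e →
      Fintype.card k ^ e = 2 ^ n → ∀ a : Matrix ι ι (ZMod 2), Commute (zm k a) m →
      ∀ T : Finset W, T.Nonempty → (∀ α ∈ T, α ^ 2 ^ (n + n) = α ∧
        (α • 1 + (algebraMap k W).mapMatrix m).det ≠ 0 ∧
        Ap (α • 1 + (algebraMap k W).mapMatrix m) (n + n) = zm W a) →
      a ∈ D ∧ D.card * T.card ≤ 2 ^ n * 2 ^ n + C0 * 2 ^ n

lemma thmA_abstract {k K F : Type} [Field k] [Fintype k] [CharP k 2] [Field K] [Field F] [Algebra k[X] K]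
    [IsFractionRing k[X] K]
    [Algebra K F] [Algebra k[X] F] [IsScalarTower k[X] K F] [CharP F 2]
    (m : Matrix ι ι k) (Y : Matrix ι ι F)
    (hY : sq Y = (algebraMap k[X] F).mapMatrix (Amat m) * Y) (hdet : Y.det ≠ 0)
    (htop : IntermediateField.adjoin K (entries Y) = ⊤)
    (iot : F →+* LaurentSeries k) (hiot : ∀ p, iot (algebraMap k[X] F p) = evInf p)
    (hcomm : ∀ a, Commute (zm k a) m → Commute (zm F a) Y) : ThmA m := by
  have hfin := sol_finite (Amat m) Y hY htop
  have hgal := sol_galois (Amat m) Y hY hdet htop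
  let G := F ≃ₐ[K] F
  let B := integralClosure k[X] F
  letI : Algebra k B := ((algebraMap k[X] B).comp C).toAlgebra
  haveI : IsScalarTower k k[X] B := IsScalarTower.of_algebraMap_eq' rfl
  have hYu : IsUnit Y.det := isUnit_iff_ne_zero.2 hdet
  have hcan : ∀ c d, Y * zm F c = Y * zm F d → c = d := by
    intro c d h
    have h8 := congrArg (fun T => Y⁻¹ * T) h
    simp only [Matrix.nonsing_inv_mul_cancel_left _ _ hYu] at h8
    exact zm_inj h8
  have hex : ∀ σ : G, ∃ c, (σ : F →+* F).mapMatrix Y = Y * zm F c := exists_cmat (Amat m) Y hY hdet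
  choose c hc using hex
  have hcinj : Function.Injective c := by
    intro σ τ h
    have h1 : (σ : F →+* F).mapMatrix Y = (τ : F →+* F).mapMatrix Y := by rw [hc, hc, h]
    have := algHom_ext_of_entries (K := K) Y htop (σ : F →ₐ[K] F) (τ : F →ₐ[K] F)
      (fun i j => congrFun (congrFun h1 i) j)
    ext x
    exact congrArg (fun f => f x) this
  have hmul : ∀ σ τ : G, ((σ * τ : G) : F →+* F).mapMatrix Y = (σ : F →+* F).mapMatrix ((τ : F →+* F).mapMatrix Y) :=
    fun σ τ => rfl
  have hcmul : ∀ σ τ, c (σ * τ) = c σ * c τ := by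
    intro σ τ
    apply hcan
    rw [← hc, hmul, hc τ, map_mul, hc σ, map_zm, map_mul, mul_assoc]
  have hcone : c 1 = 1 := by
    apply hcan
    rw [← hc, map_one, mul_one]; rfl
  -- Stepanov data
  obtain ⟨s, bas, hbas⟩ := FiniteDimensional.exists_is_basis_integral k[X] K F
  have hcard : Fintype.card s = Fintype.card G := by
    rw [← Nat.card_eq_fintype_card (α := G), IsGalois.card_aut_eq_finrank, Module.finrank_eq_card_basis bas]
  let en : Fin (Fintype.card G) ≃ s := (finCongr hcard.symm).trans (Fintype.equivFin s).symm
  let S : StepData k B G :=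
    { act := { toFun := fun g => (galRestrict k[X] K F B g : B →ₐ[k[X]] B)
               map_one' := by ext x; simp
               map_mul' := fun x y => by ext x; simp }
      iot := iot.comp (algebraMap B F)
      iot_inj := iot.injective.comp Subtype.val_injective
      iot_poly := fun p => hiot p
      norm_poly := fun b => ⟨_, (prod_galRestrict_eq_norm k[X] K F B b).symm⟩
      beta := fun i => ⟨bas (en i), hbas _⟩
      beta_ind := by
        have h1 : LinearIndependent k[X] (fun i => bas (en i)) :=
          (bas.linearIndependent.comp en en.injective).restrict_scalars' k[X]
        refine LinearIndependent.of_comp (B.val.toLinearMap) ?_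
        exact h1 }
  have hS : ∀ g b, ((S.act g b : B) : F) = g b := fun g b => algebraMap_galRestrict_apply k[X] g b
  obtain ⟨C0, e0, hst⟩ := S.stepanov
  refine ⟨Finset.univ.image c, C0, e0, ?_, ?_, ?_⟩
  · exact Finset.mem_image.2 ⟨1, Finset.mem_univ _, hcone⟩
  · intro a ha b hb
    obtain ⟨σ, -, rfl⟩ := Finset.mem_image.1 ha
    obtain ⟨τ, -, rfl⟩ := Finset.mem_image.1 hb
    exact Finset.mem_image.2 ⟨σ * τ, Finset.mem_univ _, hcmul _ _⟩
  · intro W _ _ _ _ e n he hen a ha T hTne hT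
    have hk : ∀ x : k, x ^ 2 ^ (n + n) = x := by
      intro x
      rw [pow_add, ← hen, ← pow_add, FiniteField.pow_card_pow]
    have hYa := hcomm a ha
    have hloc : ∀ α ∈ T, ∃ σ : G, c σ = a ∧ ∃ ρ : B →+* PowerSeries W,
      (∀ p, ρ (algebraMap k[X] _ p) = shiftHom k α p) ∧
      (∀ b b' : B, (b' : F) = σ b →
        PowerSeries.constantCoeff (ρ b') = PowerSeries.constantCoeff (ρ b) ^ 2 ^ (n + n)) := by
      intro α hα
      obtain ⟨h1, h2, h3⟩ := hT α hα
      obtain ⟨σ, ρ, hρ1, hρ2, hρ3⟩ := exists_frob m Y hY hdet htop (n + n) hk α h1 h2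
      refine ⟨σ, ?_, ρ, hρ1, hρ2⟩
      apply hcan
      rw [← hρ3 a hYa h3, hc]
    obtain ⟨α0, hα0⟩ := hTne
    obtain ⟨τ, hτa, -⟩ := hloc α0 hα0
    refine ⟨Finset.mem_image.2 ⟨τ, Finset.mem_univ _, hτa⟩, ?_⟩
    rw [Finset.card_image_of_injective _ hcinj, Finset.card_univ]
    refine hst e n he hen τ ?_ W T ?_
    · intro g
      apply hcinj
      rw [hcmul, hcmul, hτa]
      apply hcan
      have h1 := hYa.map (g : F →+* F).mapMatrix
      rw [map_zm, hc] at h1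
      have h2 : zm F a * (Y * zm F (c g)) = Y * zm F (c g) * zm F a := h1
      rw [map_mul, map_mul, ← mul_assoc, ← hYa.eq, mul_assoc, h2, mul_assoc]
    · intro α hα
      obtain ⟨σ, hσ, ρ, h1, h2⟩ := hloc α hα
      obtain rfl : σ = τ := hcinj (hσ.trans hτa.symm)
      refine ⟨ρ, h1, fun b => ?_⟩
      rw [h2 b (S.act σ b) (hS σ b), pow_add]

theorem thmA {k : Type} [Field k] [Fintype k] [CharP k 2] (m : Matrix ι ι k) : ThmA m := by
  let L := LaurentSeries k
  let K := FractionRing k[X]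
  let ev : k[X] →+* L := eval₂RingHom HahnSeries.C (tinv k)
  have hev : Function.Injective ev := by
    rw [injective_iff_map_eq_zero]
    intro p hp
    apply aeval_tinv_eq_zero
    change ge (ev p) 1
    rw [hp]; exact ge_zero _
  let KL : K →+* L := IsFractionRing.lift hev
  letI : Algebra K L := KL.toAlgebra
  have hKL : ∀ p, algebraMap K L (algebraMap k[X] K p) = ev p := fun p => IsFractionRing.lift_algebraMap hev p
  haveI : CharP L 2 := charP_of_injective_ringHom (f := HahnSeries.ofPowerSeries ℤ k)
    HahnSeries.ofPowerSeries_injective 2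
  have h1sol : sq (1 : Matrix ι ι k) = 1 * 1 := by rw [map_one, mul_one]
  let Z := solMat (1 : Matrix ι ι k) m 1
  have hZ := solMat_sol (1 : Matrix ι ι k) m 1 (by simp) h1sol
  let po := HahnSeries.ofPowerSeries ℤ k
  let YL : Matrix ι ι L := tinv k • po.mapMatrix Z
  have htX : tinv k * po PowerSeries.X = 1 := by
    change tinv k * HahnSeries.ofPowerSeries ℤ k PowerSeries.X = 1
    rw [HahnSeries.ofPowerSeries_X, tinv, HahnSeries.single_mul_single]
    simp
  have ht0 : tinv k ≠ 0 := left_ne_zero_of_mul (htX.symm ▸ one_ne_zero)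
  have hYL : sq YL = ev.mapMatrix (Amat m) * YL := by
    have h1 : sq YL = (tinv k) ^ 2 • po.mapMatrix (sq Z) := by
      rw [map_sq]
      ext i j : 2
      simp only [sq_apply, YL, Matrix.smul_apply, smul_eq_mul, mul_pow]
    have h2 : ev.mapMatrix (Amat m) = tinv k • po.mapMatrix (PowerSeries.C.mapMatrix (1 : Matrix ι ι k) + (PowerSeries.X : PowerSeries k) • PowerSeries.C.mapMatrix m) := by
      rw [Amat, map_add, map_add, smul_add, map_one, map_one]
      congr 1
      · refine Matrix.ext fun i j => ?_
        simp only [RingHom.mapMatrix_apply, Matrix.map_apply, Matrix.smul_apply, Matrix.one_apply, smul_eq_mul,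
          mul_ite, mul_one, mul_zero]
        split_ifs
        · simp [ev]
        · simp
      · refine Matrix.ext fun i j => ?_
        simp only [RingHom.mapMatrix_apply, Matrix.map_apply, Matrix.smul_apply, smul_eq_mul, map_mul]
        rw [← mul_assoc, htX, one_mul]
        simp [ev, po]
        rfl
    rw [h1, hZ, map_mul, h2, Matrix.smul_mul, Matrix.mul_smul, smul_smul, pow_two]
  have hYLd : YL.det ≠ 0 := by
    change (tinv k • po.mapMatrix Z).det ≠ 0
    rw [Matrix.det_smul, ← RingHom.map_det]
    refine mul_ne_zero (pow_ne_zero _ ht0) ?_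
    intro h
    have h1 : Z.det = 0 := HahnSeries.ofPowerSeries_injective (Γ := ℤ) (by rw [map_zero]; exact h)
    have h2 := congrArg (PowerSeries.constantCoeff (R := k)) h1
    rw [RingHom.map_det, map_zero] at h2
    have h3 : (PowerSeries.constantCoeff (R := k)).mapMatrix Z = 1 := by
      ext i j
      simp [Z, solMat, solSeq, ← PowerSeries.coeff_zero_eq_constantCoeff_apply]
    rw [h3] at h2
    simp at h2
  let F := IntermediateField.adjoin K (entries YL)
  let Y : Matrix ι ι F := Matrix.of fun i j => ⟨YL i j, IntermediateField.subset_adjoin K _ ⟨(i, j), rfl⟩⟩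
  letI : Algebra k[X] F := ((algebraMap K F).comp (algebraMap k[X] K)).toAlgebra
  haveI : IsScalarTower k[X] K F := IsScalarTower.of_algebraMap_eq' rfl
  let io : F →+* L := algebraMap F L
  have hio : Function.Injective io := io.injective
  haveI : CharP F 2 := (RingHom.charP_iff io hio 2).2 inferInstance
  have hioY : io.mapMatrix Y = YL := rfl
  have hiop : ∀ p, io (algebraMap k[X] F p) = ev p := by
    intro p
    rw [← hKL]; rfl
  have hmi : ∀ A B : Matrix ι ι F, io.mapMatrix A = io.mapMatrix B → A = B := by
    intro A B h
    exact Matrix.ext fun i j => hio (congrFun (congrFun h i) j)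
  refine thmA_abstract (K := K) (F := F) m Y ?_ ?_ ?_ io hiop ?_
  · apply hmi
    rw [map_sq, map_mul, hioY, hYL]
    congr 1
    exact Matrix.ext fun i j => (hiop _).symm
  · intro h
    apply hYLd
    rw [← hioY, ← RingHom.map_det, h, map_zero]
  · apply IntermediateField.map_injective F.val
    rw [IntermediateField.adjoin_map, ← AlgHom.fieldRange_eq_map, IntermediateField.fieldRange_val]
    congr 1
    ext x
    constructor
    · rintro ⟨_, ⟨p, rfl⟩, rfl⟩; exact ⟨p, rfl⟩
    · rintro ⟨p, rfl⟩; exact ⟨_, ⟨p, rfl⟩, rfl⟩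
  · intro a ha
    apply hmi
    rw [map_mul, map_mul, hioY, map_zm]
    have h1 := solMat_comm (1 : Matrix ι ι k) m 1 a (by simp) ha (Commute.one_right _)
    have h2 := h1.map po.mapMatrix
    rw [map_zm] at h2
    change zm L a * (tinv k • po.mapMatrix Z) = (tinv k • po.mapMatrix Z) * zm L a
    rw [Matrix.mul_smul, Matrix.smul_mul]
    exact congrArg _ h2

end Sark

namespace Sark

variable {ι : Type} [Fintype ι] [DecidableEq ι]

section
variable {S : Type} [CommRing S] [CharP S 2]

lemma map_sq_iter {T : Type} [CommRing T] [CharP T 2] (f : S →+* T) (Y : Matrix ι ι S) (n : ℕ) :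
    f.mapMatrix (sq^[n] Y) = sq^[n] (f.mapMatrix Y) := by
  induction n with
  | zero => rfl
  | succ n ih => rw [Function.iterate_succ_apply', Function.iterate_succ_apply', map_sq, ih]

lemma map_Ap {T : Type} [CommRing T] [CharP T 2] (f : S →+* T) (Y : Matrix ι ι S) (n : ℕ) :
    f.mapMatrix (Ap Y n) = Ap (f.mapMatrix Y) n := by
  induction n with
  | zero => simp [Ap]
  | succ n ih => rw [Ap, Ap, map_mul, ih, map_sq_iter]

lemma Ap_add (M : Matrix ι ι S) (a b : ℕ) : Ap M (a + b) = sq^[b] (Ap M a) * Ap M b := by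
  induction a with
  | zero => simp [Ap, iterate_map_one]
  | succ a ih =>
    rw [show a + 1 + b = (a + b) + 1 by ring, Ap, ih, Ap, iterate_map_mul, ← mul_assoc, mul_assoc,
      ← Function.iterate_add_apply, mul_assoc, add_comm b a]

lemma Ap_period (M : Matrix ι ι S) (b : ℕ) (h : sq^[b] M = M) (l : ℕ) : Ap M (b * l) = (Ap M b) ^ l := by
  have h1 : ∀ a, sq^[b] (Ap M a) = Ap M a := by
    intro a
    induction a with
    | zero => simp [Ap, iterate_map_one]
    | succ a ih => rw [Ap, iterate_map_mul, ih, ← Function.iterate_add_apply, add_comm,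
        Function.iterate_add_apply, h]
  induction l with
  | zero => simp [Ap]
  | succ l ih => rw [mul_add, mul_one, Ap_add, h1, ih, pow_succ]

lemma Ap_smul (c : S) (M : Matrix ι ι S) (n : ℕ) : Ap (c • M) n = c ^ (2 ^ n - 1) • Ap M n := by
  induction n with
  | zero => simp [Ap]
  | succ n ih =>
    have h1 : sq^[n] (c • M) = c ^ 2 ^ n • sq^[n] M := by
      ext i j; simp [sq_iter_apply, mul_pow]
    rw [Ap, ih, h1, Ap, Matrix.smul_mul, Matrix.mul_smul, smul_smul, ← pow_add]
    congr 2
    have : 1 ≤ 2 ^ n := Nat.one_le_two_pow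
    rw [pow_succ]; omega

lemma Ap_mul {A B : Matrix ι ι S} (h : ∀ i j, Commute (sq^[i] A) (sq^[j] B)) (n : ℕ) :
    Ap (A * B) n = Ap A n * Ap B n := by
  have h1 : ∀ i n, Commute (Ap A n) (sq^[i] B) := by
    intro i n
    induction n with
    | zero => simp [Ap]
    | succ n ih => rw [Ap]; exact (h n i).mul_left ih
  induction n with
  | zero => simp [Ap]
  | succ n ih =>
    rw [Ap, Ap, Ap, ih, iterate_map_mul, mul_assoc, mul_assoc, ← mul_assoc (sq^[n] B), ← (h1 n n).eq, mul_assoc]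

lemma det_sq_iter (M : Matrix ι ι S) (n : ℕ) : (sq^[n] M).det = M.det ^ 2 ^ n := by
  induction n with
  | zero => simp
  | succ n ih => rw [Function.iterate_succ_apply', det_sq, ih, ← pow_mul, pow_succ]

lemma det_Ap (M : Matrix ι ι S) (n : ℕ) : (Ap M n).det = M.det ^ (2 ^ n - 1) := by
  induction n with
  | zero => simp [Ap]
  | succ n ih =>
    rw [Ap, Matrix.det_mul, ih, det_sq_iter, ← pow_add]
    congr 1
    have : 1 ≤ 2 ^ n := Nat.one_le_two_pow
    rw [pow_succ]; omega

lemma sq_iter_zm (c : Matrix ι ι (ZMod 2)) (n : ℕ) : sq^[n] (zm S c) = zm S c := by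
  induction n with
  | zero => rfl
  | succ n ih => rw [Function.iterate_succ_apply, sq_zm, ih]

/-- homogenized evaluation -/
def homv {M : Type} [Ring M] [Module S M] (n : ℕ) (f : S[X]) (x z : M) : M :=
  ∑ i ∈ Finset.range (n + 1), f.coeff i • (x ^ i * z ^ (n - i))

lemma homv_mul {S : Type} [CommRing S] {M : Type} [Ring M] [Algebra S M] (n : ℕ) (f : S[X]) (x z : M) (hxz : Commute x z) (β : S)
    (hf : f.natDegree ≤ n) :
    homv (n + 1) (f * (X - C β)) x z = (x - β • z) * homv n f x z := by
  have hc : ∀ i, (f * (X - C β)).coeff i = (f * X).coeff i - β * f.coeff i := by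
    intro i; rw [mul_sub, coeff_sub, coeff_mul_C, mul_comm β]
  simp only [homv, hc, sub_smul, Finset.sum_sub_distrib, sub_mul]
  congr 1
  · rw [Finset.sum_range_succ', Finset.mul_sum]
    simp only [coeff_mul_X, coeff_mul_X_zero, mul_coeff_zero, coeff_X_zero, mul_zero, zero_smul, add_zero]
    refine Finset.sum_congr rfl fun i hi => ?_
    rw [mul_smul_comm, ← mul_assoc, ← pow_succ', Nat.add_sub_add_right]
  · rw [Finset.sum_range_succ, coeff_eq_zero_of_natDegree_lt (by omega : f.natDegree < n + 1), mul_zero, zero_smul,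
      add_zero, Finset.mul_sum]
    refine Finset.sum_congr rfl fun i hi => ?_
    have : i ≤ n := by simpa [Nat.lt_succ_iff] using hi
    rw [mul_smul_comm, smul_mul_assoc, ← mul_assoc, ← (hxz.pow_left i).eq, mul_assoc, ← pow_succ', smul_smul,
      mul_comm β, show n + 1 - i = n - i + 1 by omega]

end

abbrev Wc := AlgebraicClosure (ZMod 2)

instance : CharP Wc 2 := charP_of_injective_algebraMap (algebraMap (ZMod 2) Wc).injective 2

/-- elements of `F_{2^n}` -/
def Tn (n : ℕ) : Finset Wc := (X ^ 2 ^ n - X : Wc[X]).roots.toFinset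

lemma mem_Tn {n : ℕ} (hn : n ≠ 0) (α : Wc) : α ∈ Tn n ↔ α ^ 2 ^ n = α := by
  rw [Tn, Multiset.mem_toFinset, mem_roots (FiniteField.X_pow_card_pow_sub_X_ne_zero Wc hn one_lt_two)]
  simp [sub_eq_zero]

lemma card_Tn {n : ℕ} (hn : n ≠ 0) : (Tn n).card = 2 ^ n := by
  rw [Tn, Multiset.toFinset_card_of_nodup]
  · rw [← (IsAlgClosed.splits _).natDegree_eq_card_roots,
      FiniteField.X_pow_card_pow_sub_X_natDegree_eq Wc hn one_lt_two]
  · exact nodup_roots (galois_poly_separable 2 (2 ^ n) (dvd_pow_self 2 hn))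

lemma homv_prod (Ξ Z : Matrix ι ι Wc) (hc : Commute Ξ Z) (α : Wc) (hΞ : sq Ξ = Ξ) (hZ : sq Z = Z) (n : ℕ) :
    homv n (∏ i ∈ Finset.range n, (X - C (α ^ 2 ^ i)) : Wc[X]) Ξ Z = Ap (Ξ + α • Z) n := by
  induction n with
  | zero => simp [homv, Ap]
  | succ n ih =>
    rw [Finset.prod_range_succ, homv_mul _ _ _ _ hc, ih, Ap]
    · congr 1
      have h1 : sq^[n] Ξ = Ξ := Function.iterate_fixed hΞ n
      have h2 : sq^[n] Z = Z := Function.iterate_fixed hZ n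
      have h3 : sq^[n] (α • Z) = α ^ 2 ^ n • sq^[n] Z := by
        ext i j; simp [sq_iter_apply, mul_pow]
      rw [iterate_map_add, h3, h1, h2]
      ext i j
      simp only [Matrix.sub_apply, Matrix.add_apply, CharTwo.sub_eq_add]
    · refine (natDegree_prod_le _ _).trans ?_
      simp only [Function.comp_def, natDegree_X_sub_C]
      simp


lemma commute_inv {S : Type} [CommRing S] {A B : Matrix ι ι S} (h : Commute A B) (hA : IsUnit A.det) :
    Commute A⁻¹ B := by
  have : A⁻¹ * B = A⁻¹ * (B * A) * A⁻¹ := by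
    rw [mul_assoc, mul_assoc, Matrix.mul_nonsing_inv _ hA, mul_one]
  rw [Commute, SemiconjBy, this, ← h.eq, ← mul_assoc, Matrix.nonsing_inv_mul _ hA, one_mul]

lemma char_lower_aux {R : Type} [CommRing R] [Fintype R] (χ : MulChar R ℂ)
    (D : Finset Rˣ) (h1 : 1 ∈ D) (hmul : ∀ a ∈ D, ∀ b ∈ D, a * b ∈ D) (N : Rˣ → ℕ) (U B : ℝ)
    (h0 : ∀ r, r ∉ D → N r = 0) (hU : ∀ r ∈ D, (N r : ℝ) ≤ U) (hB : U * D.card - B ≤ ∑ r, (N r : ℝ)) :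
    -B ≤ (∑ r : Rˣ, (N r : ℂ) * χ r).re := by
  have hU0 : 0 ≤ U := le_trans (Nat.cast_nonneg _) (hU 1 h1)
  have hsum : ∑ r : Rˣ, (N r : ℂ) * χ r = ∑ r ∈ D, (N r : ℂ) * χ r := by
    symm
    apply Finset.sum_subset (Finset.subset_univ _)
    intro r _ hr
    rw [h0 r hr]; simp
  have hsum' : ∑ r : Rˣ, (N r : ℝ) = ∑ r ∈ D, (N r : ℝ) := by
    symm
    apply Finset.sum_subset (Finset.subset_univ _)
    intro r _ hr
    rw [h0 r hr]; simp
  -- character sum over D is nonnegative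
  have hchar : 0 ≤ (∑ r ∈ D, χ r).re := by
    by_cases hall : ∀ r ∈ D, χ r = 1
    · rw [Finset.sum_congr rfl hall]; simp
    · push Not at hall
      obtain ⟨a, ha, hχa⟩ := hall
      have hinj : D.image (fun r => a * r) = D := by
        apply Finset.eq_of_subset_of_card_le
        · intro x hx
          obtain ⟨r, hr, rfl⟩ := Finset.mem_image.1 hx
          exact hmul a ha r hr
        · rw [Finset.card_image_of_injective _ (mul_right_injective a)]
      have h2 : ∑ r ∈ D, χ r = χ a * ∑ r ∈ D, χ r := by
        conv_lhs => rw [← hinj]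
        rw [Finset.sum_image (fun x _ y _ h => mul_right_injective a h), Finset.mul_sum]
        refine Finset.sum_congr rfl fun r _ => ?_
        rw [Units.val_mul, map_mul]
      have h3 : (χ a - 1) * ∑ r ∈ D, χ r = 0 := by rw [sub_mul, ← h2]; ring
      rw [(mul_eq_zero.1 h3).resolve_left (sub_ne_zero.2 hχa)]
      simp
  have hnorm : ∀ r : Rˣ, ‖χ r‖ = 1 := by
    intro r
    have hfin : (r : R) ^ Fintype.card Rˣ = 1 := by
      rw [← Units.val_pow_eq_pow_val, pow_card_eq_one]; simp
    have := congrArg χ hfin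
    rw [map_pow, map_one] at this
    exact Complex.norm_eq_one_of_pow_eq_one this Fintype.card_ne_zero
  have hre : ∀ r : Rˣ, (χ r).re ≤ 1 := fun r => (Complex.re_le_norm _).trans (hnorm r).le
  have key : (∑ r ∈ D, (N r : ℂ) * χ r).re = U * (∑ r ∈ D, χ r).re - ∑ r ∈ D, (U - N r) * (χ r).re := by
    rw [Complex.re_sum, Complex.re_sum, Finset.mul_sum, ← Finset.sum_sub_distrib]
    refine Finset.sum_congr rfl fun r _ => ?_
    rw [← Complex.ofReal_natCast, Complex.re_ofReal_mul]; ring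
  rw [hsum, key]
  have h5 : ∑ r ∈ D, (U - N r) * (χ r).re ≤ ∑ r ∈ D, (U - N r) := by
    refine Finset.sum_le_sum fun r hr => ?_
    have := hU r hr
    nlinarith [hre r]
  rw [Finset.sum_sub_distrib, Finset.sum_const, nsmul_eq_mul] at h5
  rw [hsum'] at hB
  nlinarith [mul_nonneg hU0 hchar]

end Sark

namespace Sark

variable {ι : Type} [Fintype ι] [DecidableEq ι]

lemma matA (Ξ Z : Matrix ι ι (ZMod 2)) (hc : Commute Ξ Z) (t : Wc)
    (ht : (zm Wc Ξ + t • zm Wc Z).det ≠ 0) :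
    ∃ (M C0 l0 : ℕ) (D : Finset (Matrix ι ι (ZMod 2))), 0 < M ∧ 1 ∈ D ∧ (∀ a ∈ D, ∀ b ∈ D, a * b ∈ D) ∧
      ∀ l, l0 ≤ l → ∀ a : Matrix ι ι (ZMod 2), Commute a Ξ → Commute a Z → ∀ T : Finset Wc, T.Nonempty →
      (∀ α ∈ T, α ≠ t ∧ α ^ 2 ^ (M * l + M * l) = α ∧ (zm Wc Ξ + α • zm Wc Z).det ≠ 0 ∧
        Ap (zm Wc Ξ + α • zm Wc Z) (M * l + M * l) = zm Wc a) →
      a ∈ D ∧ D.card * T.card ≤ 2 ^ (M * l) * 2 ^ (M * l) + C0 * 2 ^ (M * l) := by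
  let k := IntermediateField.adjoin (ZMod 2) {t}
  haveI hfd : FiniteDimensional (ZMod 2) k := IntermediateField.adjoin.finiteDimensional
    (Algebra.IsAlgebraic.isAlgebraic (R := ZMod 2) t).isIntegral
  haveI : Finite k := Module.finite_of_finite (ZMod 2)
  letI : Fintype k := Fintype.ofFinite k
  haveI : CharP k 2 := charP_of_injective_algebraMap (algebraMap (ZMod 2) k).injective 2
  let tk : k := ⟨t, IntermediateField.mem_adjoin_simple_self _ _⟩
  have htk : algebraMap k Wc tk = t := rfl
  obtain ⟨m0, hm0, hcard⟩ := FiniteField.card k 2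
  set v : Matrix ι ι k := zm k Ξ + tk • zm k Z with hv
  have hmapv : (algebraMap k Wc).mapMatrix v = zm Wc Ξ + t • zm Wc Z := by
    rw [hv, map_add, map_zm]
    congr 1
  have hdv : v.det ≠ 0 := by
    intro h
    apply ht
    rw [← hmapv, ← RingHom.map_det, h, map_zero]
  have hdvu : IsUnit v.det := isUnit_iff_ne_zero.2 hdv
  set m : Matrix ι ι k := zm k Z * v⁻¹ with hm
  obtain ⟨D, C0, e0, h1D, hDmul, hD⟩ := thmA m
  have hper : sq^[(m0 : ℕ)] v = v := by
    ext i j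
    rw [sq_iter_apply, ← hcard]
    exact congrArg Subtype.val (FiniteField.pow_card (v i j))
  have hAu : IsUnit (Ap v m0) := by
    rw [Matrix.isUnit_iff_isUnit_det, det_Ap]
    exact hdvu.pow _
  obtain ⟨u, hu⟩ := hAu
  haveI : Finite (Matrix ι ι k)ˣ := inferInstance
  obtain ⟨o, ho, huo⟩ := (isOfFinOrder_of_finite u).exists_pow_eq_one
  have hApv : ∀ l, Ap v (m0 * o * l) = 1 := by
    intro l
    rw [mul_assoc, Ap_period _ _ hper, ← hu, pow_mul, ← Units.val_pow_eq_pow_val, huo]; simp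
  have hm0p : 0 < (m0 : ℕ) := m0.pos
  refine ⟨m0 * o, C0, e0, D, by positivity, h1D, hDmul, ?_⟩
  intro l hl a haΞ haZ T hT hTα
  -- over Wc
  set V : Matrix ι ι Wc := zm Wc Ξ + t • zm Wc Z with hV
  have hVu : IsUnit V.det := isUnit_iff_ne_zero.2 ht
  have hmm : (algebraMap k Wc).mapMatrix m * V = zm Wc Z := by
    rw [← hmapv, ← map_mul, hm, mul_assoc, Matrix.nonsing_inv_mul _ hdvu, mul_one, map_zm]
  have hΞZ : Commute (zm Wc Ξ) (zm Wc Z) := hc.map (zm Wc)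
  have hsqV : ∀ j, sq^[j] V = zm Wc Ξ + t ^ 2 ^ j • zm Wc Z := by
    intro j
    rw [hV, iterate_map_add, sq_iter_zm]
    congr 1
    ext p q
    rw [sq_iter_apply]
    have : zm Wc Z p q ^ 2 ^ j = zm Wc Z p q := by rw [← sq_iter_apply, sq_iter_zm]
    simp [mul_pow, this]
  set mW := (algebraMap k Wc).mapMatrix m with hmW
  have hsqVu : ∀ j, IsUnit (sq^[j] V).det := by
    intro j; rw [det_sq_iter]; exact hVu.pow _
  have hsqm : ∀ i, sq^[i] mW = zm Wc Z * (sq^[i] V)⁻¹ := by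
    intro i
    have := congrArg (sq^[i]) hmm
    rw [iterate_map_mul, sq_iter_zm] at this
    rw [← this, mul_assoc, Matrix.mul_nonsing_inv _ (hsqVu i), mul_one]
  have hVV : ∀ i j, Commute (sq^[i] V) (sq^[j] V) := by
    intro i j
    rw [hsqV, hsqV]
    refine Commute.add_left (Commute.add_right (Commute.refl _) (hΞZ.smul_right _)) (Commute.add_right ?_ ?_)
    · exact (hΞZ.symm.smul_left _)
    · exact ((Commute.refl _).smul_left _).smul_right _
  have hVZ : ∀ i, Commute (sq^[i] V) (zm Wc Z) := by
    intro i
    rw [hsqV]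
    exact Commute.add_left hΞZ ((Commute.refl _).smul_left _)
  have hmV : ∀ i j, Commute (sq^[i] mW) (sq^[j] V) := by
    intro i j
    rw [hsqm]
    exact Commute.mul_left (hVZ j).symm (commute_inv (hVV i j) (hsqVu i))
  have hApV : Ap V (m0 * o * l + m0 * o * l) = 1 := by
    rw [← mul_add, ← hmapv, ← map_Ap, hApv, map_one]
  let n := m0 * o * l
  -- transformation
  have htr : ∀ α ∈ T, (((α + t)⁻¹ • 1 + mW).det ≠ 0 ∧
      Ap ((α + t)⁻¹ • 1 + mW) (m0 * o * l + m0 * o * l) = zm Wc a) := by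
    intro α hα
    obtain ⟨hαt, hαn, hαd, hαA⟩ := hTα α hα
    have hne : α + t ≠ 0 := by
      rw [← CharTwo.sub_eq_add]; exact sub_ne_zero.2 hαt
    have h1 : ((α + t)⁻¹ • 1 + mW) * V = (α + t)⁻¹ • (zm Wc Ξ + α • zm Wc Z) := by
      rw [add_mul, hmm, smul_mul_assoc, one_mul, hV]
      have h2 : zm Wc Z = (α + t)⁻¹ • ((α + t) • zm Wc Z) := by rw [smul_smul, inv_mul_cancel₀ hne, one_smul]
      nth_rewrite 2 [h2]
      rw [← smul_add]
      congr 1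
      rw [add_assoc, ← add_smul, add_comm α t, ← add_assoc, CharTwo.add_self_eq_zero, zero_add]
    refine ⟨?_, ?_⟩
    · intro h0
      have := congrArg Matrix.det h1
      rw [Matrix.det_mul, h0, zero_mul, Matrix.det_smul] at this
      rcases mul_eq_zero.1 this.symm with h | h
      · exact pow_ne_zero _ (inv_ne_zero hne) h
      · exact hαd h
    · have h3 := Ap_mul (A := (α + t)⁻¹ • 1 + mW) (B := V) (n := m0 * o * l + m0 * o * l) (by
        intro i j
        rw [iterate_map_add]
        refine Commute.add_left ?_ (hmV i j)
        have : sq^[i] ((α + t)⁻¹ • (1 : Matrix ι ι Wc)) = ((α + t)⁻¹ ^ 2 ^ i) • (1 : Matrix ι ι Wc) := by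
          ext p q
          rw [sq_iter_apply]
          by_cases hpq : p = q
          · simp [hpq]
          · simp [hpq]
        rw [this]
        exact (Commute.one_left _).smul_left _)
      rw [hApV, mul_one, h1, Ap_smul, hαA] at h3
      rw [← h3]
      have htn : t ^ 2 ^ (m0 * o * l + m0 * o * l) = t := by
        have h4 : tk ^ 2 ^ (m0 * (o * l + o * l)) = tk := by
          rw [pow_mul, ← hcard]; exact FiniteField.pow_card_pow _ _
        have := congrArg (algebraMap k Wc) h4
        rw [map_pow, htk] at this
        rwa [mul_assoc, ← mul_add]
      have h5 : (α + t) ^ 2 ^ (m0 * o * l + m0 * o * l) = α + t := by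
        rw [add_pow_char_pow, hαn, htn]
      have h6 : ((α + t)⁻¹) ^ (2 ^ (m0 * o * l + m0 * o * l) - 1) = 1 := by
        have h7 : ((α + t)⁻¹) ^ (2 ^ (m0 * o * l + m0 * o * l) - 1 + 1) = (α + t)⁻¹ := by
          rw [Nat.sub_add_cancel Nat.one_le_two_pow, inv_pow, h5]
        rw [pow_succ] at h7
        exact mul_right_cancel₀ (inv_ne_zero hne) (by rw [h7, one_mul])
      rw [h6, one_smul]
  have hinj : Function.Injective (fun α : Wc => (α + t)⁻¹) := by
    intro x y h
    simpa using h
  have htn : t ^ 2 ^ (m0 * o * l + m0 * o * l) = t := by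
    have h4 : tk ^ 2 ^ (m0 * (o * l + o * l)) = tk := by
      rw [pow_mul, ← hcard]; exact FiniteField.pow_card_pow _ _
    have := congrArg (algebraMap k Wc) h4
    rw [map_pow, htk] at this
    rwa [mul_assoc, ← mul_add]
  have hle : e0 ≤ o * l := hl.trans (Nat.le_mul_of_pos_left l ho)
  have hcomm : Commute (zm k a) m := by
    have h1 : Commute (zm k a) v := by
      rw [hv]
      exact Commute.add_right (haΞ.map _) ((haZ.map (zm k)).smul_right _)
    rw [hm]
    exact Commute.mul_right (haZ.map _) (commute_inv h1.symm hdvu).symm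
  have := hD Wc (o * l) (m0 * o * l) hle (by rw [hcard, ← pow_mul, mul_assoc]) a hcomm
    (T.image fun α => (α + t)⁻¹) (hT.image _) (by
      intro β hβ
      obtain ⟨α, hα, rfl⟩ := Finset.mem_image.1 hβ
      refine ⟨?_, htr α hα⟩
      rw [inv_pow, add_pow_char_pow, (hTα α hα).2.1, htn])
  rwa [Finset.card_image_of_injective _ hinj] at this

end Sark

namespace Sark

variable {ι : Type} [Fintype ι] [DecidableEq ι]

lemma det_roots_card (A B : Matrix ι ι Wc) (t : Wc) (ht : (B + t • A).det ≠ 0) (T : Finset Wc) :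
    (T.filter fun α => (B + α • A).det = 0).card ≤ Fintype.card ι := by
  set p : Wc[X] := ((X : Wc[X]) • A.map C + B.map C).det with hp
  have hev : ∀ α, p.eval α = (B + α • A).det := by
    intro α
    rw [hp, ← coe_evalRingHom, RingHom.map_det]
    congr 1
    ext i j
    simp [add_comm]
    rw [mul_comm]
  have hp0 : p ≠ 0 := by
    intro h
    apply ht
    rw [← hev, h, eval_zero]
  calc _ ≤ p.roots.toFinset.card := by
        apply Finset.card_le_card
        intro α hα
        rw [Multiset.mem_toFinset, mem_roots hp0, IsRoot, hev]
        exact (Finset.mem_filter.1 hα).2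
    _ ≤ _ := (Multiset.toFinset_card_le _).trans ((card_roots' p).trans (natDegree_det_X_add_C_le A B))

lemma zm_smul (c : ZMod 2) (a : Matrix ι ι (ZMod 2)) : zm Wc (c • a) = algebraMap (ZMod 2) Wc c • zm Wc a := by
  have h : algebraMap (ZMod 2) Wc = z2 Wc := RingHom.ext_zmod _ _
  rw [h]
  ext i j
  change z2 Wc (c * a i j) = z2 Wc c * z2 Wc (a i j)
  rw [map_mul]

theorem charsum_lower {R : Type} [CommRing R] [Fintype R] [Algebra (ZMod 2) R] (ξ ζ : R) (F : ℕ → Wc → R)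
    (hF : ∀ n, n ≠ 0 → ∀ α ∈ Tn n, ∃ f : (ZMod 2)[X],
      f.map (algebraMap (ZMod 2) Wc) = ∏ i ∈ Finset.range n, (X - C (α ^ 2 ^ i)) ∧ F n α = homv n f ξ ζ)
    (χ : MulChar R ℂ) :
    ∃ (C : ℝ) (M l0 : ℕ), 0 < M ∧ ∀ l, l0 ≤ l →
      -C * 2 ^ (M * l) ≤ (∑ α ∈ Tn (M * l + M * l), χ (F (M * l + M * l) α)).re := by
  by_cases hex : ∃ n, n ≠ 0 ∧ ∃ α ∈ Tn n, IsUnit (F n α)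
  swap
  · push Not at hex
    refine ⟨0, 1, 1, one_pos, fun l hl => ?_⟩
    rw [Finset.sum_eq_zero]
    · simp
    · intro α hα
      exact χ.map_nonunit (hex _ (by omega) α hα)
  let b := Module.finBasis (ZMod 2) R
  let L := Algebra.leftMulMatrix b
  have hLinj : Function.Injective L := Algebra.leftMulMatrix_injective b
  set Ξ := L ξ with hΞ
  set Z := L ζ with hZ
  have hcR : ∀ x y, Commute (L x) (L y) := fun x y => (Commute.all x y).map L
  have hAp : ∀ n, n ≠ 0 → ∀ α ∈ Tn n, zm Wc (L (F n α)) = Ap (zm Wc Ξ + α • zm Wc Z) n := by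
    intro n hn α hα
    obtain ⟨f, hf, hFf⟩ := hF n hn α hα
    rw [← homv_prod _ _ ((hcR ξ ζ).map (zm Wc)) α (sq_zm _) (sq_zm _), ← hf, hFf, homv, homv, map_sum, map_sum]
    refine Finset.sum_congr rfl fun i _ => ?_
    rw [map_smul, zm_smul, coeff_map, map_mul, map_mul, map_pow, map_pow, map_pow, map_pow]
  have hunit : ∀ n, n ≠ 0 → ∀ α ∈ Tn n, (IsUnit (F n α) ↔ (zm Wc Ξ + α • zm Wc Z).det ≠ 0) := by
    intro n hn α hα
    have h2 : 1 < 2 ^ n := Nat.one_lt_two_pow hn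
    constructor
    · intro h h0
      have h1 := (h.map L).map (zm Wc)
      rw [hAp n hn α hα, Matrix.isUnit_iff_isUnit_det, det_Ap, h0, zero_pow (by omega)] at h1
      exact not_isUnit_zero h1
    · intro h
      have h1 : (zm Wc (L (F n α))).det ≠ 0 := by
        rw [hAp n hn α hα, det_Ap]; exact pow_ne_zero _ h
      have h3 : IsUnit (L (F n α)) := by
        rw [Matrix.isUnit_iff_isUnit_det, isUnit_iff_ne_zero]
        intro h0
        apply h1
        rw [zm, ← RingHom.map_det, h0, map_zero]
      have h4 : Function.Injective (fun x : R => F n α * x) := by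
        intro x y hxy
        apply hLinj
        have := congrArg L hxy
        simp only [map_mul] at this
        exact h3.mul_left_cancel this
      obtain ⟨y, hy⟩ := Finite.injective_iff_surjective.1 h4 1
      exact IsUnit.of_mul_eq_one y hy
  obtain ⟨n1, hn1, t, htn, htu⟩ := hex
  have ht := (hunit n1 hn1 t htn).1 htu
  obtain ⟨M, C0, l0, D, hM, h1D, hDmul, hD⟩ := matA Ξ Z (hcR ξ ζ) t ht
  set d := Fintype.card (Fin (Module.finrank (ZMod 2) R)) with hd
  refine ⟨C0 + d + 2, M, l0 + 1, hM, fun l hl => ?_⟩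
  set n := M * l + M * l with hn
  have hn0 : n ≠ 0 := by
    have : 0 < M * l := Nat.mul_pos hM (by omega)
    omega
  set Q : ℝ := 2 ^ (M * l) with hQ
  have hQ1 : 1 ≤ Q := one_le_pow₀ (by norm_num)
  have hcardT : ((Tn n).card : ℝ) = Q * Q := by
    rw [card_Tn hn0, hn, pow_add]; push_cast; rfl
  set T' := (Tn n).erase t with hT'
  set Nr : Rˣ → ℕ := fun r => (T'.filter fun α => F n α = r).card with hNr
  set D' : Finset Rˣ := Finset.univ.filter fun r : Rˣ => L r ∈ D with hD'
  have hDpos : 0 < (D.card : ℝ) := by exact_mod_cast Finset.card_pos.2 ⟨1, h1D⟩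
  have hD'le : (D'.card : ℝ) ≤ D.card := by
    have : D'.card ≤ D.card := by
      apply Finset.card_le_card_of_injOn (fun r : Rˣ => L r)
      · intro r hr
        simpa [hD'] using hr
      · intro x _ y _ h
        exact Units.ext (hLinj h)
    exact_mod_cast this
  have hkey : ∀ r : Rˣ, Nr r ≠ 0 → r ∈ D' ∧ (D.card : ℝ) * Nr r ≤ Q * Q + C0 * Q := by
    intro r hr
    have := hD l (by omega) (L r) (hcR _ _) (hcR _ _) (T'.filter fun α => F n α = r)
      (Finset.card_pos.1 (Nat.pos_of_ne_zero hr)) (by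
        intro α hα
        rw [Finset.mem_filter, hT', Finset.mem_erase] at hα
        obtain ⟨⟨h1, h2⟩, h3⟩ := hα
        refine ⟨h1, (mem_Tn hn0 α).1 h2, (hunit n hn0 α h2).1 (h3 ▸ r.isUnit), ?_⟩
        rw [← h3, hAp n hn0 α h2])
    refine ⟨by simpa [hD'] using this.1, ?_⟩
    have h2 := this.2
    rw [hQ]
    exact_mod_cast h2
  have hsumχ : ∑ α ∈ T', χ (F n α) = ∑ r : Rˣ, (Nr r : ℂ) * χ r := by
    have : ∀ r : Rˣ, (Nr r : ℂ) * χ r = ∑ α ∈ T', if F n α = r then χ (F n α) else 0 := by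
      intro r
      rw [← Finset.sum_filter, Finset.sum_congr rfl (g := fun _ => χ r), Finset.sum_const, nsmul_eq_mul]
      intro α hα
      rw [(Finset.mem_filter.1 hα).2]
    rw [Finset.sum_congr rfl fun r _ => this r, Finset.sum_comm]
    refine Finset.sum_congr rfl fun α _ => ?_
    by_cases hu : IsUnit (F n α)
    · obtain ⟨u, hu⟩ := hu
      rw [Finset.sum_eq_single u]
      · rw [if_pos hu.symm]
      · intro r _ hr
        rw [if_neg]
        intro h
        exact hr (Units.ext (h.symm.trans hu.symm))
      · simp
    · rw [χ.map_nonunit hu]; simp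
  have hsumN : Q * Q - d - 1 ≤ ∑ r, (Nr r : ℝ) := by
    have h1 : ∑ r, Nr r = (T'.filter fun α => IsUnit (F n α)).card := by
      rw [Finset.card_eq_sum_card_fiberwise (f := fun α => F n α)
        (t := Finset.univ.image (fun r : Rˣ => (r : R))), Finset.sum_image (fun x _ y _ h => Units.ext h)]
      · refine Finset.sum_congr rfl fun r _ => ?_
        change (T'.filter fun α => F n α = r).card = _
        refine congrArg Finset.card (Finset.ext fun α => ?_)
        simp only [Finset.mem_filter]
        constructor
        · rintro ⟨h1, h2⟩
          exact ⟨⟨h1, h2 ▸ r.isUnit⟩, h2⟩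
        · rintro ⟨⟨h1, _⟩, h2⟩
          exact ⟨h1, h2⟩
      · intro α hα
        obtain ⟨u, hu⟩ := (Finset.mem_filter.1 hα).2
        simp only [Finset.coe_image, Set.mem_image]
        exact ⟨u, by simp, hu⟩
    have h2 : (T'.filter fun α => ¬ IsUnit (F n α)).card ≤ d := by
      refine le_trans (Finset.card_le_card ?_) (det_roots_card (zm Wc Z) (zm Wc Ξ) t ht T')
      intro α hα
      rw [Finset.mem_filter] at hα ⊢
      refine ⟨hα.1, ?_⟩
      have := (hunit n hn0 α (Finset.mem_of_mem_erase hα.1))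
      by_contra h0
      exact hα.2 (this.2 h0)
    have h3 := Finset.card_filter_add_card_filter_not (s := T') (fun α => IsUnit (F n α))
    have h4 : (Tn n).card - 1 ≤ T'.card := Finset.pred_card_le_card_erase
    have h5 : (Tn n).card ≤ ∑ r, Nr r + d + 1 := by omega
    have h6 : ((Tn n).card : ℝ) ≤ ∑ r, (Nr r : ℝ) + d + 1 := by exact_mod_cast h5
    linarith
  have hmain := char_lower_aux χ D' (by simpa [hD'] using h1D) (by
      intro x hx y hy
      simp only [hD', Finset.mem_filter, Finset.mem_univ, true_and] at hx hy ⊢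
      rw [Units.val_mul, map_mul]
      exact hDmul _ hx _ hy) Nr ((Q * Q + C0 * Q) / D.card) (C0 * Q + d + 1) (by
      intro r hr
      by_contra h
      exact hr (hkey r h).1) (by
      intro r _
      rw [le_div_iff₀ hDpos]
      by_cases h : Nr r = 0
      · rw [h]; simp; positivity
      · linarith [(hkey r h).2]) (by
      have h1 : (Q * Q + C0 * Q) / D.card * D'.card ≤ Q * Q + C0 * Q := by
        rw [div_mul_eq_mul_div, div_le_iff₀ hDpos]
        exact mul_le_mul_of_nonneg_left hD'le (by positivity)
      linarith)
  rw [← hsumχ] at hmain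
  have hnorm : ∀ x, ‖χ x‖ ≤ 1 := by
    intro x
    by_cases hx : IsUnit x
    · obtain ⟨r, rfl⟩ := hx
      have hfin : (r : R) ^ Fintype.card Rˣ = 1 := by
        rw [← Units.val_pow_eq_pow_val, pow_card_eq_one]; simp
      have := congrArg χ hfin
      rw [map_pow, map_one] at this
      exact (Complex.norm_eq_one_of_pow_eq_one this Fintype.card_ne_zero).le
    · rw [χ.map_nonunit hx]; simp
  have hfull : (∑ α ∈ T', χ (F n α)).re - 1 ≤ (∑ α ∈ Tn n, χ (F n α)).re := by
    by_cases h : t ∈ Tn n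
    · rw [← Finset.add_sum_erase _ _ h, Complex.add_re]
      have := (abs_le.1 ((Complex.abs_re_le_norm _).trans (hnorm (F n t)))).1
      linarith
    · rw [hT', Finset.erase_eq_of_notMem h]; linarith
  have hd0 : (0 : ℝ) ≤ d := Nat.cast_nonneg _
  nlinarith

end Sark

namespace Sark

abbrev mp (α : Wc) : (ZMod 2)[X] := minpoly (ZMod 2) α

lemma mp_integral (α : Wc) : IsIntegral (ZMod 2) α :=
  (Algebra.IsAlgebraic.isAlgebraic (R := ZMod 2) α).isIntegral

lemma mp_irr (α : Wc) : Irreducible (mp α) := minpoly.irreducible (mp_integral α)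

lemma mp_monic (α : Wc) : (mp α).Monic := minpoly.monic (mp_integral α)

lemma mp_deg_pos (α : Wc) : 0 < (mp α).natDegree := minpoly.natDegree_pos (mp_integral α)

lemma pow_eq_iff (α : Wc) (n : ℕ) : α ^ 2 ^ n = α ↔ (mp α).natDegree ∣ n := by
  rw [(mp_irr α).natDegree_dvd_iff_dvd_X_pow_card_pow_sub_X, minpoly.dvd_iff]
  simp [sub_eq_zero]

lemma mp_map (α : Wc) : (mp α).map (algebraMap (ZMod 2) Wc) =
    ∏ i ∈ Finset.range (mp α).natDegree, (X - C (α ^ 2 ^ i)) := by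
  symm
  have hroot : ∀ i, (mp α).aeval (α ^ 2 ^ i) = 0 := by
    intro i
    have : α ^ 2 ^ i = (FiniteField.frobeniusAlgHom (ZMod 2) Wc ^ i) α := by
      induction i with
      | zero => simp
      | succ i ih =>
        rw [pow_succ, pow_mul, ih, pow_succ' (FiniteField.frobeniusAlgHom (ZMod 2) Wc), AlgHom.mul_apply,
          FiniteField.coe_frobeniusAlgHom]
        simp
    rw [this, aeval_algHom_apply, minpoly.aeval, map_zero]
  have hinj : Set.InjOn (fun i => α ^ 2 ^ i) (Finset.range (mp α).natDegree : Set ℕ) := by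
    have key : ∀ i j, i ≤ j → j < (mp α).natDegree → α ^ 2 ^ i = α ^ 2 ^ j → i = j := by
      intro i j hij hj h
      have h1 : α ^ 2 ^ (j - i) = α := by
        have h2 : (iterateFrobenius Wc 2 i) (α ^ 2 ^ (j - i)) = iterateFrobenius Wc 2 i α := by
          rw [iterateFrobenius_def, iterateFrobenius_def, ← pow_mul, ← pow_add, h]
          congr 2; omega
        exact (iterateFrobenius Wc 2 i).injective h2
      rw [pow_eq_iff] at h1
      have := Nat.eq_zero_of_dvd_of_lt h1 (by omega)
      omega
    intro i hi j hj h
    simp only [Finset.coe_range, Set.mem_Iio] at hi hj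
    rcases le_total i j with h1 | h1
    · exact key i j h1 hj h
    · exact (key j i h1 hi h.symm).symm
  apply eq_of_dvd_of_natDegree_le_of_leadingCoeff
  · have : ∏ i ∈ Finset.range (mp α).natDegree, (X - C (α ^ 2 ^ i)) =
        ∏ β ∈ (Finset.range (mp α).natDegree).image (fun i => α ^ 2 ^ i), (X - C β) := by
      rw [Finset.prod_image hinj]
    rw [this]
    apply Finset.prod_dvd_of_coprime
    · intro x _ y _ hxy
      exact isCoprime_X_sub_C_of_isUnit_sub (sub_ne_zero.2 hxy).isUnit
    · intro β hβ
      obtain ⟨i, _, rfl⟩ := Finset.mem_image.1 hβ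
      rw [dvd_iff_isRoot, IsRoot, eval_map_algebraMap]
      exact hroot i
  · rw [natDegree_map, natDegree_prod_of_monic _ _ (fun i _ => monic_X_sub_C _)]
    simp only [natDegree_X_sub_C]
    simp
  · rw [(monic_prod_of_monic _ _ (fun i _ => monic_X_sub_C _)).leadingCoeff,
      ((mp_monic α).map _).leadingCoeff]

/-- `N_{F_{2^n}/F_2}(X - α)` as a polynomial over `F_2` -/
def fn (n : ℕ) (α : Wc) : (ZMod 2)[X] := mp α ^ (n / (mp α).natDegree)

lemma fn_map {n : ℕ} (hn : n ≠ 0) (α : Wc) (hα : α ∈ Tn n) :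
    (fn n α).map (algebraMap (ZMod 2) Wc) = ∏ i ∈ Finset.range n, (X - C (α ^ 2 ^ i)) := by
  rw [mem_Tn hn, pow_eq_iff] at hα
  obtain ⟨q, hq⟩ := hα
  have hd := mp_deg_pos α
  have key : ∀ q, ∏ i ∈ Finset.range ((mp α).natDegree * q), (X - C (α ^ 2 ^ i)) =
      ((mp α).map (algebraMap (ZMod 2) Wc)) ^ q := by
    intro q
    induction q with
    | zero => simp
    | succ q ih =>
      rw [mul_add, mul_one, Finset.prod_range_add, ih, pow_succ, mp_map]
      congr 1
      refine Finset.prod_congr rfl fun i _ => ?_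
      rw [pow_add, pow_mul, (pow_eq_iff α _).2 (dvd_mul_right _ _)]
  rw [hq, key, fn, Polynomial.map_pow, Nat.mul_div_cancel_left _ hd]

lemma fn_natDegree {n : ℕ} (hn : n ≠ 0) (α : Wc) (hα : α ∈ Tn n) : (fn n α).natDegree = n := by
  rw [mem_Tn hn, pow_eq_iff] at hα
  rw [fn, (mp_monic α).natDegree_pow, Nat.div_mul_cancel hα]

lemma fn_ne_zero (n : ℕ) (α : Wc) : fn n α ≠ 0 := pow_ne_zero _ (mp_irr α).ne_zero

lemma rootMult_eq (f : (ZMod 2)[X]) (hf : f ≠ 0) (α : Wc) :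
    ∃ v, (∀ k, mp α ^ k ∣ f ↔ k ≤ v) ∧
      v = (f.map (algebraMap (ZMod 2) Wc)).rootMultiplicity α := by
  obtain ⟨v, w, hw, hfw⟩ := WfDvdMonoid.max_power_factor hf (mp_irr α)
  refine ⟨v, ?_, ?_⟩
  · intro k
    constructor
    · intro h
      by_contra hk
      push Not at hk
      apply hw
      rw [hfw] at h
      have h1 : mp α ^ (v + 1) ∣ mp α ^ v * w := (pow_dvd_pow _ hk).trans h
      rw [pow_succ] at h1
      exact (mul_dvd_mul_iff_left (pow_ne_zero v (mp_irr α).ne_zero)).1 h1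
    · intro h
      rw [hfw]
      exact (pow_dvd_pow _ h).mul_right _
  · have hp0 : (mp α).map (algebraMap (ZMod 2) Wc) ≠ 0 := map_monic_ne_zero (mp_monic α)
    have hw0 : w.map (algebraMap (ZMod 2) Wc) ≠ 0 := by
      rw [Polynomial.map_ne_zero_iff (algebraMap (ZMod 2) Wc).injective]
      rintro rfl
      exact hw (dvd_zero _)
    have h1 : (w.map (algebraMap (ZMod 2) Wc)).rootMultiplicity α = 0 := by
      apply rootMultiplicity_eq_zero
      rw [IsRoot, eval_map_algebraMap]
      intro h
      exact hw ((minpoly.dvd_iff).2 h)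
    have h2 : ((mp α).map (algebraMap (ZMod 2) Wc)).rootMultiplicity α = 1 := by
      have hsep : ((mp α).map (algebraMap (ZMod 2) Wc)).Separable := (PerfectField.separable_of_irreducible (mp_irr α)).map
      apply le_antisymm (rootMultiplicity_le_one_of_separable hsep α)
      rw [Nat.succ_le_iff, rootMultiplicity_pos hp0, IsRoot, eval_map_algebraMap, minpoly.aeval]
    rw [hfw, Polynomial.map_mul, Polynomial.map_pow, rootMultiplicity_mul (mul_ne_zero (pow_ne_zero _ hp0) hw0),
      h1, add_zero, ← count_roots, roots_pow, Multiset.count_nsmul, count_roots, h2, mul_one]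

/-- the von Mangoldt identity -/
lemma mangoldt (f : (ZMod 2)[X]) (hf : f ≠ 0) :
    ∑ j ∈ Finset.Icc 1 f.natDegree, ((Tn j).filter fun α => fn j α ∣ f).card = f.natDegree := by
  set fW := f.map (algebraMap (ZMod 2) Wc) with hfW
  have hfW0 : fW ≠ 0 := by
    rwa [hfW, Polynomial.map_ne_zero_iff (algebraMap (ZMod 2) Wc).injective]
  have hdeg : f.natDegree = ∑ α ∈ fW.roots.toFinset, fW.rootMultiplicity α := by
    have h1 : fW.roots.card = f.natDegree := by
      rw [← (IsAlgClosed.splits fW).natDegree_eq_card_roots, hfW, natDegree_map]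
    rw [← h1, ← Multiset.toFinset_sum_count_eq]
    refine Finset.sum_congr rfl fun α _ => ?_
    rw [count_roots]
  have hroot : ∀ j ∈ Finset.Icc 1 f.natDegree, ∀ α ∈ Tn j, fn j α ∣ f → α ∈ fW.roots.toFinset := by
    intro j hj α hα h
    rw [Finset.mem_Icc] at hj
    have hj0 : j ≠ 0 := by omega
    rw [Multiset.mem_toFinset, mem_roots hfW0, IsRoot, hfW, eval_map_algebraMap, ← minpoly.dvd_iff]
    refine (dvd_pow_self (mp α) ?_).trans h
    rw [mem_Tn hj0, pow_eq_iff] at hα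
    exact (Nat.div_pos (Nat.le_of_dvd (by omega) hα) (mp_deg_pos α)).ne'
  have hstep : ∀ j ∈ Finset.Icc 1 f.natDegree, ((Tn j).filter fun α => fn j α ∣ f).card =
      ∑ α ∈ fW.roots.toFinset, if (α ∈ Tn j ∧ fn j α ∣ f) then 1 else 0 := by
    intro j hj
    rw [Finset.card_eq_sum_ones, ← Finset.sum_filter]
    refine Finset.sum_congr ?_ fun _ _ => rfl
    ext α
    simp only [Finset.mem_filter]
    constructor
    · rintro ⟨h1, h2⟩
      exact ⟨hroot j hj α h1 h2, h1, h2⟩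
    · rintro ⟨_, h⟩
      exact h
  rw [Finset.sum_congr rfl hstep, Finset.sum_comm]
  conv_rhs => rw [hdeg]
  refine Finset.sum_congr rfl fun α _ => ?_
  obtain ⟨v, hv, hvr⟩ := rootMult_eq f hf α
  rw [← hfW] at hvr
  rw [← hvr, ← Finset.sum_filter, ← Finset.card_eq_sum_ones]
  have hd := mp_deg_pos α
  have : (Finset.Icc 1 f.natDegree).filter (fun j => α ∈ Tn j ∧ fn j α ∣ f) =
      (Finset.Icc 1 v).image (fun k => (mp α).natDegree * k) := by
    ext j
    simp only [Finset.mem_filter, Finset.mem_image, Finset.mem_Icc]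
    constructor
    · rintro ⟨⟨h1, h2⟩, h3, h4⟩
      rw [mem_Tn (by omega), pow_eq_iff] at h3
      obtain ⟨q, rfl⟩ := h3
      rw [fn, Nat.mul_div_cancel_left _ hd, hv] at h4
      refine ⟨q, ⟨?_, h4⟩, rfl⟩
      by_contra h
      have : q = 0 := by omega
      subst this
      simp at h1
    · rintro ⟨q, ⟨h1, h2⟩, rfl⟩
      have hp : 1 ≤ (mp α).natDegree * q := Nat.mul_pos hd h1
      refine ⟨⟨hp, ?_⟩, ?_, ?_⟩
      · have := natDegree_le_of_dvd ((hv q).2 h2) hf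
        rwa [(mp_monic α).natDegree_pow, mul_comm] at this
      · rw [mem_Tn (by omega), pow_eq_iff]; exact dvd_mul_right _ _
      · rw [fn, Nat.mul_div_cancel_left _ hd, hv]; exact h2
  rw [this, Finset.card_image_of_injective]
  · simp
  · intro x y h
    exact Nat.eq_of_mul_eq_mul_left hd h

end Sark

namespace Sark

/-- polynomials over `F_2` of degree less than `n` -/
def Pl (n : ℕ) : Finset (ZMod 2)[X] :=
  (Finset.univ : Finset (Fin n → ZMod 2)).image (fun c => ((degreeLTEquiv (ZMod 2) n).symm c : (ZMod 2)[X]))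

lemma mem_Pl {n : ℕ} {f : (ZMod 2)[X]} : f ∈ Pl n ↔ f.degree < n := by
  rw [Pl, Finset.mem_image, ← mem_degreeLT]
  constructor
  · rintro ⟨c, _, rfl⟩
    exact ((degreeLTEquiv (ZMod 2) n).symm c).2
  · intro h
    exact ⟨degreeLTEquiv (ZMod 2) n ⟨f, h⟩, Finset.mem_univ _, by simp⟩

lemma card_Pl (n : ℕ) : (Pl n).card = 2 ^ n := by
  rw [Pl, Finset.card_image_of_injective]
  · simp
  · intro x y h
    exact (degreeLTEquiv (ZMod 2) n).symm.injective (Subtype.ext h)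

/-- polynomials over `F_2` of degree exactly `n` -/
def Mn (n : ℕ) : Finset (ZMod 2)[X] := (Pl (n + 1)).filter fun f => f.degree = n

lemma mem_Mn {n : ℕ} {f : (ZMod 2)[X]} : f ∈ Mn n ↔ f.degree = n := by
  rw [Mn, Finset.mem_filter, mem_Pl]
  constructor
  · exact fun h => h.2
  · intro h
    refine ⟨?_, h⟩
    rw [h]; exact_mod_cast Nat.lt_succ_self n

lemma Mn_ne_zero {n : ℕ} {f : (ZMod 2)[X]} (h : f ∈ Mn n) : f ≠ 0 := by
  rintro rfl
  rw [mem_Mn] at h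
  simp at h

lemma Mn_natDegree {n : ℕ} {f : (ZMod 2)[X]} (h : f ∈ Mn n) : f.natDegree = n :=
  natDegree_eq_of_degree_eq_some (mem_Mn.1 h)

lemma mem_Mn' {n : ℕ} {f : (ZMod 2)[X]} : f ∈ Mn n ↔ f ≠ 0 ∧ f.natDegree = n :=
  ⟨fun h => ⟨Mn_ne_zero h, Mn_natDegree h⟩, fun h => by rw [mem_Mn, degree_eq_natDegree h.1, h.2]⟩

lemma lead_one {f : (ZMod 2)[X]} (h : f ≠ 0) : f.leadingCoeff = 1 := by
  have h1 := leadingCoeff_ne_zero.2 h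
  revert h1
  generalize f.leadingCoeff = x
  revert x; decide

lemma monic_of_ne {f : (ZMod 2)[X]} (h : f ≠ 0) : f.Monic := lead_one h

lemma Mn_eq_image (n : ℕ) : Mn n = (Pl n).image (fun f => X ^ n + f) := by
  ext f
  rw [Finset.mem_image]
  constructor
  · intro h
    refine ⟨f - X ^ n, ?_, by ring⟩
    rw [mem_Pl]
    have h1 := mem_Mn.1 h
    have := degree_sub_lt (p := f) (q := X ^ n) (by rw [h1, degree_X_pow]) (Mn_ne_zero h)
      (by rw [lead_one (Mn_ne_zero h), leadingCoeff_X_pow])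
    rwa [h1] at this
  · rintro ⟨g, hg, rfl⟩
    rw [mem_Pl] at hg
    rw [mem_Mn, degree_add_eq_left_of_degree_lt (by rwa [degree_X_pow]), degree_X_pow]

lemma card_Mn (n : ℕ) : (Mn n).card = 2 ^ n := by
  rw [Mn_eq_image, Finset.card_image_of_injective _ (add_right_injective _), card_Pl]

section
variable (c : (ZMod 2)[X] → ℂ)

def aa (n : ℕ) : ℂ := ∑ f ∈ Mn n, c f
def psi (n : ℕ) : ℂ := ∑ α ∈ Tn n, c (fn n α)

lemma newton_rec (hmul : ∀ f g, c (f * g) = c f * c g) (n : ℕ) :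
    n * aa c n = ∑ j ∈ Finset.Icc 1 n, psi c j * aa c (n - j) := by
  have h1 : ∀ j ∈ Finset.Icc 1 n, psi c j * aa c (n - j) =
      ∑ f ∈ Mn n, (((Tn j).filter fun α => fn j α ∣ f).card : ℂ) * c f := by
    intro j hj
    rw [Finset.mem_Icc] at hj
    have h2 : ∀ f ∈ Mn n, (((Tn j).filter fun α => fn j α ∣ f).card : ℂ) * c f =
        ∑ α ∈ Tn j, if fn j α ∣ f then c f else 0 := by
      intro f _
      rw [← Finset.sum_filter, Finset.sum_const, nsmul_eq_mul]
    rw [Finset.sum_congr rfl h2, Finset.sum_comm, psi, aa, Finset.sum_mul]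
    refine Finset.sum_congr rfl fun α hα => ?_
    rw [← Finset.sum_filter, Finset.mul_sum]
    have h3 : (Mn n).filter (fun f => fn j α ∣ f) = (Mn (n - j)).image (fun g => fn j α * g) := by
      ext f
      rw [Finset.mem_filter, Finset.mem_image, mem_Mn']
      constructor
      · rintro ⟨⟨h0, h4⟩, g, rfl⟩
        have hg : g ≠ 0 := right_ne_zero_of_mul h0
        refine ⟨g, ?_, rfl⟩
        rw [natDegree_mul (fn_ne_zero j α) hg, fn_natDegree (by omega) α hα] at h4
        rw [mem_Mn']
        exact ⟨hg, by omega⟩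
      · rintro ⟨g, hg, rfl⟩
        rw [mem_Mn'] at hg
        refine ⟨⟨mul_ne_zero (fn_ne_zero j α) hg.1, ?_⟩, dvd_mul_right _ _⟩
        rw [natDegree_mul (fn_ne_zero j α) hg.1, fn_natDegree (by omega) α hα, hg.2]
        omega
    rw [h3, Finset.sum_image (fun x _ y _ h => mul_left_cancel₀ (fn_ne_zero j α) h)]
    exact Finset.sum_congr rfl fun g _ => (hmul _ _).symm
  rw [Finset.sum_congr rfl h1, Finset.sum_comm, aa, Finset.mul_sum]
  refine Finset.sum_congr rfl fun f hf => ?_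
  rw [← Finset.sum_mul]
  congr 1
  have := mangoldt f (Mn_ne_zero hf)
  rw [Mn_natDegree hf] at this
  exact_mod_cast this.symm

end

/-- factorization of a polynomial with constant term one -/
lemma factor_one (n : ℕ) : ∀ P : ℂ[X], P.natDegree = n → P.coeff 0 = 1 →
    ∃ s : Multiset ℂ, s.card = n ∧ P = (s.map fun w => (1 - C w * X)).prod := by
  induction n with
  | zero =>
    intro P hP h0
    refine ⟨0, rfl, ?_⟩
    rw [eq_C_of_natDegree_eq_zero hP, h0]; simp
  | succ n ih =>
    intro P hP h0
    obtain ⟨r, hr⟩ := IsAlgClosed.exists_root P (by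
      intro h
      have := natDegree_eq_of_degree_eq_some h
      simp [hP] at this)
    obtain ⟨Q, hQ⟩ := dvd_iff_isRoot.2 hr
    have hr0 : r ≠ 0 := by
      rintro rfl
      rw [hQ] at h0
      simp at h0
    have hP2 : P = (1 - C r⁻¹ * X) * (C (-r) * Q) := by
      have h1 : (C r : ℂ[X]) * C r⁻¹ = 1 := by rw [← C_mul, mul_inv_cancel₀ hr0, C_1]
      rw [hQ, C_neg]
      linear_combination X * Q * (-h1)
    have hQ0 : C (-r) * Q ≠ 0 := by
      intro h
      rw [hP2, h] at h0
      simp at h0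
    obtain ⟨s, hs, hsQ⟩ := ih (C (-r) * Q) (by
      have hne : (1 - C r⁻¹ * X : ℂ[X]) ≠ 0 := by
        intro h; rw [hP2, h] at h0; simp at h0
      have h1 : (1 - C r⁻¹ * X : ℂ[X]).natDegree = 1 := by
        rw [show (1 - C r⁻¹ * X : ℂ[X]) = C (-r⁻¹) * X + C 1 by rw [C_neg, C_1]; ring]
        exact natDegree_linear (neg_ne_zero.2 (inv_ne_zero hr0))
      rw [hP2, natDegree_mul hne hQ0, h1] at hP
      omega) (by
      rw [hP2, mul_coeff_zero] at h0
      simpa using h0)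
    refine ⟨r⁻¹ ::ₘ s, by simp [hs], ?_⟩
    rw [Multiset.map_cons, Multiset.prod_cons, ← hsQ]
    exact hP2

/-- Newton identity in power series form -/
lemma newton_ps (s : Multiset ℂ) :
    PowerSeries.X * ((derivative (s.map fun w => (1 - C w * X)).prod : ℂ[X]) : PowerSeries ℂ) =
      (((s.map fun w => (1 - C w * X)).prod : ℂ[X]) : PowerSeries ℂ) *
        PowerSeries.mk (fun n => if n = 0 then 0 else -(s.map fun w => w ^ n).sum) := by
  induction s using Multiset.induction_on with
  | empty =>
    simp
    ext n; simp
  | cons w s ih =>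
    rw [Multiset.map_cons, Multiset.prod_cons]
    set P := (s.map fun w => (1 - C w * X)).prod with hP
    set G := PowerSeries.mk (fun n => if n = 0 then 0 else -(s.map fun w => w ^ n).sum) with hG
    set Gw : PowerSeries ℂ := PowerSeries.mk (fun n => if n = 0 then 0 else - w ^ n) with hGw
    have h1 : PowerSeries.mk (fun n => if n = 0 then 0 else -((w ::ₘ s).map fun w => w ^ n).sum) = Gw + G := by
      ext n
      simp only [hG, hGw, PowerSeries.coeff_mk, map_add]
      split_ifs <;> simp; ring
    have h2 : (1 - PowerSeries.C w * PowerSeries.X) * Gw = - (PowerSeries.C w * PowerSeries.X) := by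
      ext n
      rw [sub_mul, one_mul, map_sub, mul_assoc, PowerSeries.coeff_C_mul, map_neg, PowerSeries.coeff_C_mul]
      rcases n with _ | _ | n
      · simp [hGw]
      · rw [mul_comm PowerSeries.X, PowerSeries.coeff_succ_mul_X]; simp [hGw]
      · rw [mul_comm PowerSeries.X, PowerSeries.coeff_succ_mul_X]; simp [hGw, PowerSeries.coeff_X]; ring
    rw [h1, derivative_mul]
    have h3 : derivative (1 - C w * X : ℂ[X]) = - C w := by simp
    rw [h3]
    simp only [coe_add, coe_mul, coe_neg, coe_C, coe_sub, coe_one, coe_X]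
    linear_combination (-(P : PowerSeries ℂ)) * h2 + (1 - PowerSeries.C w * PowerSeries.X) * ih

lemma psi_formula (a ψ : ℕ → ℂ) (m : ℕ) (ha0 : a 0 = 1) (ham : ∀ n, m < n → a n = 0)
    (hrec : ∀ n : ℕ, n * a n = ∑ j ∈ Finset.Icc 1 n, ψ j * a (n - j)) :
    ∃ s : Multiset ℂ, s.card ≤ m ∧ ∀ n, n ≠ 0 → ψ n = -(s.map fun w => w ^ n).sum := by
  set P : ℂ[X] := ∑ i ∈ Finset.range (m + 1), C (a i) * X ^ i with hP
  have hco : ∀ n, P.coeff n = a n := by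
    intro n
    rw [hP, finsetSum_coeff]
    simp only [coeff_C_mul_X_pow]
    rw [Finset.sum_ite_eq]
    split_ifs with h
    · rfl
    · rw [Finset.mem_range] at h
      rw [ham n (by omega)]
  obtain ⟨s, hs, hPs⟩ := factor_one P.natDegree P rfl (by rw [hco, ha0])
  refine ⟨s, ?_, ?_⟩
  · rw [hs]
    rw [natDegree_le_iff_coeff_eq_zero]
    intro n hn
    rw [hco, ham n hn]
  have hps := newton_ps s
  rw [← hPs] at hps
  set q : ℕ → ℂ := fun n => if n = 0 then 0 else -(s.map fun w => w ^ n).sum with hq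
  have hrec2 : ∀ n : ℕ, n * a n = ∑ j ∈ Finset.Icc 1 n, q j * a (n - j) := by
    intro n
    rcases n with _ | n
    · simp
    have := congrArg (PowerSeries.coeff (n + 1)) hps
    rw [PowerSeries.coeff_succ_X_mul, coeff_coe, coeff_derivative, hco, mul_comm (P : PowerSeries ℂ),
      PowerSeries.coeff_mul, Finset.Nat.sum_antidiagonal_eq_sum_range_succ_mk] at this
    simp only [PowerSeries.coeff_mk, coeff_coe, hco] at this
    rw [Finset.sum_range_succ'] at this
    rw [show q 0 = 0 from rfl, zero_mul, add_zero, mul_comm] at this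
    rw [Nat.cast_succ, this]
    rw [Finset.range_eq_Ico, Finset.sum_Ico_add' (fun j => q j * a (n + 1 - j)) 0 (n + 1) 1]
    refine Finset.sum_congr ?_ fun _ _ => rfl
    ext; simp
  intro n hn
  have key : ∀ n, n ≠ 0 → ψ n = q n := by
    intro n
    induction n using Nat.strong_induction_on with
    | _ n ih =>
      intro hn
      have h1 := (hrec n).symm.trans (hrec2 n)
      obtain ⟨n, rfl⟩ := Nat.exists_eq_succ_of_ne_zero hn
      rw [Nat.succ_eq_add_one, Finset.sum_Icc_succ_top (by omega), Finset.sum_Icc_succ_top (by omega), Nat.sub_self, ha0, mul_one, mul_one] at h1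
      rw [Finset.sum_congr rfl (g := fun j => q j * a (n + 1 - j))] at h1
      · exact add_left_cancel h1
      · intro j hj
        rw [Finset.mem_Icc] at hj
        rw [ih j (by omega) (by omega)]
  rw [key n hn, hq]
  simp [hn]

end Sark

namespace Sark

lemma recurrence {κ : Type} [Fintype κ] (u : κ → ℂ) (hu : ∀ i, ‖u i‖ = 1) (L : ℕ) :
    ∃ l, L ≤ l ∧ ∀ i, 1 / 2 ≤ (u i ^ l).re := by
  have hcomp : IsCompact (Set.pi Set.univ (fun _ : κ => Metric.closedBall (0 : ℂ) 1)) :=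
    isCompact_univ_pi fun _ => isCompact_closedBall _ _
  obtain ⟨a, _, φ, hφ, hlim⟩ := hcomp.tendsto_subseq (x := fun l i => u i ^ l) (by
    intro l i _
    simp [hu i])
  rw [Metric.tendsto_atTop] at hlim
  obtain ⟨k0, hk0⟩ := hlim (1 / 4) (by norm_num)
  obtain ⟨j, hj⟩ : ∃ j, k0 ≤ j ∧ φ k0 + L ≤ φ j :=
    ⟨k0 + (φ k0 + L), by omega, (by omega : φ k0 + L ≤ k0 + (φ k0 + L)).trans (hφ.le_apply)⟩
  refine ⟨φ j - φ k0, by omega, fun i => ?_⟩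
  have h1 : ‖u i ^ φ j - u i ^ φ k0‖ < 1 / 2 := by
    have e1 := (dist_le_pi_dist _ _ i).trans_lt (hk0 j hj.1)
    have e2 := (dist_le_pi_dist _ _ i).trans_lt (hk0 k0 le_rfl)
    rw [← dist_eq_norm]
    calc _ ≤ dist (u i ^ φ j) (a i) + dist (u i ^ φ k0) (a i) := dist_triangle_right _ _ _
      _ < 1 / 2 := by
        simp only [Function.comp] at e1 e2
        linarith
  have h2 : ‖u i ^ (φ j - φ k0) - 1‖ < 1 / 2 := by
    have : u i ^ φ j - u i ^ φ k0 = u i ^ φ k0 * (u i ^ (φ j - φ k0) - 1) := by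
      rw [mul_sub, ← pow_add, mul_one]; congr 2; omega
    rw [this, norm_mul, norm_pow, hu, one_pow, one_mul] at h1
    exact h1
  have h3 := (Complex.abs_re_le_norm _).trans_lt h2
  rw [Complex.sub_re, Complex.one_re, abs_lt] at h3
  linarith [h3.1]

lemma one_sided {κ : Type} [Fintype κ] (z : κ → ℂ) (C ρ : ℝ) (hρ : 0 < ρ) (l0 : ℕ)
    (h : ∀ l, l0 ≤ l → (∑ i, z i ^ l).re ≤ C * ρ ^ l) (i : κ) : ‖z i‖ ≤ ρ := by
  by_contra hi
  push Not at hi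
  set B := ‖z i‖ with hB
  have hB0 : 0 < B := hρ.trans hi
  have hr : 1 < B / ρ := (one_lt_div hρ).2 hi
  obtain ⟨L, hL⟩ := (((tendsto_pow_atTop_atTop_of_one_lt hr).eventually_gt_atTop (2 * C)).exists_forall_of_atTop)
  obtain ⟨l, hl, hre⟩ := recurrence (fun i => if z i = 0 then 1 else z i / ‖z i‖) (by
    intro j
    split_ifs with h0
    · simp
    · rw [norm_div, Complex.norm_real, norm_norm, div_self (norm_ne_zero_iff.2 h0)]) (max (l0 + 1) L)
  have hl1 : l0 + 1 ≤ l := (le_max_left _ _).trans hl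
  have hl2 : L ≤ l := (le_max_right _ _).trans hl
  have hterm : ∀ j, ‖z j‖ ^ l / 2 ≤ (z j ^ l).re := by
    intro j
    have h1 := hre j
    by_cases h0 : z j = 0
    · rw [h0, norm_zero, zero_pow (by omega), zero_pow (by omega)]; simp
    · simp only [if_neg h0] at h1
      have h2 : z j ^ l = ((‖z j‖ ^ l : ℝ) : ℂ) * (z j / ‖z j‖) ^ l := by
        rw [div_pow, Complex.ofReal_pow, mul_div_cancel₀]
        simp [h0]
      rw [h2, Complex.re_ofReal_mul]
      have : 0 ≤ ‖z j‖ ^ l := by positivity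
      nlinarith
  have h1 : B ^ l / 2 ≤ (∑ i, z i ^ l).re := by
    rw [Complex.re_sum]
    refine (hterm i).trans (Finset.single_le_sum (f := fun j => (z j ^ l).re) (fun j _ => ?_) (Finset.mem_univ i))
    exact le_trans (by positivity) (hterm j)
  have h2 := h l (by omega)
  have h3 := hL l hl2
  rw [div_pow, lt_div_iff₀ (by positivity)] at h3
  linarith

lemma psi_bound (a ψ : ℕ → ℂ) (m : ℕ) (ha0 : a 0 = 1) (ham : ∀ n, m < n → a n = 0)
    (hrec : ∀ n : ℕ, n * a n = ∑ j ∈ Finset.Icc 1 n, ψ j * a (n - j))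
    (C : ℝ) (M l0 : ℕ) (hM : 0 < M) (hl : ∀ l, l0 ≤ l → -C * 2 ^ (M * l) ≤ (ψ (M * l + M * l)).re)
    (n : ℕ) (hn : n ≠ 0) : ‖ψ n‖ ≤ m * Real.sqrt 2 ^ n := by
  obtain ⟨s, hs, hψ⟩ := psi_formula a ψ m ha0 ham hrec
  have hw : ∀ w ∈ s, ‖w‖ ≤ Real.sqrt 2 := by
    set z : Fin s.toList.length → ℂ := fun i => s.toList.get i ^ (M + M) with hz
    have hsum : ∀ l, ∑ i, z i ^ l = (s.map fun w => w ^ (M * l + M * l)).sum := by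
      intro l
      conv_rhs => rw [← Multiset.coe_toList s]
      rw [Multiset.map_coe, Multiset.sum_coe, ← Fin.sum_univ_fun_getElem]
      refine Finset.sum_congr rfl fun i _ => ?_
      rw [hz]
      dsimp only
      rw [← pow_mul, add_mul]
      rfl
    have key := one_sided z C (2 ^ M) (by positivity) (l0 + 1) (by
      intro l hll
      have h1 := hl l (by omega)
      have : 0 < M * l := Nat.mul_pos hM (by omega)
      rw [hψ _ (by omega)] at h1
      rw [hsum, ← pow_mul]
      rw [Complex.neg_re] at h1
      linarith)
    intro w hw
    obtain ⟨i, hi⟩ := List.get_of_mem (Multiset.mem_toList.2 hw)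
    have h2 := key i
    rw [hz] at h2
    dsimp only at h2
    rw [hi, norm_pow] at h2
    have h3 : (2 : ℝ) ^ M = Real.sqrt 2 ^ (M + M) := by
      rw [← two_mul, pow_mul, Real.sq_sqrt (by norm_num)]
    rw [h3] at h2
    exact le_of_pow_le_pow_left₀ (by omega) (by positivity) h2
  rw [hψ n hn, norm_neg]
  calc ‖(s.map fun w => w ^ n).sum‖ ≤ ((s.map fun w => w ^ n).map norm).sum := by
        have := Multiset.le_sum_of_subadditive (fun x : ℂ => ‖x‖) norm_zero.le norm_add_le (s.map fun w => w ^ n)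
        exact this
    _ ≤ (s.map fun w => w ^ n).card • Real.sqrt 2 ^ n := by
        rw [← Multiset.card_map norm]
        apply Multiset.sum_le_card_nsmul
        intro x hx
        simp only [Multiset.mem_map, exists_exists_and_eq_and] at hx
        obtain ⟨w, hws, rfl⟩ := hx
        rw [norm_pow]
        exact pow_le_pow_left₀ (norm_nonneg _) (hw w hws) n
    _ ≤ _ := by
        rw [Multiset.card_map, nsmul_eq_mul]
        exact mul_le_mul_of_nonneg_right (by exact_mod_cast hs) (by positivity)

end Sark

namespace Sark

def Irr (n : ℕ) : Finset (ZMod 2)[X] := (Mn n).filter Irreducible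

lemma pow_half_le (n : ℕ) : (2 : ℝ) ^ (n / 2) ≤ Real.sqrt 2 ^ n := by
  have h3 : (2 : ℝ) ^ (n / 2) = Real.sqrt 2 ^ (2 * (n / 2)) := by
    rw [pow_mul, Real.sq_sqrt (by norm_num)]
  rw [h3]
  exact pow_le_pow_right₀ (by rw [Real.one_le_sqrt]; norm_num) (by omega)

lemma psi_primes (c : (ZMod 2)[X] → ℂ) (hc : ∀ f, ‖c f‖ ≤ 1) (n : ℕ) (hn : n ≠ 0) :
    ‖psi c n - n * ∑ r ∈ Irr n, c r‖ ≤ 2 * Real.sqrt 2 ^ n := by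
  have h1 : ∑ α ∈ (Tn n).filter (fun α => (mp α).natDegree = n), c (fn n α) = n * ∑ r ∈ Irr n, c r := by
    have h2 : ∀ α ∈ (Tn n).filter (fun α => (mp α).natDegree = n), mp α ∈ Irr n := by
      intro α hα
      rw [Finset.mem_filter] at hα
      rw [Irr, Finset.mem_filter, mem_Mn']
      exact ⟨⟨(mp_irr α).ne_zero, hα.2⟩, mp_irr α⟩
    rw [← Finset.sum_fiberwise_of_maps_to h2, Finset.mul_sum]
    refine Finset.sum_congr rfl fun r hr => ?_
    rw [Irr, Finset.mem_filter, mem_Mn'] at hr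
    obtain ⟨⟨hr0, hrn⟩, hri⟩ := hr
    rw [Finset.sum_congr rfl (g := fun _ => c r), Finset.sum_const, nsmul_eq_mul]
    · congr 2
      have hmpr : ∀ α : Wc, mp α = r ↔ α ∈ (r.map (algebraMap (ZMod 2) Wc)).roots.toFinset := by
        intro α
        rw [Multiset.mem_toFinset, mem_roots (map_monic_ne_zero (monic_of_ne hr0)), IsRoot, eval_map_algebraMap]
        constructor
        · rintro rfl; exact minpoly.aeval _ _
        · intro h
          exact (minpoly.eq_of_irreducible_of_monic hri h (monic_of_ne hr0)).symm
      have : ((Tn n).filter (fun α => (mp α).natDegree = n)).filter (fun α => mp α = r) =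
          (r.map (algebraMap (ZMod 2) Wc)).roots.toFinset := by
        ext α
        rw [← hmpr, Finset.mem_filter, Finset.mem_filter, mem_Tn hn, pow_eq_iff]
        constructor
        · exact fun h => h.2
        · rintro rfl
          exact ⟨⟨hrn ▸ dvd_rfl, hrn⟩, rfl⟩
      rw [this, Multiset.toFinset_card_of_nodup]
      · rw [← (IsAlgClosed.splits _).natDegree_eq_card_roots, natDegree_map, hrn]
      · exact nodup_roots (PerfectField.separable_of_irreducible hri).map
    · intro α hα
      rw [Finset.mem_filter, Finset.mem_filter] at hα
      rw [fn, hα.1.2, Nat.div_self (by omega), pow_one, hα.2]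
  have h2 : psi c n - n * ∑ r ∈ Irr n, c r = ∑ α ∈ (Tn n).filter (fun α => ¬ (mp α).natDegree = n), c (fn n α) := by
    rw [← h1, psi, ← Finset.sum_filter_add_sum_filter_not (Tn n) (fun α => (mp α).natDegree = n)]
    ring
  rw [h2]
  refine (norm_sum_le _ _).trans ((Finset.sum_le_sum fun α _ => hc _).trans ?_)
  rw [Finset.sum_const, nsmul_eq_mul, mul_one]
  have h3 : ((Tn n).filter (fun α => ¬ (mp α).natDegree = n)).card ≤ 2 * 2 ^ (n / 2) := by
    calc _ ≤ ((Finset.Icc 1 (n / 2)).biUnion Tn).card := by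
          apply Finset.card_le_card
          intro α hα
          rw [Finset.mem_filter, mem_Tn hn, pow_eq_iff] at hα
          have hd := mp_deg_pos α
          rw [Finset.mem_biUnion]
          refine ⟨(mp α).natDegree, ?_, by rw [mem_Tn hd.ne', pow_eq_iff]⟩
          rw [Finset.mem_Icc]
          refine ⟨hd, ?_⟩
          obtain ⟨⟨q, hq⟩, h⟩ := hα
          have hq2 : 2 ≤ q := by
            by_contra h'
            have : q = 0 ∨ q = 1 := by omega
            rcases this with rfl | rfl
            · simp at hq; exact hn hq
            · simp at hq; exact h hq.symm
          rw [Nat.le_div_iff_mul_le (by norm_num)]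
          calc _ ≤ (mp α).natDegree * q := Nat.mul_le_mul_left _ hq2
            _ = n := hq.symm
      _ ≤ ∑ d ∈ Finset.Icc 1 (n / 2), (Tn d).card := Finset.card_biUnion_le
      _ = ∑ d ∈ Finset.Icc 1 (n / 2), 2 ^ d := by
          refine Finset.sum_congr rfl fun d hd => card_Tn ?_
          rw [Finset.mem_Icc] at hd; omega
      _ ≤ ∑ d ∈ Finset.range (n / 2 + 1), 2 ^ d := by
          apply Finset.sum_le_sum_of_subset
          intro d hd
          rw [Finset.mem_Icc] at hd; rw [Finset.mem_range]; omega
      _ ≤ 2 * 2 ^ (n / 2) := by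
          have := Nat.geomSum_eq (le_refl 2) (n / 2 + 1)
          rw [this]; simp [pow_succ]; omega
  have h4 : (((Tn n).filter (fun α => ¬ (mp α).natDegree = n)).card : ℝ) ≤ 2 * 2 ^ (n / 2) := by exact_mod_cast h3
  linarith [pow_half_le n]

/-- the ring of residues modulo `h` and of leading coefficients -/
abbrev Rg (h : (ZMod 2)[X]) (K : ℕ) := AdjoinRoot h × AdjoinRoot (X ^ K : (ZMod 2)[X])

lemma finite_AdjoinRoot {h : (ZMod 2)[X]} (hh : h ≠ 0) : Finite (AdjoinRoot h) := by
  haveI := PowerBasis.finite (AdjoinRoot.powerBasis hh)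
  exact Module.finite_of_finite (ZMod 2)

lemma card_AdjoinRoot {h : (ZMod 2)[X]} (hh : h ≠ 0) : Nat.card (AdjoinRoot h) = 2 ^ h.natDegree := by
  haveI := PowerBasis.finite (AdjoinRoot.powerBasis hh)
  rw [Module.natCard_eq_pow_finrank (K := ZMod 2), PowerBasis.finrank (AdjoinRoot.powerBasis hh), AdjoinRoot.powerBasis_dim]
  simp

lemma finite_Rg {h : (ZMod 2)[X]} (hh : h ≠ 0) (K : ℕ) : Finite (Rg h K) := by
  haveI := finite_AdjoinRoot hh
  haveI := finite_AdjoinRoot (pow_ne_zero K (X_ne_zero (R := ZMod 2)))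
  infer_instance

lemma card_Rg {h : (ZMod 2)[X]} (hh : h ≠ 0) (K : ℕ) : Nat.card (Rg h K) = 2 ^ (h.natDegree + K) := by
  rw [Nat.card_prod, card_AdjoinRoot hh, card_AdjoinRoot (pow_ne_zero K (X_ne_zero (R := ZMod 2))), pow_add]
  simp

section
variable (h : (ZMod 2)[X]) (K : ℕ)

def xi : Rg h K := (AdjoinRoot.root h, 1)
def zet : Rg h K := (1, AdjoinRoot.root (X ^ K))

def PhiN (n : ℕ) (f : (ZMod 2)[X]) : Rg h K := (AdjoinRoot.mk h f, AdjoinRoot.mk (X ^ K) (f.reflect n))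

def Phi (f : (ZMod 2)[X]) : Rg h K := (AdjoinRoot.mk h f, AdjoinRoot.mk (X ^ K) f.reverse)

lemma Phi_mul (f g : (ZMod 2)[X]) : Phi h K (f * g) = Phi h K f * Phi h K g := by
  rw [Phi, Phi, Phi, reverse_mul_of_domain]
  simp

lemma Phi_one : Phi h K 1 = 1 := by
  rw [Phi, ← C_1, reverse_C]
  simp

lemma homv_eq (n : ℕ) (f : (ZMod 2)[X]) (hf : f.natDegree ≤ n) : homv n f (xi h K) (zet h K) = PhiN h K n f := by
  rw [homv, PhiN]
  refine Prod.ext ?_ ?_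
  · rw [Prod.fst_sum]
    conv_rhs => rw [f.as_sum_range_C_mul_X_pow' (Nat.lt_succ_of_le hf)]
    simp only [map_sum, map_mul, map_pow, AdjoinRoot.mk_X, xi, zet, Prod.smul_fst, Prod.fst_mul, Prod.pow_fst, one_pow, mul_one,
      Algebra.smul_def, AdjoinRoot.mk_C]
    rfl
  · rw [Prod.snd_sum]
    have h1 : (f.reflect n).natDegree < n + 1 := by
      rw [Nat.lt_succ_iff, natDegree_le_iff_coeff_eq_zero]
      intro N hN
      rw [coeff_reflect, revAt_eq_self_of_lt hN]
      exact coeff_eq_zero_of_natDegree_lt (by omega)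
    conv_rhs => rw [(f.reflect n).as_sum_range_C_mul_X_pow' h1]
    rw [← Finset.sum_range_reflect]
    simp only [map_sum, map_mul, map_pow, AdjoinRoot.mk_X, xi, zet, Prod.smul_snd, Prod.snd_mul, Prod.pow_snd, one_pow, one_mul,
      Algebra.smul_def, AdjoinRoot.mk_C, coeff_reflect]
    refine Finset.sum_congr rfl fun i hi => ?_
    rw [Finset.mem_range] at hi
    rw [revAt_le (by omega), show n + 1 - 1 - i = n - i by omega, show n - (n - i) = i by omega]
    rfl

lemma Phi_eq_PhiN {n : ℕ} {f : (ZMod 2)[X]} (hf : f.natDegree = n) : Phi h K f = PhiN h K n f := by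
  rw [Phi, PhiN, reverse, hf]

lemma isUnit_mk_iff (h f : (ZMod 2)[X]) : IsUnit (AdjoinRoot.mk h f) ↔ IsCoprime f h := by
  constructor
  · intro hu
    obtain ⟨g, hg⟩ := hu.exists_right_inv
    obtain ⟨g, rfl⟩ := AdjoinRoot.mk_surjective g
    rw [← map_mul, ← map_one (AdjoinRoot.mk h), AdjoinRoot.mk_eq_mk] at hg
    obtain ⟨q, hq⟩ := hg
    exact ⟨g, -q, by linear_combination hq⟩
  · rintro ⟨a, b, hab⟩
    refine IsUnit.of_mul_eq_one (AdjoinRoot.mk h a) ?_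
    rw [← map_mul, ← map_one (AdjoinRoot.mk h), AdjoinRoot.mk_eq_mk]
    exact ⟨-b, by linear_combination hab⟩

lemma isUnit_Phi_iff (f : (ZMod 2)[X]) (hf : f ≠ 0) : IsUnit (Phi h K f) ↔ IsCoprime f h := by
  rw [Prod.isUnit_iff, Phi]
  dsimp only
  rw [isUnit_mk_iff, isUnit_mk_iff, and_iff_left]
  apply IsCoprime.pow_right
  refine (irreducible_X.coprime_iff_not_dvd.2 ?_).symm
  rw [X_dvd_iff, coeff_zero_reverse]
  exact leadingCoeff_ne_zero.2 hf

end

end Sark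

namespace Sark

section
variable {h : (ZMod 2)[X]} (hh : h ≠ 0) (K n : ℕ)

lemma PhiN_add (h : (ZMod 2)[X]) (f g : (ZMod 2)[X]) : PhiN h K n (f + g) = PhiN h K n f + PhiN h K n g := by
  simp [PhiN]

lemma PhiN_sub (h : (ZMod 2)[X]) (f g : (ZMod 2)[X]) : PhiN h K n (f - g) = PhiN h K n f - PhiN h K n g := by
  simp [PhiN]

lemma PhiN_surj {h : (ZMod 2)[X]} (hh : h ≠ 0) (hn : h.natDegree + K ≤ n + 1) (r : Rg h K) :
    ∃ f ∈ Pl (n + 1), PhiN h K n f = r := by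
  obtain ⟨a, b⟩ := r
  obtain ⟨p, rfl⟩ := AdjoinRoot.mk_surjective a
  obtain ⟨q, rfl⟩ := AdjoinRoot.mk_surjective b
  have hXK : (X ^ K : (ZMod 2)[X]).Monic := monic_X_pow K
  set q0 := q %ₘ X ^ K with hq0
  have hq0d : q0.degree < K := by
    have := degree_modByMonic_lt q hXK
    rwa [degree_X_pow] at this
  set f1 := q0.reflect n with hf1
  set f2 := (p - f1) %ₘ h with hf2
  have hhm : h.Monic := monic_of_ne hh
  have hf2d : f2.degree < h.natDegree := by
    have := degree_modByMonic_lt (p - f1) hhm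
    rwa [degree_eq_natDegree hh] at this
  refine ⟨f1 + f2, ?_, ?_⟩
  · rw [mem_Pl, degree_lt_iff_coeff_zero]
    intro i hi
    rw [coeff_add, coeff_eq_zero_of_degree_lt (hf2d.trans_le (by exact_mod_cast (by omega : h.natDegree ≤ i))),
      add_zero, hf1, coeff_reflect, revAt_eq_self_of_lt (by omega)]
    by_cases hK : K ≤ i
    · exact coeff_eq_zero_of_degree_lt (hq0d.trans_le (by exact_mod_cast hK))
    · omega
  · rw [PhiN]
    refine Prod.ext ?_ ?_
    · dsimp only
      rw [AdjoinRoot.mk_eq_mk]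
      refine ⟨-((p - f1) /ₘ h), ?_⟩
      have := modByMonic_add_div (p - f1) h
      linear_combination this
    · dsimp only
      rw [AdjoinRoot.mk_eq_mk, reflect_add, hf1]
      have h1 : (q0.reflect n).reflect n = q0 := by
        ext i
        rw [coeff_reflect, coeff_reflect, revAt_invol]
      rw [h1]
      have h2 : X ^ K ∣ f2.reflect n := by
        rw [X_pow_dvd_iff]
        intro d hd
        rw [coeff_reflect]
        apply coeff_eq_zero_of_degree_lt
        refine hf2d.trans_le ?_
        rw [revAt_le (by omega)]
        exact_mod_cast (by omega : h.natDegree ≤ n - d)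
      have h3 : X ^ K ∣ q0 - q := by
        refine ⟨-(q /ₘ X ^ K), ?_⟩
        have := modByMonic_add_div q (X ^ K)
        linear_combination this
      have : q0 + f2.reflect n - q = (q0 - q) + f2.reflect n := by ring
      rw [this]
      exact dvd_add h3 h2

lemma fiber_count {h : (ZMod 2)[X]} (hh : h ≠ 0) (hn : h.natDegree + K ≤ n + 1) (r : Rg h K) :
    ((Pl (n + 1)).filter fun f => PhiN h K n f = r).card = 2 ^ (n + 1 - (h.natDegree + K)) := by
  haveI := finite_Rg hh K
  letI := Fintype.ofFinite (Rg h K)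
  set fib : Rg h K → ℕ := fun r => ((Pl (n + 1)).filter fun f => PhiN h K n f = r).card with hfib
  have h1 : ∀ r, fib r = fib 0 := by
    intro r
    obtain ⟨f0, hf0, hf0r⟩ := PhiN_surj K n hh hn r
    apply Finset.card_bij (fun f _ => f - f0)
    · intro f hf
      rw [Finset.mem_filter, mem_Pl] at hf ⊢
      rw [mem_Pl] at hf0
      refine ⟨(degree_sub_le _ _).trans_lt (max_lt hf.1 hf0), ?_⟩
      rw [PhiN_sub, hf.2, hf0r, sub_self]
    · intro a _ b _ hab
      exact sub_left_injective hab
    · intro g hg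
      rw [Finset.mem_filter, mem_Pl] at hg
      rw [mem_Pl] at hf0
      refine ⟨g + f0, ?_, by ring⟩
      rw [Finset.mem_filter, mem_Pl]
      refine ⟨(degree_add_le _ _).trans_lt (max_lt hg.1 hf0), ?_⟩
      rw [PhiN_add, hg.2, hf0r, zero_add]
  have h2 : 2 ^ (n + 1) = ∑ r : Rg h K, fib r := by
    rw [← card_Pl (n + 1)]
    exact Finset.card_eq_sum_card_fiberwise (fun _ _ => by simp)
  rw [Finset.sum_congr rfl (fun r _ => h1 r), Finset.sum_const, smul_eq_mul, Finset.card_univ,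
    ← Nat.card_eq_fintype_card, card_Rg hh] at h2
  change fib r = _
  rw [h1]
  have h3 : 2 ^ (n + 1) = 2 ^ (h.natDegree + K) * 2 ^ (n + 1 - (h.natDegree + K)) := by
    rw [← pow_add]; congr 1; omega
  rw [h3] at h2
  exact (Nat.eq_of_mul_eq_mul_left (by positivity) h2).symm

lemma fiber_unit {h : (ZMod 2)[X]} (hK : 1 ≤ K) (r : Rg h K) (hr : IsUnit r) :
    (Mn n).filter (fun f => Phi h K f = r) = (Pl (n + 1)).filter (fun f => PhiN h K n f = r) := by
  ext f
  rw [Finset.mem_filter, Finset.mem_filter]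
  constructor
  · rintro ⟨h1, h2⟩
    refine ⟨?_, by rw [← Phi_eq_PhiN h K (Mn_natDegree h1), h2]⟩
    rw [Mn, Finset.mem_filter] at h1
    exact h1.1
  · rintro ⟨h1, h2⟩
    have h3 : f ∈ Mn n := by
      rw [← h2, PhiN, Prod.isUnit_iff] at hr
      have h4 := (isUnit_mk_iff _ _).1 hr.2
      have h5 : ¬ X ∣ f.reflect n := by
        intro hd
        have := (h4.of_isCoprime_of_dvd_left hd).of_isCoprime_of_dvd_right (dvd_pow_self X (by omega : K ≠ 0))
        exact irreducible_X.not_isUnit (isCoprime_self.1 this)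
      rw [X_dvd_iff, coeff_reflect, revAt_zero] at h5
      rw [mem_Pl] at h1
      rw [mem_Mn]
      refine le_antisymm ?_ (le_degree_of_ne_zero h5)
      exact Order.lt_succ_iff.1 (by exact_mod_cast h1)
    exact ⟨h3, by rw [Phi_eq_PhiN h K (Mn_natDegree h3), h2]⟩

lemma sum_Mn {S : Type} [CommRing S] {h : (ZMod 2)[X]} [Fintype (Rg h K)] (hh : h ≠ 0) (hK : 1 ≤ K)
    (hn : h.natDegree + K ≤ n + 1)
    (G : Rg h K → S) (hG : ∀ r, ¬ IsUnit r → G r = 0) :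
    ∑ f ∈ Mn n, G (Phi h K f) = 2 ^ (n + 1 - (h.natDegree + K)) * ∑ r, G r := by
  rw [← Finset.sum_fiberwise_of_maps_to (t := Finset.univ) (g := fun f => Phi h K f) (fun _ _ => Finset.mem_univ _),
    Finset.mul_sum]
  refine Finset.sum_congr rfl fun r _ => ?_
  rw [Finset.sum_congr rfl (g := fun _ => G r), Finset.sum_const, nsmul_eq_mul]
  · by_cases hr : IsUnit r
    · rw [fiber_unit K n hK r hr, fiber_count K n hh hn]
      push_cast; rfl
    · rw [hG r hr]; simp
  · intro f hf
    rw [(Finset.mem_filter.1 hf).2]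

end

lemma mulChar_norm {R : Type} [CommRing R] [Finite R] (χ : MulChar R ℂ) (x : R) : ‖χ x‖ ≤ 1 := by
  letI := Fintype.ofFinite R
  by_cases hx : IsUnit x
  · obtain ⟨r, rfl⟩ := hx
    have hfin : (r : R) ^ Fintype.card Rˣ = 1 := by
      rw [← Units.val_pow_eq_pow_val, pow_card_eq_one]; simp
    have := congrArg χ hfin
    rw [map_pow, map_one] at this
    exact (Complex.norm_eq_one_of_pow_eq_one this Fintype.card_ne_zero).le
  · rw [χ.map_nonunit hx]; simp

theorem char_primes {h : (ZMod 2)[X]} (hh : h ≠ 0) (K : ℕ) (hK : 1 ≤ K) (χ : MulChar (Rg h K) ℂ) (n : ℕ) (hn : n ≠ 0)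
    (v : ℂ) (hv1 : χ = 1 → v = 2 ^ n) (hv0 : χ ≠ 1 → v = 0) :
    ‖n * ∑ r ∈ Irr n, χ (Phi h K r) - v‖ ≤ (h.natDegree + K + 2) * Real.sqrt 2 ^ n := by
  haveI := finite_Rg hh K
  letI := Fintype.ofFinite (Rg h K)
  set c : (ZMod 2)[X] → ℂ := fun f => χ (Phi h K f) with hc
  have hcmul : ∀ f g, c (f * g) = c f * c g := by
    intro f g
    simp only [hc, Phi_mul, map_mul]
  have hc1 : c 1 = 1 := by simp only [hc, Phi_one, map_one]
  have hpr := psi_primes c (fun f => mulChar_norm χ _) n hn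
  have hsq1 : 1 ≤ Real.sqrt 2 ^ n := one_le_pow₀ (by rw [Real.one_le_sqrt]; norm_num)
  have key : ‖psi c n - v‖ ≤ (h.natDegree + K) * Real.sqrt 2 ^ n := by
    by_cases hχ : χ = 1
    · rw [hv1 hχ]
      have h1 : psi c n - 2 ^ n = ∑ α ∈ Tn n, (c (fn n α) - 1) := by
        rw [Finset.sum_sub_distrib, Finset.sum_const, card_Tn hn, psi]; simp
      rw [h1]
      have h2 : ∀ α ∈ Tn n, α ∉ (h.map (algebraMap (ZMod 2) Wc)).roots.toFinset → c (fn n α) - 1 = 0 := by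
        intro α _ hα
        rw [Multiset.mem_toFinset, mem_roots (map_monic_ne_zero (monic_of_ne hh)), IsRoot, eval_map_algebraMap,
          ← minpoly.dvd_iff] at hα
        have h3 : IsUnit (Phi h K (fn n α)) := by
          rw [isUnit_Phi_iff h K _ (fn_ne_zero n α)]
          exact IsCoprime.pow_left ((mp_irr α).coprime_iff_not_dvd.2 hα)
        rw [hc, hχ]
        dsimp only
        rw [MulChar.one_apply h3, sub_self]
      have h4 : ∑ α ∈ Tn n, (c (fn n α) - 1) =
          ∑ α ∈ (Tn n).filter (fun α => α ∈ (h.map (algebraMap (ZMod 2) Wc)).roots.toFinset), (c (fn n α) - 1) := by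
        rw [Finset.sum_filter]
        refine Finset.sum_congr rfl fun α hα => ?_
        split_ifs with h5
        · rfl
        · exact h2 α hα h5
      rw [h4]
      have h6 : ∀ α, ‖c (fn n α) - 1‖ ≤ 1 := by
        intro α
        rw [hc, hχ]
        dsimp only
        by_cases h3 : IsUnit (Phi h K (fn n α))
        · rw [MulChar.one_apply h3]; simp
        · rw [MulChar.map_nonunit _ h3]; simp
      refine (norm_sum_le _ _).trans ((Finset.sum_le_sum fun α _ => h6 α).trans ?_)
      rw [Finset.sum_const, nsmul_eq_mul, mul_one]
      have h7 : ((Tn n).filter (fun α => α ∈ (h.map (algebraMap (ZMod 2) Wc)).roots.toFinset)).card ≤ h.natDegree := by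
        calc _ ≤ (h.map (algebraMap (ZMod 2) Wc)).roots.toFinset.card := by
              apply Finset.card_le_card
              intro α hα
              exact (Finset.mem_filter.1 hα).2
          _ ≤ _ := (Multiset.toFinset_card_le _).trans ((card_roots' _).trans (natDegree_map_le))
      have h8 : (((Tn n).filter (fun α => α ∈ (h.map (algebraMap (ZMod 2) Wc)).roots.toFinset)).card : ℝ)
        ≤ h.natDegree := by exact_mod_cast h7
      have h9 : (0 : ℝ) ≤ h.natDegree := Nat.cast_nonneg _
      have h10 : (0 : ℝ) ≤ K := Nat.cast_nonneg _
      nlinarith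
    · rw [hv0 hχ, sub_zero]
      obtain ⟨C, M, l0, hM, hl⟩ := charsum_lower (xi h K) (zet h K) (fun n α => Phi h K (fn n α)) (by
        intro n hn α hα
        refine ⟨fn n α, fn_map hn α hα, ?_⟩
        rw [homv_eq h K n _ (fn_natDegree hn α hα).le, Phi_eq_PhiN h K (fn_natDegree hn α hα)]) χ
      have := psi_bound (aa c) (psi c) (h.natDegree + K) (by
        have : Mn 0 = {1} := by
          ext f
          rw [mem_Mn', Finset.mem_singleton]
          constructor
          · rintro ⟨h1, h2⟩
            exact (monic_of_ne h1).natDegree_eq_zero.1 h2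
          · rintro rfl; simp
        rw [aa, this, Finset.sum_singleton, hc1]) (by
        intro n hn
        rw [aa, hc]
        dsimp only
        rw [sum_Mn K n hh hK (by omega) (fun r => χ r) (fun r hr => χ.map_nonunit hr),
          MulChar.sum_eq_zero_of_ne_one hχ, mul_zero]) (newton_rec c hcmul) C M l0 hM hl n hn
      push_cast at this
      exact this
  have h1 : (n : ℂ) * ∑ r ∈ Irr n, c r - v = (psi c n - v) - (psi c n - n * ∑ r ∈ Irr n, c r) := by ring
  change ‖(n : ℂ) * ∑ r ∈ Irr n, c r - v‖ ≤ _
  rw [h1]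
  refine (norm_sub_le _ _).trans ?_
  linarith

end Sark

namespace Sark

section
variable {R : Type} [CommRing R] [Finite R]

lemma orth [Fintype (MulChar R ℂ)] (a b : R) (ha : IsUnit a) :
    ∑ χ : MulChar R ℂ, star (χ a) * χ b = if a = b then (Nat.card Rˣ : ℂ) else 0 := by
  have h1 : ∀ χ : MulChar R ℂ, star (χ a) * χ b = χ (Ring.inverse a * b) := by
    intro χ
    rw [MulChar.star_apply', MulChar.inv_apply, map_mul]
  simp only [h1]
  split_ifs with h
  · subst h
    rw [Ring.inverse_mul_cancel _ ha]
    simp only [map_one, Finset.sum_const, Finset.card_univ, nsmul_eq_mul, mul_one]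
    rw [← MulChar.card_eq_card_units_of_hasEnoughRootsOfUnity R ℂ, Nat.card_eq_fintype_card]
  · have h2 : Ring.inverse a * b ≠ 1 := by
      intro h2
      apply h
      calc a = a * (Ring.inverse a * b) := by rw [h2, mul_one]
        _ = b := by rw [← mul_assoc, Ring.mul_inverse_cancel _ ha, one_mul]
    obtain ⟨χ, hχ⟩ := MulChar.exists_apply_ne_one_of_hasEnoughRootsOfUnity R ℂ h2
    refine eq_zero_of_mul_eq_self_left hχ ?_
    simp only [Finset.mul_sum, ← MulChar.mul_apply]
    exact Fintype.sum_bijective _ (Group.mulLeft_bijective χ) _ _ fun χ' ↦ rfl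

lemma equi_abs [Fintype R] {ι : Type} (I : Finset ι) (p : ι → R) (n : ℂ) (V E : ℝ)
    (hE : ∀ χ : MulChar R ℂ, ∀ v : ℂ, (χ = 1 → v = V) → (χ ≠ 1 → v = 0) →
      ‖n * ∑ i ∈ I, χ (p i) - v‖ ≤ E) (φ : R → ℝ) (hφ : ∀ r, ¬ IsUnit r → φ r = 0) :
    ‖n * ∑ i ∈ I, (φ (p i) : ℂ) - V / Nat.card Rˣ * ∑ r, (φ r : ℂ)‖ ≤ E * Real.sqrt (∑ r, φ r ^ 2) := by
  haveI : Finite (MulChar R ℂ) := inferInstance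
  letI : Fintype (MulChar R ℂ) := Fintype.ofFinite _
  have hE0 : 0 ≤ E := (norm_nonneg _).trans (hE 1 V (fun _ => rfl) (fun h => absurd rfl h))
  set U : ℂ := (Nat.card Rˣ : ℂ) with hU
  have hU0 : U ≠ 0 := by
    rw [hU]; exact_mod_cast Nat.card_pos.ne'
  set c : MulChar R ℂ → ℂ := fun χ => (∑ s, φ s * star (χ s)) / U with hc
  have hex : ∀ x, (φ x : ℂ) = ∑ χ, c χ * χ x := by
    intro x
    by_cases hx : IsUnit x
    · have : ∀ χ : MulChar R ℂ, c χ * χ x = (∑ s, φ s * (star (χ s) * χ x)) / U := by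
        intro χ
        rw [hc]
        simp only [← mul_assoc, ← Finset.sum_mul]
        ring
      simp only [this]
      rw [← Finset.sum_div, Finset.sum_comm]
      have h2 : ∀ s : R, ∑ χ : MulChar R ℂ, (φ s : ℂ) * (star (χ s) * χ x) = if s = x then φ s * U else 0 := by
        intro s
        by_cases hs : IsUnit s
        · rw [← Finset.mul_sum, orth s x hs]
          split_ifs
          · rw [hU]
          · simp
        · rw [hφ s hs]; simp
      simp only [h2]
      rw [Finset.sum_ite_eq' Finset.univ x, if_pos (Finset.mem_univ _)]
      field_simp
    · rw [hφ x hx]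
      simp [MulChar.map_nonunit _ hx]
  have hpars : ∑ χ, ‖c χ‖ ^ 2 = (∑ r, φ r ^ 2) / Nat.card Rˣ := by
    have : ((∑ χ, ‖c χ‖ ^ 2 : ℝ) : ℂ) = (∑ r, (φ r : ℂ) ^ 2) / U := by
      push_cast
      have h1 : ∀ χ : MulChar R ℂ, ((‖c χ‖ : ℂ)) ^ 2 = (∑ s, φ s * (star (c χ * χ s))) / U := by
        intro χ
        rw [← Complex.mul_conj']
        nth_rewrite 1 [hc]
        simp only [star_mul']
        rw [div_mul_eq_mul_div, Finset.sum_mul]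
        congr 1
        refine Finset.sum_congr rfl fun s _ => ?_
        simp only [RCLike.star_def]
        ring
      simp only [h1]
      rw [← Finset.sum_div, Finset.sum_comm]
      congr 1
      refine Finset.sum_congr rfl fun s _ => ?_
      rw [← Finset.mul_sum, ← star_sum, ← hex]
      simp [pow_two]
    have h2 : ((∑ χ, ‖c χ‖ ^ 2 : ℝ) : ℂ) = (((∑ r, φ r ^ 2) / Nat.card Rˣ : ℝ) : ℂ) := by
      rw [this]; push_cast; rfl
    exact_mod_cast h2
  have hcard : (Fintype.card (MulChar R ℂ) : ℝ) = Nat.card Rˣ := by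
    rw [← MulChar.card_eq_card_units_of_hasEnoughRootsOfUnity R ℂ, Nat.card_eq_fintype_card]
  have hcs : ∑ χ, ‖c χ‖ ≤ Real.sqrt (∑ r, φ r ^ 2) := by
    apply Real.le_sqrt_of_sq_le
    have h3 := sq_sum_le_card_mul_sum_sq (s := (Finset.univ : Finset (MulChar R ℂ))) (f := fun χ => ‖c χ‖)
    rw [hpars, Finset.card_univ, hcard] at h3
    have : (0 : ℝ) < Nat.card Rˣ := by exact_mod_cast Nat.card_pos
    rwa [mul_div_cancel₀ _ this.ne'] at h3
  set v : MulChar R ℂ → ℂ := fun χ => if χ = 1 then V else 0 with hv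
  have hmain : n * ∑ i ∈ I, (φ (p i) : ℂ) - V / U * ∑ r, (φ r : ℂ) =
      ∑ χ, c χ * (n * ∑ i ∈ I, χ (p i) - v χ) := by
    have h1 : n * ∑ i ∈ I, (φ (p i) : ℂ) = ∑ χ, c χ * (n * ∑ i ∈ I, χ (p i)) := by
      simp only [hex, Finset.mul_sum]
      rw [Finset.sum_comm]
      refine Finset.sum_congr rfl fun χ _ => Finset.sum_congr rfl fun i _ => by ring
    have h2 : ∑ χ, c χ * v χ = V / U * ∑ r, (φ r : ℂ) := by
      rw [hv]
      simp only [mul_ite, mul_zero]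
      rw [Finset.sum_ite_eq' Finset.univ (1 : MulChar R ℂ), if_pos (Finset.mem_univ _), hc]
      simp only
      have h3 : ∀ s : R, (φ s : ℂ) * star ((1 : MulChar R ℂ) s) = φ s := by
        intro s
        by_cases hs : IsUnit s
        · rw [MulChar.one_apply hs]; simp
        · rw [hφ s hs]; simp
      simp only [h3]
      ring
    simp only [mul_sub, Finset.sum_sub_distrib]
    rw [h1, h2]
  rw [hmain]
  calc _ ≤ ∑ χ, ‖c χ‖ * E := by
        refine (norm_sum_le _ _).trans (Finset.sum_le_sum fun χ _ => ?_)
        rw [norm_mul]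
        refine mul_le_mul_of_nonneg_left (hE χ _ (fun h => ?_) (fun h => ?_)) (norm_nonneg _)
        · rw [hv]; simp only [if_pos h]
        · rw [hv]; simp only [if_neg h]
    _ = E * ∑ χ, ‖c χ‖ := by rw [← Finset.sum_mul, mul_comm]
    _ ≤ _ := mul_le_mul_of_nonneg_left hcs hE0
end

end Sark

namespace Sark

lemma Phi_eq_imp {h : (ZMod 2)[X]} {K n : ℕ} {f f' : (ZMod 2)[X]} (hf : f ∈ Mn n) (hf' : f' ∈ Mn n)
    (he : Phi h K f = Phi h K f') : h ∣ f - f' ∧ f - f' ∈ Pl (n + 1 - K) := by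
  rw [Phi_eq_PhiN h K (Mn_natDegree hf), Phi_eq_PhiN h K (Mn_natDegree hf'), ← sub_eq_zero, ← PhiN_sub, PhiN] at he
  have h1 := congrArg Prod.fst he
  have h2 := congrArg Prod.snd he
  simp only [Prod.fst_zero, Prod.snd_zero, AdjoinRoot.mk_eq_zero] at h1 h2
  refine ⟨h1, ?_⟩
  rw [mem_Pl, degree_lt_iff_coeff_zero]
  intro i hi
  rw [X_pow_dvd_iff] at h2
  by_cases hin : i ≤ n
  · have h3 := h2 (n - i) (by omega)
    rw [coeff_reflect, revAt_le (by omega)] at h3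
    rwa [Nat.sub_sub_self hin] at h3
  · rw [coeff_sub, coeff_eq_zero_of_natDegree_lt (by rw [Mn_natDegree hf]; omega),
      coeff_eq_zero_of_natDegree_lt (by rw [Mn_natDegree hf']; omega), sub_self]

theorem equi {h : (ZMod 2)[X]} (hh : h ≠ 0) (K : ℕ) (hK : 1 ≤ K) (n : ℕ) (hn : n ≠ 0)
    (hn' : h.natDegree + K ≤ n + 1) (φ : (ZMod 2)[X] → ℝ)
    (hφ : ∀ f ∈ Mn n, ∀ f' ∈ Mn n, h ∣ f - f' → f - f' ∈ Pl (n + 1 - K) → φ f = φ f')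
    (hcop : ∀ f ∈ Mn n, ¬ IsCoprime f h → φ f = 0) :
    |n * ∑ r ∈ Irr n, φ r - 2 ^ n / (((Mn n).filter fun f => IsCoprime f h).card : ℝ) * ∑ f ∈ Mn n, φ f| ≤
      ((h.natDegree + K + 2) * Real.sqrt 2 ^ n) *
        Real.sqrt ((∑ f ∈ Mn n, φ f ^ 2) / 2 ^ (n + 1 - (h.natDegree + K))) := by
  haveI := finite_Rg hh K
  letI := Fintype.ofFinite (Rg h K)
  set ψ : Rg h K → ℝ := fun r => if hr : ∃ f ∈ Mn n, Phi h K f = r then φ hr.choose else 0 with hψ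
  have hψΦ : ∀ f ∈ Mn n, ψ (Phi h K f) = φ f := by
    intro f hf
    have hr : ∃ f' ∈ Mn n, Phi h K f' = Phi h K f := ⟨f, hf, rfl⟩
    rw [hψ]
    simp only [dif_pos hr]
    have h1 := Phi_eq_imp hr.choose_spec.1 hf hr.choose_spec.2
    exact hφ _ hr.choose_spec.1 _ hf h1.1 h1.2
  have hψ0 : ∀ r, ¬ IsUnit r → ψ r = 0 := by
    intro r hr
    by_cases h1 : ∃ f ∈ Mn n, Phi h K f = r
    · obtain ⟨f, hf, rfl⟩ := h1
      rw [hψΦ f hf]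
      rw [isUnit_Phi_iff h K f (Mn_ne_zero hf)] at hr
      exact hcop f hf hr
    · rw [hψ]; simp only [dif_neg h1]
  have s1 : ∑ f ∈ Mn n, φ f = 2 ^ (n + 1 - (h.natDegree + K)) * ∑ r, ψ r := by
    rw [← sum_Mn K n hh hK hn' ψ hψ0]
    exact Finset.sum_congr rfl fun f hf => (hψΦ f hf).symm
  have s2 : ∑ f ∈ Mn n, φ f ^ 2 = 2 ^ (n + 1 - (h.natDegree + K)) * ∑ r, ψ r ^ 2 := by
    rw [← sum_Mn K n hh hK hn' (fun r => ψ r ^ 2) (fun r hr => by rw [hψ0 r hr]; simp)]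
    exact Finset.sum_congr rfl fun f hf => by rw [hψΦ f hf]
  have s3 : (((Mn n).filter fun f => IsCoprime f h).card : ℝ) =
      2 ^ (n + 1 - (h.natDegree + K)) * Nat.card (Rg h K)ˣ := by
    have e1 : ∑ r : Rg h K, (if IsUnit r then (1 : ℝ) else 0) = Nat.card (Rg h K)ˣ := by
      rw [Finset.sum_boole]
      congr 1
      rw [← Fintype.card_subtype]
      rw [← Nat.card_eq_fintype_card]
      symm
      refine Nat.card_congr (Equiv.ofBijective (fun u => ⟨u, u.isUnit⟩) ⟨fun u v huv => ?_, ?_⟩)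
      · exact Units.ext (congrArg Subtype.val huv)
      · rintro ⟨r, u, rfl⟩
        exact ⟨u, rfl⟩
    rw [← e1, ← sum_Mn K n hh hK hn' (fun r => if IsUnit r then (1 : ℝ) else 0) (fun r hr => by rw [if_neg hr]),
      Finset.sum_boole]
    congr 2
    ext f
    simp only [Finset.mem_filter]
    constructor
    · rintro ⟨a, b⟩
      exact ⟨a, (isUnit_Phi_iff h K f (Mn_ne_zero a)).2 b⟩
    · rintro ⟨a, b⟩
      exact ⟨a, (isUnit_Phi_iff h K f (Mn_ne_zero a)).1 b⟩
  have main := equi_abs (Irr n) (Phi h K) (n : ℂ) ((2 : ℝ) ^ n) ((h.natDegree + K + 2) * Real.sqrt 2 ^ n)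
    (fun χ v h1 h0 => char_primes hh K hK χ n hn v (fun h => by rw [h1 h]; push_cast; rfl) h0) ψ hψ0
  have hκ : (2 : ℝ) ^ (n + 1 - (h.natDegree + K)) ≠ 0 := by positivity
  rw [s2, mul_div_cancel_left₀ _ hκ, s1, s3]
  have e2 : ∑ r ∈ Irr n, φ r = ∑ r ∈ Irr n, ψ (Phi h K r) := by
    refine Finset.sum_congr rfl fun f hf => (hψΦ f ?_).symm
    rw [Irr, Finset.mem_filter] at hf
    exact hf.1
  rw [e2]
  have e3 : (2 : ℝ) ^ n / (2 ^ (n + 1 - (h.natDegree + K)) * Nat.card (Rg h K)ˣ) *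
      (2 ^ (n + 1 - (h.natDegree + K)) * ∑ r, ψ r) = 2 ^ n / Nat.card (Rg h K)ˣ * ∑ r, ψ r := by
    have : (Nat.card (Rg h K)ˣ : ℝ) ≠ 0 := by exact_mod_cast Nat.card_pos.ne'
    field_simp
  rw [e3, ← Real.norm_eq_abs, ← Complex.norm_real]
  push_cast at main ⊢
  exact main

end Sark

namespace Sark

def PP (h : (ZMod 2)[X]) : Finset (ZMod 2)[X] := (Pl (h.natDegree + 1)).filter fun p => Irreducible p ∧ p ∣ h

lemma mem_PP {h p : (ZMod 2)[X]} (hh : h ≠ 0) : p ∈ PP h ↔ Irreducible p ∧ p ∣ h := by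
  rw [PP, Finset.mem_filter, and_iff_right_iff_imp]
  rintro ⟨_, h2⟩
  rw [mem_Pl]
  refine (degree_le_of_dvd h2 hh).trans_lt ?_
  rw [degree_eq_natDegree hh]
  exact_mod_cast Nat.lt_succ_self _

def sT (T : Finset (ZMod 2)[X]) : (ZMod 2)[X] := ∏ p ∈ T, p

def th (h : (ZMod 2)[X]) : ℝ := ∏ p ∈ PP h, (1 - (1 / 2 : ℝ) ^ p.natDegree)

lemma irr_coprime {p q : (ZMod 2)[X]} (hp : Irreducible p) (hq : Irreducible q) (hpq : p ≠ q) : IsCoprime p q := by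
  rw [hp.coprime_iff_not_dvd]
  intro hd
  apply hpq
  exact eq_of_monic_of_associated (monic_of_ne hp.ne_zero) (monic_of_ne hq.ne_zero)
    ((hp.dvd_irreducible_iff_associated hq).1 hd)

lemma sT_dvd_iff {T : Finset (ZMod 2)[X]} (hT : ∀ p ∈ T, Irreducible p) (f : (ZMod 2)[X]) :
    sT T ∣ f ↔ ∀ p ∈ T, p ∣ f := by
  constructor
  · intro h p hp
    have h1 : p ∣ sT T := Finset.dvd_prod_of_mem (fun p => p) hp
    exact h1.trans h
  · intro h
    have h2 : (T : Set (ZMod 2)[X]).Pairwise (Function.onFun IsCoprime fun p => p) :=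
      fun p hp q hq hpq => irr_coprime (hT p hp) (hT q hq) hpq
    exact Finset.prod_dvd_of_coprime (s := fun p => p) h2 h

lemma sT_ne_zero {T : Finset (ZMod 2)[X]} (hT : ∀ p ∈ T, Irreducible p) : sT T ≠ 0 :=
  Finset.prod_ne_zero_iff.2 fun p hp => (hT p hp).ne_zero

lemma sT_natDegree {T : Finset (ZMod 2)[X]} (hT : ∀ p ∈ T, Irreducible p) :
    (sT T).natDegree = ∑ p ∈ T, p.natDegree :=
  natDegree_prod _ _ fun p hp => (hT p hp).ne_zero

lemma PP_irr {g : (ZMod 2)[X]} {T : Finset (ZMod 2)[X]} (hT : T ⊆ PP g) : ∀ p ∈ T, Irreducible p := fun p hp =>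
  (Finset.mem_filter.1 (hT hp)).2.1

lemma PP_dvd {g : (ZMod 2)[X]} {T : Finset (ZMod 2)[X]} (hT : T ⊆ PP g) : ∀ p ∈ T, p ∣ g := fun p hp =>
  (Finset.mem_filter.1 (hT hp)).2.2

lemma sT_dvd {g : (ZMod 2)[X]} {T : Finset (ZMod 2)[X]} (hT : T ⊆ PP g) : sT T ∣ g :=
  (sT_dvd_iff (PP_irr hT) g).2 (PP_dvd hT)

lemma coprime_iff {g : (ZMod 2)[X]} (hg : g ≠ 0) (f : (ZMod 2)[X]) : IsCoprime f g ↔ ∀ p ∈ PP g, ¬ p ∣ f := by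
  constructor
  · intro h p hp hd
    rw [mem_PP hg] at hp
    exact hp.1.not_isUnit (h.isUnit_of_dvd' hd hp.2)
  · intro h
    apply isCoprime_of_irreducible_dvd (by tauto)
    intro p hp h1 h2
    exact h p ((mem_PP hg).2 ⟨hp, h2⟩) h1

lemma incl_excl {g : (ZMod 2)[X]} (hg : g ≠ 0) (f : (ZMod 2)[X]) : (if IsCoprime f g then (1 : ℝ) else 0) =
    ∑ T ∈ (PP g).powerset, (-1) ^ T.card * (if sT T ∣ f then (1 : ℝ) else 0) := by
  have h1 : (if IsCoprime f g then (1 : ℝ) else 0) = ∏ p ∈ PP g, (-(if p ∣ f then (1 : ℝ) else 0) + 1) := by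
    split_ifs with h
    · rw [coprime_iff hg] at h
      symm
      apply Finset.prod_eq_one
      intro p hp
      rw [if_neg (h p hp)]; simp
    · rw [coprime_iff hg] at h
      push Not at h
      obtain ⟨p, hp, hd⟩ := h
      symm
      apply Finset.prod_eq_zero hp
      rw [if_pos hd]; simp
  rw [h1, Finset.prod_add]
  refine Finset.sum_congr rfl fun T hT => ?_
  rw [Finset.mem_powerset] at hT
  rw [Finset.prod_const_one, mul_one, Finset.prod_neg]
  congr 1
  by_cases h2 : sT T ∣ f
  · rw [if_pos h2]
    rw [sT_dvd_iff (PP_irr hT)] at h2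
    apply Finset.prod_eq_one
    intro p hp
    rw [if_pos (h2 p hp)]
  · rw [if_neg h2]
    rw [sT_dvd_iff (PP_irr hT)] at h2
    push Not at h2
    obtain ⟨p, hp, hd⟩ := h2
    apply Finset.prod_eq_zero hp
    rw [if_neg hd]

lemma sum_mult {s : (ZMod 2)[X]} (hs : s ≠ 0) {n : ℕ} (hn : s.natDegree ≤ n) (F : (ZMod 2)[X] → ℝ) :
    ∑ f ∈ Mn n, (if s ∣ f then F f else 0) = ∑ h ∈ Mn (n - s.natDegree), F (s * h) := by
  rw [← Finset.sum_filter]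
  symm
  apply Finset.sum_bij (fun h _ => s * h)
  · intro h hh
    rw [mem_Mn'] at hh
    rw [Finset.mem_filter, mem_Mn']
    refine ⟨⟨mul_ne_zero hs hh.1, ?_⟩, dvd_mul_right _ _⟩
    rw [natDegree_mul hs hh.1, hh.2]; omega
  · intro a _ b _ hab
    exact mul_left_cancel₀ hs hab
  · intro f hf
    rw [Finset.mem_filter, mem_Mn'] at hf
    obtain ⟨⟨h1, h2⟩, q, rfl⟩ := hf
    refine ⟨q, ?_, rfl⟩
    rw [mem_Mn']
    have hq : q ≠ 0 := right_ne_zero_of_mul h1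
    rw [natDegree_mul hs hq] at h2
    exact ⟨hq, by omega⟩
  · intro h _; rfl

lemma count_mult {s : (ZMod 2)[X]} (hs : s ≠ 0) {n : ℕ} (hn : s.natDegree ≤ n) :
    ∑ f ∈ Mn n, (if s ∣ f then (1 : ℝ) else 0) = 2 ^ (n - s.natDegree) := by
  rw [sum_mult hs hn (fun _ => 1), Finset.sum_const, card_Mn]; simp

lemma count_coprime {h : (ZMod 2)[X]} (hh : h ≠ 0) {n : ℕ} (hn : h.natDegree ≤ n) :
    (((Mn n).filter fun f => IsCoprime f h).card : ℝ) = 2 ^ n * th h := by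
  rw [← Finset.sum_boole]
  simp only [incl_excl hh]
  rw [Finset.sum_comm]
  have : th h = ∏ p ∈ PP h, (-((1 / 2 : ℝ) ^ p.natDegree) + 1) := by
    rw [th]
    exact Finset.prod_congr rfl fun p _ => by ring
  rw [this, Finset.prod_add, Finset.mul_sum]
  refine Finset.sum_congr rfl fun T hT => ?_
  rw [Finset.mem_powerset] at hT
  have h1 : (sT T).natDegree ≤ n := (natDegree_le_of_dvd (sT_dvd hT) hh).trans hn
  rw [← Finset.mul_sum, count_mult (sT_ne_zero (PP_irr hT)) h1, Finset.prod_const_one, mul_one, Finset.prod_neg,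
    Finset.prod_pow_eq_pow_sum, ← sT_natDegree (PP_irr hT)]
  have h2 : (2 : ℝ) ^ n = 2 ^ (n - (sT T).natDegree) * 2 ^ (sT T).natDegree := by
    rw [← pow_add]; congr 1; omega
  rw [h2, one_div, inv_pow]
  field_simp

lemma irr_deg_pos {p : (ZMod 2)[X]} (hp : Irreducible p) : 1 ≤ p.natDegree := hp.natDegree_pos

lemma fac_bound {p : (ZMod 2)[X]} (hp : Irreducible p) :
    1 / 2 ≤ 1 - (1 / 2 : ℝ) ^ p.natDegree ∧ 1 - (1 / 2 : ℝ) ^ p.natDegree ≤ 1 := by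
  have h1 : (1 / 2 : ℝ) ^ p.natDegree ≤ (1 / 2) ^ 1 :=
    pow_le_pow_of_le_one (by norm_num) (by norm_num) (irr_deg_pos hp)
  have h2 : (0 : ℝ) < (1 / 2 : ℝ) ^ p.natDegree := by positivity
  constructor <;> linarith

lemma th_pos (h : (ZMod 2)[X]) : 0 < th h :=
  Finset.prod_pos fun p hp => by have := (fac_bound (PP_irr (Finset.Subset.refl _) p hp)).1; linarith

lemma th_le_one (h : (ZMod 2)[X]) : th h ≤ 1 :=
  Finset.prod_le_one (fun p hp => by have := (fac_bound (PP_irr (Finset.Subset.refl _) p hp)).1; linarith)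
    fun p hp => (fac_bound (PP_irr (Finset.Subset.refl _) p hp)).2

lemma PP_mul {a b : (ZMod 2)[X]} (ha : a ≠ 0) (hb : b ≠ 0) : PP (a * b) = PP a ∪ (PP b).filter (fun p => ¬ p ∣ a) := by
  ext p
  rw [mem_PP (mul_ne_zero ha hb), Finset.mem_union, Finset.mem_filter, mem_PP ha, mem_PP hb]
  constructor
  · rintro ⟨h1, h2⟩
    rcases h1.prime.dvd_or_dvd h2 with h3 | h3
    · exact Or.inl ⟨h1, h3⟩
    · by_cases h4 : p ∣ a
      · exact Or.inl ⟨h1, h4⟩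
      · exact Or.inr ⟨⟨h1, h3⟩, h4⟩
  · rintro (⟨h1, h2⟩ | ⟨⟨h1, h2⟩, _⟩)
    · exact ⟨h1, h2.mul_right b⟩
    · exact ⟨h1, h2.mul_left a⟩

lemma th_mul {a b : (ZMod 2)[X]} (ha : a ≠ 0) (hb : b ≠ 0) :
    th (a * b) = th a * ∏ p ∈ (PP b).filter (fun p => ¬ p ∣ a), (1 - (1 / 2 : ℝ) ^ p.natDegree) := by
  rw [th, PP_mul ha hb, Finset.prod_union]
  · rfl
  · rw [Finset.disjoint_left]
    intro p hp hp'
    exact (Finset.mem_filter.1 hp').2 ((mem_PP ha).1 hp).2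

lemma kap_eq {d g : (ZMod 2)[X]} (hd : d ≠ 0) (hg : g ≠ 0) :
    th d / th (d * g) = (∏ p ∈ (PP g).filter (fun p => ¬ p ∣ d), (1 - (1 / 2 : ℝ) ^ p.natDegree))⁻¹ := by
  rw [th_mul hd hg]
  have := th_pos d
  field_simp

lemma kap_bound {d g : (ZMod 2)[X]} (hd : d ≠ 0) (hg : g ≠ 0) :
    0 ≤ th d / th (d * g) ∧ th d / th (d * g) ≤ 2 ^ (PP g).card := by
  refine ⟨div_nonneg (th_pos _).le (th_pos _).le, ?_⟩
  rw [kap_eq hd hg, ← Finset.prod_inv_distrib]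
  calc _ ≤ ∏ p ∈ (PP g).filter (fun p => ¬ p ∣ d), (2 : ℝ) := by
        apply Finset.prod_le_prod
        · intro p hp
          have := (fac_bound (PP_irr (Finset.filter_subset _ _) p hp)).1
          exact inv_nonneg.2 (by linarith)
        · intro p hp
          have := (fac_bound (PP_irr (Finset.filter_subset _ _) p hp)).1
          rw [inv_le_comm₀ (by linarith) (by norm_num)]
          linarith
    _ ≤ _ := by
        rw [Finset.prod_const]
        exact pow_le_pow_right₀ (by norm_num) (Finset.card_filter_le _ _)

end Sark

namespace Sark

def e1 (a : ZMod 2) : ℝ := if a = 0 then 1 else -1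

lemma zmod2_cases (a : ZMod 2) : a = 0 ∨ a = 1 := by
  revert a; decide

lemma e1_zero : e1 0 = 1 := by simp [e1]
lemma e1_one : e1 1 = -1 := by simp [e1]

lemma e1_add (a b : ZMod 2) : e1 (a + b) = e1 a * e1 b := by
  have h2 : (1 + 1 : ZMod 2) = 0 := by decide
  rcases zmod2_cases a with rfl | rfl <;> rcases zmod2_cases b with rfl | rfl <;>
    simp [e1_zero, e1_one, h2]

lemma e1_abs (a : ZMod 2) : |e1 a| = 1 := by
  rcases zmod2_cases a with rfl | rfl <;> simp [e1_zero, e1_one]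

lemma e1_sq (a : ZMod 2) : e1 a ^ 2 = 1 := by
  rcases zmod2_cases a with rfl | rfl <;> simp [e1_zero, e1_one]

lemma e1_sum {ι : Type} (T : Finset ι) (f : ι → ZMod 2) : e1 (∑ i ∈ T, f i) = ∏ i ∈ T, e1 (f i) := by
  induction T using Finset.induction_on with
  | empty => simp [e1_zero]
  | insert a s ha ih => rw [Finset.sum_insert ha, Finset.prod_insert ha, e1_add, ih]

lemma mem_Pl' {f : (ZMod 2)[X]} {n : ℕ} : f ∈ Pl n ↔ f = 0 ∨ f.natDegree < n := by
  rw [mem_Pl]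
  by_cases hf : f = 0
  · simp [hf]
  · rw [degree_eq_natDegree hf]
    simp [hf]

lemma Pl_add {f g : (ZMod 2)[X]} {n : ℕ} (hf : f ∈ Pl n) (hg : g ∈ Pl n) : f + g ∈ Pl n := by
  rw [mem_Pl] at *
  exact (degree_add_le _ _).trans_lt (max_lt hf hg)

lemma Pl_sub {f g : (ZMod 2)[X]} {n : ℕ} (hf : f ∈ Pl n) (hg : g ∈ Pl n) : f - g ∈ Pl n := by
  rw [mem_Pl] at *
  exact (degree_sub_le _ _).trans_lt (max_lt hf hg)

lemma Pl_mono {f : (ZMod 2)[X]} {n m : ℕ} (hnm : n ≤ m) (hf : f ∈ Pl n) : f ∈ Pl m := by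
  rw [mem_Pl'] at *
  exact hf.imp id fun h => by omega

lemma Pl_mul {a b : (ZMod 2)[X]} {i j : ℕ} (ha : a ∈ Pl i) (hb : b.natDegree ≤ j) : a * b ∈ Pl (i + j) := by
  rw [mem_Pl'] at *
  rcases ha with rfl | ha
  · simp
  · right
    have := natDegree_mul_le (p := a) (q := b)
    omega

lemma Pl_of_mul {a g : (ZMod 2)[X]} {L : ℕ} (hg : g ≠ 0) (h : a * g ∈ Pl (L + g.natDegree)) : a ∈ Pl L := by
  rw [mem_Pl'] at *
  by_cases ha : a = 0
  · exact Or.inl ha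
  · right
    rcases h with h | h
    · exact absurd h (mul_ne_zero ha hg)
    · rw [natDegree_mul ha hg] at h; omega

lemma Mn_Pl {f : (ZMod 2)[X]} {n : ℕ} (h : f ∈ Mn n) : f ∈ Pl (n + 1) := by
  rw [mem_Pl']; right; rw [Mn_natDegree h]; omega

lemma Mn_add_Pl {f g : (ZMod 2)[X]} {n : ℕ} (hf : f ∈ Mn n) (hg : g ∈ Pl n) : f + g ∈ Mn n := by
  rw [mem_Mn] at *
  rw [mem_Pl] at hg
  rw [degree_add_eq_left_of_degree_lt (by rw [hf]; exact hg), hf]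

lemma Mn_sub_Mn {f g : (ZMod 2)[X]} {n : ℕ} (hf : f ∈ Mn n) (hg : g ∈ Mn n) : f - g ∈ Pl n := by
  have h1 := monic_of_ne (Mn_ne_zero hf)
  have h2 := monic_of_ne (Mn_ne_zero hg)
  rw [mem_Pl]
  rw [mem_Mn] at *
  rw [← hf]
  exact degree_sub_lt (hf.trans hg.symm) h1.ne_zero (h1.leadingCoeff.trans h2.leadingCoeff.symm)

lemma Mn_mul {f g : (ZMod 2)[X]} {n m : ℕ} (hf : f ∈ Mn n) (hg : g ∈ Mn m) : f * g ∈ Mn (n + m) := by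
  rw [mem_Mn'] at *
  exact ⟨mul_ne_zero hf.1 hg.1, by rw [natDegree_mul hf.1 hg.1, hf.2, hg.2]⟩

lemma X_pow_Mn (n : ℕ) : (X ^ n : (ZMod 2)[X]) ∈ Mn n := by
  rw [mem_Mn']; exact ⟨pow_ne_zero _ X_ne_zero, natDegree_X_pow n⟩

lemma sum_e1 (l : (ZMod 2)[X] →+ ZMod 2) (J : ℕ) :
    ∑ j ∈ Pl J, e1 (l j) = if ∀ j ∈ Pl J, l j = 0 then (2 : ℝ) ^ J else 0 := by
  split_ifs with h
  · rw [Finset.sum_congr rfl (g := fun _ => (1 : ℝ)) (fun j hj => by rw [h j hj, e1_zero])]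
    rw [Finset.sum_const, card_Pl]; simp
  · push Not at h
    obtain ⟨j0, hj0, hl⟩ := h
    have h1 : l j0 = 1 := (zmod2_cases _).resolve_left hl
    have h2 : ∑ j ∈ Pl J, e1 (l j) = ∑ j ∈ Pl J, e1 (l (j + j0)) := by
      symm
      apply Finset.sum_bij (fun j _ => j + j0)
      · intro j hj; exact Pl_add hj hj0
      · intro a _ b _ hab; exact add_right_cancel hab
      · intro b hb
        exact ⟨b - j0, Pl_sub hb hj0, by ring⟩
      · intro j _; rfl
    have h3 : ∑ j ∈ Pl J, e1 (l (j + j0)) = - ∑ j ∈ Pl J, e1 (l j) := by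
      rw [← Finset.sum_neg_distrib]
      refine Finset.sum_congr rfl fun j _ => ?_
      rw [map_add, e1_add, h1, e1_one]; ring
    linarith

lemma coset_sum {s d h0 : (ZMod 2)[X]} {m : ℕ} (hs : s ≠ 0) (hm : s.natDegree ≤ m) (hh0 : h0 ∈ Mn m)
    (hd : s ∣ 1 + d * h0) (F : (ZMod 2)[X] → ℝ) :
    ∑ h ∈ Mn m, (if s ∣ 1 + d * h then F h else 0) = ∑ j ∈ Pl (m - s.natDegree), F (h0 + s * j) := by
  rw [← Finset.sum_filter]
  symm
  apply Finset.sum_bij (fun j _ => h0 + s * j)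
  · intro j hj
    rw [Finset.mem_filter]
    constructor
    · apply Mn_add_Pl hh0
      have := Pl_mul hj (le_refl s.natDegree)
      rwa [Nat.sub_add_cancel hm, mul_comm] at this
    · have : 1 + d * (h0 + s * j) = (1 + d * h0) + s * (d * j) := by ring
      rw [this]
      exact dvd_add hd (dvd_mul_right _ _)
  · intro a _ b _ hab
    exact mul_left_cancel₀ hs (add_left_cancel hab)
  · intro h hh
    rw [Finset.mem_filter] at hh
    have hc : IsCoprime s d := by
      obtain ⟨q, hq⟩ := hd
      refine ⟨q, -h0, ?_⟩
      linear_combination -hq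
    have h1 : s ∣ h - h0 := by
      apply hc.dvd_of_dvd_mul_left
      have := dvd_sub hh.2 hd
      have e : 1 + d * h - (1 + d * h0) = d * (h - h0) := by ring
      rwa [e] at this
    obtain ⟨q, hq⟩ := h1
    refine ⟨q, ?_, by rw [← hq]; ring⟩
    apply Pl_of_mul hs
    rw [Nat.sub_add_cancel hm, mul_comm, ← hq]
    exact Mn_sub_Mn hh.1 hh0
  · intro j _; rfl

variable (l : (ZMod 2)[X] →ₗ[ZMod 2] ZMod 2)

def Bs (d s : (ZMod 2)[X]) (m : ℕ) : ℝ := ∑ h ∈ Mn m, (if s ∣ 1 + d * h then e1 (l (d * h)) else 0)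

lemma Bs_eq {s d h0 : (ZMod 2)[X]} {m : ℕ} (hs : s ≠ 0) (hm : s.natDegree ≤ m) (hh0 : h0 ∈ Mn m)
    (hd : s ∣ 1 + d * h0) : Bs l d s m = e1 (l (d * h0)) *
      (if ∀ j ∈ Pl (m - s.natDegree), l (d * s * j) = 0 then (2 : ℝ) ^ (m - s.natDegree) else 0) := by
  rw [Bs, coset_sum hs hm hh0 hd (fun h => e1 (l (d * h)))]
  have := sum_e1 ((l.comp (LinearMap.mulLeft (ZMod 2) (d * s))).toAddMonoidHom) (m - s.natDegree)
  simp only [LinearMap.toAddMonoidHom_coe, LinearMap.comp_apply, LinearMap.mulLeft_apply] at this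
  trans e1 (l (d * h0)) * ∑ j ∈ Pl (m - s.natDegree), e1 (l (d * s * j))
  swap
  · rw [this]
    congr 1
  rw [Finset.mul_sum]
  refine Finset.sum_congr rfl fun j _ => ?_
  rw [← e1_add, ← map_add]
  congr 2; ring

lemma Bs_nonzero {s d : (ZMod 2)[X]} {m : ℕ} (hs : s ≠ 0) (hm : s.natDegree ≤ m) (h : Bs l d s m ≠ 0) :
    IsCoprime s d ∧ (∀ j ∈ Pl (m - s.natDegree), l (d * s * j) = 0) ∧ |Bs l d s m| ≤ 2 ^ (m - s.natDegree) := by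
  by_cases hex : ∃ h0 ∈ Mn m, s ∣ 1 + d * h0
  · obtain ⟨h0, hh0, hd⟩ := hex
    rw [Bs_eq l hs hm hh0 hd] at h ⊢
    refine ⟨?_, ?_, ?_⟩
    · obtain ⟨q, hq⟩ := hd
      refine ⟨q, -h0, ?_⟩
      linear_combination -hq
    · by_contra hc
      rw [if_neg hc] at h
      simp at h
    · rw [abs_mul, e1_abs, one_mul]
      split_ifs
      · rw [abs_of_nonneg (by positivity)]
      · simp
  · exfalso
    apply h
    apply Finset.sum_eq_zero
    intro x hx
    rw [if_neg]
    intro hd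
    exact hex ⟨x, hx, hd⟩

lemma Bs_abs {s d : (ZMod 2)[X]} {m : ℕ} (hs : s ≠ 0) (hm : s.natDegree ≤ m) :
    |Bs l d s m| ≤ 2 ^ (m - s.natDegree) := by
  by_cases h : Bs l d s m = 0
  · rw [h]; simp
  · exact (Bs_nonzero l hs hm h).2.2

structure IsMin (L : ℕ) (g : (ZMod 2)[X]) : Prop where
  ne : g ≠ 0
  deg : g.natDegree ≤ L
  van : ∀ j ∈ Pl L, l (g * j) = 0
  min : ∀ w : (ZMod 2)[X], w ≠ 0 → w.natDegree < g.natDegree → ¬ ∀ j ∈ Pl L, l (w * j) = 0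

lemma exists_min (L : ℕ) : ∃ g, IsMin l L g := by
  have hex : ∃ n, ∃ g : (ZMod 2)[X], g ≠ 0 ∧ g.natDegree = n ∧ g.natDegree ≤ L ∧ ∀ j ∈ Pl L, l (g * j) = 0 := by
    have hp : ∃ a ∈ Pl (L + 1), ∃ b ∈ Pl (L + 1), a ≠ b ∧
        (fun i : Fin L => l (a * X ^ (i : ℕ))) = (fun i : Fin L => l (b * X ^ (i : ℕ))) := by
      apply Finset.exists_ne_map_eq_of_card_lt_of_maps_to (t := (Finset.univ : Finset (Fin L → ZMod 2)))
      · rw [card_Pl, Finset.card_univ]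
        simp only [Fintype.card_pi, ZMod.card, Finset.prod_const, Finset.card_univ, Fintype.card_fin]
        exact Nat.pow_lt_pow_right (by norm_num) (by omega)
      · intro _ _; simp
    obtain ⟨a, ha, b, hb, hab, he⟩ := hp
    refine ⟨_, a - b, sub_ne_zero.2 hab, rfl, ?_, ?_⟩
    · have := Pl_sub ha hb
      rw [mem_Pl'] at this
      rcases this with h | h
      · exact absurd h (sub_ne_zero.2 hab)
      · omega
    · intro j hj
      rw [mem_Pl'] at hj
      rcases hj with rfl | hj
      · simp
      · rw [as_sum_range' j L hj, Finset.mul_sum, map_sum]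
        apply Finset.sum_eq_zero
        intro i hi
        have h1 : (a - b) * monomial i (j.coeff i) = j.coeff i • (a * X ^ i - b * X ^ i) := by
          rw [← C_mul_X_pow_eq_monomial, smul_eq_C_mul]; ring
        rw [h1, map_smul, map_sub]
        have := congrFun he ⟨i, Finset.mem_range.1 hi⟩
        simp only at this
        rw [this]; simp
  obtain ⟨g, h1, h2, h3, h4⟩ := Nat.find_spec hex
  refine ⟨g, h1, h3, h4, ?_⟩
  intro w hw hlt hv
  rw [h2] at hlt
  exact Nat.find_min hex hlt ⟨w, hw, rfl, by omega, hv⟩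

variable {l}

lemma IsMin.dvd {L : ℕ} {g : (ZMod 2)[X]} (hg : IsMin l L g) {u : (ZMod 2)[X]} {J : ℕ} (hu : u.natDegree ≤ L)
    (hJ : g.natDegree ≤ J) (hv : ∀ j ∈ Pl J, l (u * j) = 0) : g ∣ u := by
  set w := EuclideanDomain.gcd g u with hw
  have hwg : w ∣ g := EuclideanDomain.gcd_dvd_left g u
  have hwu : w ∣ u := EuclideanDomain.gcd_dvd_right g u
  have hw0 : w ≠ 0 := fun h => hg.ne (by rw [h] at hwg; exact zero_dvd_iff.1 hwg)
  by_cases hlt : w.natDegree < g.natDegree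
  · exfalso
    apply hg.min w hw0 hlt
    intro k hk
    obtain ⟨a, b, hab⟩ : ∃ a b, w = g * a + u * b := ⟨_, _, EuclideanDomain.gcd_eq_gcd_ab g u⟩
    set q := (b * k) /ₘ g with hq
    set b' := (b * k) %ₘ g with hb'
    have hdiv : b' + g * q = b * k := modByMonic_add_div (b * k) g
    have hmon := monic_of_ne hg.ne
    have hb'P : b' ∈ Pl g.natDegree := by
      rw [mem_Pl]
      have := degree_modByMonic_lt (b * k) hmon
      rwa [degree_eq_natDegree hg.ne] at this
    have e : w * k = g * (a * k + q * u) + u * b' := by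
      rw [hab]; linear_combination -u * hdiv
    have ha' : a * k + q * u ∈ Pl L := by
      apply Pl_of_mul hg.ne
      have e2 : (a * k + q * u) * g = k * w - b' * u := by rw [mul_comm k w, e]; ring
      rw [e2]
      apply Pl_sub
      · exact Pl_mul hk hlt.le
      · rw [add_comm]; exact Pl_mul hb'P hu
    rw [e, map_add, hg.van _ ha', hv _ (Pl_mono hJ hb'P), add_zero]
  · have h1 : w = g := by
      apply eq_of_monic_of_associated (monic_of_ne hw0) (monic_of_ne hg.ne)
      apply associated_of_dvd_of_natDegree_le hwg hg.ne
      omega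
    rw [← h1]; exact hwu

end Sark

namespace Sark

variable (l : (ZMod 2)[X] →ₗ[ZMod 2] ZMod 2)

def Sn (g : (ZMod 2)[X]) (D n : ℕ) : ℝ :=
  ∑ d ∈ Mn D, th d / th (d * g) * ∑ h ∈ Mn (n - D), (if IsCoprime (1 + d * h) g then e1 (l (d * h)) else 0)

def Rs (g : (ZMod 2)[X]) (D n : ℕ) (T : Finset (ZMod 2)[X]) : ℝ :=
  ∑ d ∈ Mn D, th d / th (d * g) * Bs l d (sT T) (n - D)

lemma Sn_eq {g : (ZMod 2)[X]} (hg : g ≠ 0) (D n : ℕ) :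
    Sn l g D n = ∑ T ∈ (PP g).powerset, (-1) ^ T.card * Rs l g D n T := by
  have h1 : ∀ d, ∑ h ∈ Mn (n - D), (if IsCoprime (1 + d * h) g then e1 (l (d * h)) else 0) =
      ∑ T ∈ (PP g).powerset, (-1) ^ T.card * Bs l d (sT T) (n - D) := by
    intro d
    simp only [Bs, Finset.mul_sum]
    rw [Finset.sum_comm]
    refine Finset.sum_congr rfl fun h _ => ?_
    have := incl_excl hg (1 + d * h)
    have h2 : (if IsCoprime (1 + d * h) g then e1 (l (d * h)) else 0) =
        (if IsCoprime (1 + d * h) g then (1 : ℝ) else 0) * e1 (l (d * h)) := by split_ifs <;> simp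
    rw [h2, this, Finset.sum_mul]
    refine Finset.sum_congr rfl fun T _ => ?_
    split_ifs <;> simp
  simp only [Sn, Rs, h1, Finset.mul_sum]
  rw [Finset.sum_comm]
  refine Finset.sum_congr rfl fun T _ => Finset.sum_congr rfl fun d _ => by ring

variable {l}

lemma Rs_large {g : (ZMod 2)[X]} {k n : ℕ} (hg : IsMin l (4 * k) g) (hD : k < g.natDegree) (hn : 7 * k ≤ n)
    {T : Finset (ZMod 2)[X]} (hT : T ⊆ PP g) : |Rs l g k n T| ≤ 2 ^ (PP g).card * 2 ^ (n - k) := by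
  have hs0 := sT_ne_zero (PP_irr hT)
  have hsd := natDegree_le_of_dvd (sT_dvd hT) hg.ne
  have hdeg := hg.deg
  have hm : (sT T).natDegree ≤ n - k := by omega
  have hk : ∀ d ∈ Mn k, 0 ≤ th d / th (d * g) ∧ th d / th (d * g) ≤ 2 ^ (PP g).card :=
    fun d hd => kap_bound (Mn_ne_zero hd) hg.ne
  have key : ∑ d ∈ Mn k, |Bs l d (sT T) (n - k)| ≤ 2 ^ (n - k) := by
    by_cases hsk : k ≤ (sT T).natDegree
    · calc _ ≤ ∑ d ∈ Mn k, (2 : ℝ) ^ (n - k - k) := by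
            refine Finset.sum_le_sum fun d _ => (Bs_abs l hs0 hm).trans ?_
            exact pow_le_pow_right₀ (by norm_num) (by omega)
        _ = _ := by
            rw [Finset.sum_const, card_Mn, nsmul_eq_mul]
            push_cast
            rw [← pow_add]; congr 1; omega
    · obtain ⟨t, ht⟩ := sT_dvd hT
      have ht0 : t ≠ 0 := fun h => hg.ne (by rw [ht, h, mul_zero])
      have hdt : g.natDegree = (sT T).natDegree + t.natDegree := by
        conv_lhs => rw [ht]
        exact natDegree_mul hs0 ht0
      have h1 : ∀ d ∈ Mn k, |Bs l d (sT T) (n - k)| ≤ if t ∣ d then (2 : ℝ) ^ (n - k - (sT T).natDegree) else 0 := by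
        intro d hd
        by_cases hB : Bs l d (sT T) (n - k) = 0
        · rw [hB, abs_zero]
          split_ifs <;> positivity
        · obtain ⟨h1, h2, h3⟩ := Bs_nonzero l hs0 hm hB
          rw [if_pos]
          · exact h3
          · have h4 : g ∣ d * sT T := by
              refine hg.dvd ?_ ?_ h2
              · rw [natDegree_mul (Mn_ne_zero hd) hs0, Mn_natDegree hd]; omega
              · omega
            rw [ht, mul_comm d] at h4
            exact (mul_dvd_mul_iff_left hs0).1 h4
      refine (Finset.sum_le_sum h1).trans ?_
      by_cases htk : t.natDegree ≤ k
      · rw [sum_mult ht0 htk (fun _ => (2 : ℝ) ^ (n - k - (sT T).natDegree)), Finset.sum_const, card_Mn, nsmul_eq_mul]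
        push_cast
        rw [← pow_add]
        exact pow_le_pow_right₀ (by norm_num) (by omega)
      · rw [Finset.sum_eq_zero]
        · positivity
        · intro d hd
          rw [if_neg]
          intro hd'
          have := natDegree_le_of_dvd hd' (Mn_ne_zero hd)
          rw [Mn_natDegree hd] at this
          exact htk this
  calc |Rs l g k n T| ≤ ∑ d ∈ Mn k, 2 ^ (PP g).card * |Bs l d (sT T) (n - k)| := by
        refine (Finset.abs_sum_le_sum_abs _ _).trans (Finset.sum_le_sum fun d hd => ?_)
        rw [abs_mul, abs_of_nonneg (hk d hd).1]
        exact mul_le_mul_of_nonneg_right (hk d hd).2 (abs_nonneg _)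
    _ ≤ _ := by
        rw [← Finset.mul_sum]
        exact mul_le_mul_of_nonneg_left key (by positivity)

lemma Sn_large {g : (ZMod 2)[X]} {k n : ℕ} (hg : IsMin l (4 * k) g) (hD : k < g.natDegree) (hn : 7 * k ≤ n) :
    |Sn l g k n| ≤ 4 ^ (PP g).card * 2 ^ (n - k) := by
  rw [Sn_eq l hg.ne]
  calc _ ≤ ∑ T ∈ (PP g).powerset, (2 : ℝ) ^ (PP g).card * 2 ^ (n - k) := by
        refine (Finset.abs_sum_le_sum_abs _ _).trans (Finset.sum_le_sum fun T hT => ?_)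
        rw [abs_mul, abs_pow, abs_neg, abs_one, one_pow, one_mul]
        exact Rs_large hg hD hn (Finset.mem_powerset.1 hT)
    _ = _ := by
        rw [Finset.sum_const, Finset.card_powerset, nsmul_eq_mul]
        push_cast
        rw [show (4 : ℝ) = 2 * 2 by norm_num, mul_pow]; ring

/-! small case -/

def cc (l : (ZMod 2)[X] →ₗ[ZMod 2] ZMod 2) (g : (ZMod 2)[X]) (n : ℕ) : ℝ :=
  if ∀ q ∈ Pl (n - g.natDegree), l (g * q) = 0 then e1 (l (g * X ^ (n - g.natDegree))) else 0

lemma crt_elt {g : (ZMod 2)[X]} (hg : g ≠ 0) {p : (ZMod 2)[X]} (hp : Irreducible p) (hpg : p ∣ g)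
    (hp2 : ¬ p * p ∣ g) : ∃ c ∈ Pl g.natDegree, p ∣ 1 + c ∧ ∀ t, p * t = g → t ∣ c := by
  obtain ⟨t, ht⟩ := hpg
  have hpt : ¬ p ∣ t := by
    intro h
    apply hp2
    rw [ht]
    exact mul_dvd_mul_left p h
  obtain ⟨a, b, hab⟩ := (hp.coprime_iff_not_dvd).2 hpt
  have hmon := monic_of_ne hg
  refine ⟨(b * t) %ₘ g, ?_, ?_, ?_⟩
  · rw [mem_Pl, ← degree_eq_natDegree hg]
    exact degree_modByMonic_lt _ hmon
  · have h1 := modByMonic_add_div (b * t) g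
    have h2 : (1 : (ZMod 2)[X]) + 1 = 0 := CharTwo.add_self_eq_zero 1
    refine ⟨-a - t * ((b * t) /ₘ g), ?_⟩
    linear_combination h1 + h2 + hab - ((b * t) /ₘ g) * ht
  · intro t' ht'
    have h3 : t' = t := mul_left_cancel₀ hp.ne_zero (ht'.trans ht)
    subst h3
    have h1 := modByMonic_add_div (b * t') g
    refine ⟨b - p * ((b * t') /ₘ g), ?_⟩
    linear_combination h1 - ((b * t') /ₘ g) * ht

end Sark

namespace Sark

variable {l : (ZMod 2)[X] →ₗ[ZMod 2] ZMod 2}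

lemma Bs_small {g : (ZMod 2)[X]} {k n : ℕ} (hg : IsMin l (4 * k) g) (hD : g.natDegree ≤ k) (hn : 7 * k ≤ n)
    {s t d : (ZMod 2)[X]} (hst : g = s * t) (hd : d ∈ Mn k) (hB : Bs l d s (n - k) ≠ 0) :
    IsCoprime s d ∧ t ∣ d := by
  have hs0 : s ≠ 0 := fun h => hg.ne (by rw [hst, h, zero_mul])
  have hsd := natDegree_le_of_dvd (Dvd.intro t hst.symm) hg.ne
  have hm : s.natDegree ≤ n - k := by omega
  obtain ⟨h1, h2, h3⟩ := Bs_nonzero l hs0 hm hB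
  refine ⟨h1, ?_⟩
  have h4 : g ∣ d * s := by
    refine hg.dvd ?_ ?_ h2
    · rw [natDegree_mul (Mn_ne_zero hd) hs0, Mn_natDegree hd]; omega
    · omega
  rw [hst, mul_comm d] at h4
  exact (mul_dvd_mul_iff_left hs0).1 h4

def QQ (g : (ZMod 2)[X]) : Finset (ZMod 2)[X] := (PP g).filter fun p => ¬ p * p ∣ g

lemma sT_erase {T : Finset (ZMod 2)[X]} {p : (ZMod 2)[X]} (hp : p ∈ T) : sT T = p * sT (T.erase p) :=
  (Finset.mul_prod_erase T (fun p => p) hp).symm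

lemma Rs_small_zero {g : (ZMod 2)[X]} {k n : ℕ} (hg : IsMin l (4 * k) g) (hD : g.natDegree ≤ k) (hn : 7 * k ≤ n)
    {T : Finset (ZMod 2)[X]} (hT : T ⊆ PP g) (hQ : ¬ T ⊆ QQ g) : Rs l g k n T = 0 := by
  apply Finset.sum_eq_zero
  intro d hd
  obtain ⟨t, ht⟩ := sT_dvd hT
  by_contra hB
  have hB' : Bs l d (sT T) (n - k) ≠ 0 := right_ne_zero_of_mul hB
  obtain ⟨h1, h2⟩ := Bs_small hg hD hn ht hd hB'
  apply hQ
  intro p hp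
  rw [QQ, Finset.mem_filter]
  refine ⟨hT hp, fun hpp => ?_⟩
  have hpi := PP_irr hT p hp
  rw [ht, sT_erase hp, mul_assoc] at hpp
  have h3 := (mul_dvd_mul_iff_left hpi.ne_zero).1 hpp
  rcases hpi.prime.dvd_or_dvd h3 with h4 | h4
  · have h5 : p ∣ sT (T.erase p) := h4
    rw [sT, hpi.prime.dvd_finset_prod_iff] at h5
    obtain ⟨q, hq, hpq⟩ := h5
    have h6 := irr_coprime hpi (PP_irr hT q (Finset.mem_of_mem_erase hq)) (Finset.ne_of_mem_erase hq).symm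
    exact hpi.not_isUnit (h6.isUnit_of_dvd' dvd_rfl hpq)
  · have h5 : p ∣ sT T := by rw [sT_erase hp]; exact dvd_mul_right _ _
    exact hpi.not_isUnit (h1.isUnit_of_dvd' h5 (h4.trans h2))

lemma exists_sol {s d : (ZMod 2)[X]} {m : ℕ} (hs : s ≠ 0) (hc : IsCoprime s d) (hm : s.natDegree ≤ m) :
    ∃ h0 ∈ Mn m, s ∣ 1 + d * h0 := by
  obtain ⟨a, b, hab⟩ := hc
  refine ⟨X ^ m + (b - X ^ m) %ₘ s, ?_, ?_⟩
  · apply Mn_add_Pl (X_pow_Mn m)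
    apply Pl_mono hm
    rw [mem_Pl, ← degree_eq_natDegree hs]
    exact degree_modByMonic_lt _ (monic_of_ne hs)
  · have h1 := modByMonic_add_div (b - X ^ m) s
    have h2 : (1 : (ZMod 2)[X]) + 1 = 0 := CharTwo.add_self_eq_zero 1
    refine ⟨- a - d * ((b - X ^ m) /ₘ s), ?_⟩
    linear_combination d * h1 + h2 + hab

lemma coprime_of_QQ {g t : (ZMod 2)[X]} (hg : g ≠ 0) {T : Finset (ZMod 2)[X]} (hT : T ⊆ QQ g) (ht : g = sT T * t) :
    ∀ p ∈ T, ¬ p ∣ t := by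
  intro p hp hpt
  have := hT hp
  rw [QQ, Finset.mem_filter] at this
  apply this.2
  rw [ht]
  refine mul_dvd_mul ?_ hpt
  rw [sT_erase hp]; exact dvd_mul_right _ _

lemma PP_sT {T : Finset (ZMod 2)[X]} (hT : ∀ p ∈ T, Irreducible p) : PP (sT T) = T := by
  ext p
  rw [mem_PP (sT_ne_zero hT)]
  constructor
  · rintro ⟨h1, h2⟩
    rw [sT, h1.prime.dvd_finset_prod_iff] at h2
    obtain ⟨q, hq, hpq⟩ := h2
    by_contra hp
    have hne : p ≠ q := fun h => hp (h ▸ hq)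
    exact h1.not_isUnit ((irr_coprime h1 (hT q hq) hne).isUnit_of_dvd' dvd_rfl hpq)
  · intro hp
    refine ⟨hT p hp, ?_⟩
    rw [sT_erase hp]; exact dvd_mul_right _ _

lemma van_iff {g : (ZMod 2)[X]} {L a b : ℕ} (hg : IsMin l L g) {d' : (ZMod 2)[X]} (hd : d' ≠ 0) (hdL : d'.natDegree ≤ L)
    (hab : d'.natDegree + b = a) :
    (∀ j ∈ Pl b, l (g * (d' * j)) = 0) ↔ ∀ q ∈ Pl a, l (g * q) = 0 := by
  constructor
  · intro h q hq
    have h1 := modByMonic_add_div q d'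
    have hr : q %ₘ d' ∈ Pl d'.natDegree := by
      rw [mem_Pl, ← degree_eq_natDegree hd]
      exact degree_modByMonic_lt _ (monic_of_ne hd)
    have h2 : q /ₘ d' ∈ Pl b := by
      apply Pl_of_mul hd
      have e : q /ₘ d' * d' = q - q %ₘ d' := by linear_combination h1
      rw [e]
      apply Pl_sub
      · rwa [add_comm, hab]
      · exact Pl_mono (by omega) hr
    rw [← h1, mul_add, map_add, h _ h2, hg.van _ (Pl_mono hdL hr), add_zero]
  · intro h j hj
    apply h
    have := Pl_mul hj (le_refl d'.natDegree)
    rwa [add_comm, hab, mul_comm] at this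

lemma Bs_small_val {g : (ZMod 2)[X]} {k n : ℕ} (hg : IsMin l (4 * k) g) (hD : g.natDegree ≤ k) (hn : 7 * k ≤ n)
    {c : (ZMod 2)[X] → (ZMod 2)[X]} (hc : ∀ p ∈ QQ g, c p ∈ Pl g.natDegree ∧ p ∣ 1 + c p ∧ ∀ t, p * t = g → t ∣ c p)
    {T : Finset (ZMod 2)[X]} (hT : T ⊆ QQ g) {t d' : (ZMod 2)[X]} (ht : g = sT T * t)
    (hd' : t * d' ∈ Mn k) (hcop : IsCoprime d' (sT T)) :
    Bs l (t * d') (sT T) (n - k) = cc l g n * 2 ^ (n - k - (sT T).natDegree) * e1 (l (∑ p ∈ T, c p)) := by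
  have hT' : T ⊆ PP g := hT.trans (Finset.filter_subset _ _)
  have hTi := PP_irr hT'
  have hs0 := sT_ne_zero hTi
  have ht0 : t ≠ 0 := fun h => hg.ne (by rw [ht, h, mul_zero])
  have hd0 : d' ≠ 0 := right_ne_zero_of_mul (Mn_ne_zero hd')
  have hdt : g.natDegree = (sT T).natDegree + t.natDegree := by
    conv_lhs => rw [ht]
    exact natDegree_mul hs0 ht0
  have hkd : t.natDegree + d'.natDegree = k := by
    rw [← natDegree_mul ht0 hd0, Mn_natDegree hd']
  have hpt := coprime_of_QQ hg.ne hT ht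
  have hst : IsCoprime (sT T) t := by
    apply IsCoprime.symm
    rw [coprime_iff hs0, PP_sT hTi]
    exact hpt
  have hm : (sT T).natDegree ≤ n - k := by omega
  obtain ⟨h0, hh0, hd0'⟩ := exists_sol hs0 (hst.mul_right hcop.symm) hm
  rw [Bs_eq l hs0 hm hh0 hd0']
  have hiff : (∀ j ∈ Pl (n - k - (sT T).natDegree), l (t * d' * sT T * j) = 0) ↔
      ∀ q ∈ Pl (n - g.natDegree), l (g * q) = 0 := by
    rw [← van_iff hg hd0 (by omega) (b := n - k - (sT T).natDegree) (by omega)]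
    have : ∀ j, t * d' * sT T * j = g * (d' * j) := by intro j; rw [ht]; ring
    simp only [this]
  rw [cc]
  by_cases hv : ∀ q ∈ Pl (n - g.natDegree), l (g * q) = 0
  · rw [if_pos (hiff.2 hv), if_pos hv]
    have hcT : ∑ p ∈ T, c p ∈ Pl g.natDegree := by
      refine Finset.sum_induction _ (fun x => x ∈ Pl g.natDegree) (fun a b => Pl_add) ?_ fun p hp => (hc p (hT hp)).1
      rw [mem_Pl']; simp
    have hdiv : g ∣ t * d' * h0 - ∑ p ∈ T, c p := by
      rw [ht]
      apply hst.mul_dvd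
      · rw [sT_dvd_iff hTi]
        intro p hp
        have h1 : p ∣ 1 + c p := (hc p (hT hp)).2.1
        have h2 : p ∣ 1 + t * d' * h0 := (by rw [sT_erase hp]; exact dvd_mul_right _ _ : p ∣ sT T).trans hd0'
        have h3 : p ∣ ∑ q ∈ T.erase p, c q := by
          apply Finset.dvd_sum
          intro q hq
          have hqT := Finset.mem_of_mem_erase hq
          have hqg := PP_dvd hT' q hqT
          obtain ⟨t', ht'⟩ := hqg
          refine dvd_trans ?_ ((hc q (hT hqT)).2.2 t' ht'.symm)
          have hcop' := irr_coprime (hTi p hp) (hTi q hqT) (Finset.ne_of_mem_erase hq).symm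
          apply hcop'.dvd_of_dvd_mul_left
          rw [← ht']
          exact PP_dvd hT' p hp
        rw [← Finset.add_sum_erase T c hp]
        have e : t * d' * h0 - (c p + ∑ q ∈ T.erase p, c q) =
          (1 + t * d' * h0) - (1 + c p) - ∑ q ∈ T.erase p, c q := by ring
        rw [e]
        exact dvd_sub (dvd_sub h2 h1) h3
      · apply dvd_sub
        · rw [mul_assoc]; exact dvd_mul_right _ _
        · apply Finset.dvd_sum
          intro q hq
          have hqT := hTi q hq
          have : q * (sT (T.erase q) * t) = g := by rw [ht, sT_erase hq]; ring
          exact (dvd_mul_left t (sT (T.erase q))).trans ((hc q (hT hq)).2.2 _ this)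
    obtain ⟨q, hq⟩ := hdiv
    have hM : t * d' * h0 ∈ Mn n := by
      have := Mn_mul hd' hh0
      rwa [show k + (n - k) = n by omega] at this
    have hgq : g * q ∈ Mn n := by
      rw [← hq, sub_eq_add_neg]
      apply Mn_add_Pl hM
      rw [mem_Pl, degree_neg, ← mem_Pl]
      exact Pl_mono (by omega) hcT
    have hqM : q ∈ Mn (n - g.natDegree) := by
      have hq0 : q ≠ 0 := right_ne_zero_of_mul (Mn_ne_zero hgq)
      rw [mem_Mn'] at hgq ⊢
      rw [natDegree_mul hg.ne hq0] at hgq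
      exact ⟨hq0, by omega⟩
    have h5 : l (g * q) = l (g * X ^ (n - g.natDegree)) := by
      have := hv _ (Mn_sub_Mn hqM (X_pow_Mn (n - g.natDegree)))
      rw [mul_sub, map_sub, sub_eq_zero] at this
      exact this
    have h6 : t * d' * h0 = g * q + ∑ p ∈ T, c p := by rw [← hq]; ring
    rw [h6, map_add, e1_add, h5]
    ring
  · rw [if_neg (fun h => hv (hiff.1 h)), if_neg hv]
    ring

lemma Rs_small {g : (ZMod 2)[X]} {k n : ℕ} (hg : IsMin l (4 * k) g) (hD : g.natDegree ≤ k) (hn : 7 * k ≤ n)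
    {c : (ZMod 2)[X] → (ZMod 2)[X]} (hc : ∀ p ∈ QQ g, c p ∈ Pl g.natDegree ∧ p ∣ 1 + c p ∧ ∀ t, p * t = g → t ∣ c p)
    {T : Finset (ZMod 2)[X]} (hT : T ⊆ QQ g) :
    Rs l g k n T = cc l g n * 2 ^ (n - g.natDegree) * e1 (l (∑ p ∈ T, c p)) := by
  have hT' : T ⊆ PP g := hT.trans (Finset.filter_subset _ _)
  have hTi := PP_irr hT'
  have hs0 := sT_ne_zero hTi
  obtain ⟨t, ht⟩ := sT_dvd hT'
  have ht0 : t ≠ 0 := fun h => hg.ne (by rw [ht, h, mul_zero])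
  have hdt : g.natDegree = (sT T).natDegree + t.natDegree := by
    conv_lhs => rw [ht]
    exact natDegree_mul hs0 ht0
  have hpt := coprime_of_QQ hg.ne hT ht
  have h1 : Rs l g k n T = ∑ d ∈ Mn k, if t ∣ d then th d / th (d * g) * Bs l d (sT T) (n - k) else 0 := by
    refine Finset.sum_congr rfl fun d hd => ?_
    split_ifs with h
    · rfl
    · by_cases hB : Bs l d (sT T) (n - k) = 0
      · rw [hB, mul_zero]
      · exact absurd (Bs_small hg hD hn ht hd hB).2 h
  rw [h1, sum_mult ht0 (by omega) (fun d => th d / th (d * g) * Bs l d (sT T) (n - k))]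
  have h2 : ∀ d' ∈ Mn (k - t.natDegree), th (t * d') / th (t * d' * g) * Bs l (t * d') (sT T) (n - k) =
      (if IsCoprime d' (sT T) then (1 : ℝ) else 0) * ((th (sT T))⁻¹ *
        (cc l g n * 2 ^ (n - k - (sT T).natDegree) * e1 (l (∑ p ∈ T, c p)))) := by
    intro d' hd'
    have hM : t * d' ∈ Mn k := by
      have := Mn_mul (n := t.natDegree) ((mem_Mn').2 ⟨ht0, rfl⟩) hd'
      rwa [show t.natDegree + (k - t.natDegree) = k by omega] at this
    by_cases hcop : IsCoprime d' (sT T)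
    · rw [if_pos hcop, one_mul, Bs_small_val hg hD hn hc hT ht hM hcop, kap_eq (Mn_ne_zero hM) hg.ne]
      congr 2
      rw [th, PP_sT hTi]
      congr 1
      ext p
      rw [Finset.mem_filter, mem_PP hg.ne]
      constructor
      · rintro ⟨⟨h3, h4⟩, h5⟩
        rw [ht] at h4
        rcases h3.prime.dvd_or_dvd h4 with h6 | h6
        · rw [← PP_sT hTi, mem_PP hs0]
          exact ⟨h3, h6⟩
        · exact absurd (h6.mul_right d') h5
      · intro hp
        refine ⟨⟨hTi p hp, PP_dvd hT' p hp⟩, fun h => ?_⟩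
        rcases (hTi p hp).prime.dvd_or_dvd h with h6 | h6
        · exact hpt p hp h6
        · rw [coprime_iff hs0, PP_sT hTi] at hcop
          exact hcop p hp h6
    · rw [if_neg hcop, zero_mul]
      by_cases hB : Bs l (t * d') (sT T) (n - k) = 0
      · rw [hB, mul_zero]
      · exfalso
        apply hcop
        exact (Bs_small hg hD hn ht hM hB).1.symm.of_mul_left_right
  rw [Finset.sum_congr rfl h2, ← Finset.sum_mul, Finset.sum_boole, count_coprime hs0 (by omega)]
  have h3 := th_pos (sT T)
  have h4 : (2 : ℝ) ^ (n - g.natDegree) = 2 ^ (k - t.natDegree) * 2 ^ (n - k - (sT T).natDegree) := by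
    rw [← pow_add]; congr 1; omega
  rw [h4]
  field_simp

lemma Sn_small {g : (ZMod 2)[X]} {k : ℕ} (hg : IsMin l (4 * k) g) (hD : g.natDegree ≤ k) :
    ∃ P : ℝ, 0 ≤ P ∧ P ≤ 2 ^ (PP g).card ∧ (PP g = ∅ → P = 1) ∧ ∀ n, 7 * k ≤ n →
      Sn l g k n = cc l g n * 2 ^ (n - g.natDegree) * P := by
  have hex : ∀ p, ∃ c, p ∈ QQ g → c ∈ Pl g.natDegree ∧ p ∣ 1 + c ∧ ∀ t, p * t = g → t ∣ c := by
    intro p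
    by_cases hp : p ∈ QQ g
    · have hp' := hp
      rw [QQ, Finset.mem_filter, mem_PP hg.ne] at hp'
      obtain ⟨c, h1, h2⟩ := crt_elt hg.ne hp'.1.1 hp'.1.2 hp'.2
      exact ⟨c, fun _ => ⟨h1, h2⟩⟩
    · exact ⟨0, fun h => absurd h hp⟩
  choose c hc using hex
  have hb : ∀ p, 0 ≤ 1 - e1 (l (c p)) ∧ 1 - e1 (l (c p)) ≤ 2 := by
    intro p
    have := abs_le.1 (e1_abs (l (c p))).le
    constructor <;> linarith [this.1, this.2]
  refine ⟨∏ p ∈ QQ g, (1 - e1 (l (c p))), Finset.prod_nonneg fun p _ => (hb p).1, ?_, ?_, ?_⟩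
  · calc _ ≤ ∏ p ∈ QQ g, (2 : ℝ) := Finset.prod_le_prod (fun p _ => (hb p).1) fun p _ => (hb p).2
      _ ≤ _ := by
        rw [Finset.prod_const]
        exact pow_le_pow_right₀ (by norm_num) (Finset.card_filter_le _ _)
  · intro h
    rw [QQ, h]; simp
  · intro n hn
    rw [Sn_eq l hg.ne]
    have h1 : ∏ p ∈ QQ g, (1 - e1 (l (c p))) = ∏ p ∈ QQ g, (-e1 (l (c p)) + 1) :=
      Finset.prod_congr rfl fun p _ => by ring
    rw [h1, Finset.prod_add, Finset.mul_sum]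
    symm
    apply Finset.sum_subset_zero_on_sdiff
    · exact Finset.powerset_mono.2 (Finset.filter_subset _ _)
    · intro T hT
      rw [Finset.mem_sdiff, Finset.mem_powerset, Finset.mem_powerset] at hT
      rw [Rs_small_zero hg hD hn hT.1 hT.2, mul_zero]
    · intro T hT
      rw [Finset.mem_powerset] at hT
      rw [Rs_small hg hD hn hc hT, Finset.prod_const_one, mul_one, Finset.prod_neg, map_sum, e1_sum]
      ring

end Sark

namespace Sark

variable {l : (ZMod 2)[X] →ₗ[ZMod 2] ZMod 2}

lemma van_succ {g : (ZMod 2)[X]} {a : ℕ} (h : ∀ q ∈ Pl (a + 1), l (g * q) = 0) :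
    (∀ q ∈ Pl a, l (g * q) = 0) ∧ l (g * X ^ a) = 0 :=
  ⟨fun q hq => h q (Pl_mono (by omega) hq), h _ (Mn_Pl (X_pow_Mn a))⟩

lemma cc_sum {g : (ZMod 2)[X]} {n0 : ℕ} (hn0 : g.natDegree ≤ n0) (n1 : ℕ) (hn1 : n0 ≤ n1) :
    -(2 : ℝ) ^ n0 ≤ ∑ n ∈ Finset.Ico n0 n1, cc l g n * 2 ^ n ∧
    ((∀ q ∈ Pl (n1 - g.natDegree), l (g * q) = 0) →
      ∑ n ∈ Finset.Ico n0 n1, cc l g n * 2 ^ n = 2 ^ n1 - 2 ^ n0) := by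
  induction n1, hn1 using Nat.le_induction with
  | base => simp
  | succ n1 hn1 ih =>
    rw [Finset.sum_Ico_succ_top hn1]
    have hs : n1 + 1 - g.natDegree = (n1 - g.natDegree) + 1 := by omega
    constructor
    · by_cases hv : ∀ q ∈ Pl (n1 - g.natDegree), l (g * q) = 0
      · rw [ih.2 hv, cc, if_pos hv]
        have h1 := abs_le.1 (e1_abs (l (g * X ^ (n1 - g.natDegree)))).le
        have h2 : (0 : ℝ) < 2 ^ n1 := by positivity
        nlinarith [h1.1]
      · rw [cc, if_neg hv]
        linarith [ih.1]
    · intro h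
      rw [hs] at h
      have h1 := van_succ h
      rw [ih.2 h1.1, cc, if_pos h1.1, h1.2, e1_zero, pow_succ]
      ring

lemma Sn_total {g : (ZMod 2)[X]} {k : ℕ} (hk : 1 ≤ k) (hg : IsMin l (4 * k) g) :
    -(k * 4 ^ (PP g).card * 2 ^ (7 * k) : ℝ) ≤ ∑ n ∈ Finset.Ico (7 * k) (8 * k), Sn l g k n := by
  have hk' : (1 : ℝ) ≤ k := by exact_mod_cast hk
  by_cases hD : g.natDegree ≤ k
  · obtain ⟨P, h0, h1, _, h3⟩ := Sn_small hg hD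
    have e : ∑ n ∈ Finset.Ico (7 * k) (8 * k), Sn l g k n =
        P * (1 / 2) ^ g.natDegree * ∑ n ∈ Finset.Ico (7 * k) (8 * k), cc l g n * 2 ^ n := by
      rw [Finset.mul_sum]
      refine Finset.sum_congr rfl fun n hn => ?_
      rw [Finset.mem_Ico] at hn
      rw [h3 n hn.1]
      have : (2 : ℝ) ^ n = 2 ^ (n - g.natDegree) * 2 ^ g.natDegree := by rw [← pow_add]; congr 1; omega
      rw [this, one_div, inv_pow]
      field_simp
    rw [e]
    have hb := (cc_sum (l := l) (g := g) (n0 := 7 * k) (by omega) (8 * k) (by omega)).1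
    have hw : (1 / 2 : ℝ) ^ g.natDegree ≤ 1 := pow_le_one₀ (by norm_num) (by norm_num)
    have hw0 : (0 : ℝ) < (1 / 2 : ℝ) ^ g.natDegree := by positivity
    have hA : P * (1 / 2) ^ g.natDegree ≤ k * 4 ^ (PP g).card := by
      calc P * (1 / 2) ^ g.natDegree ≤ P * 1 := mul_le_mul_of_nonneg_left hw h0
        _ ≤ 1 * 4 ^ (PP g).card := by
            rw [mul_one, one_mul]
            exact h1.trans (pow_le_pow_left₀ (by norm_num) (by norm_num) _)
        _ ≤ _ := mul_le_mul_of_nonneg_right hk' (by positivity)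
    have hA0 : 0 ≤ P * (1 / 2) ^ g.natDegree := by positivity
    have h2 : (0 : ℝ) < 2 ^ (7 * k) := by positivity
    calc _ ≤ -(P * (1 / 2) ^ g.natDegree * 2 ^ (7 * k)) := by
          apply neg_le_neg
          exact mul_le_mul_of_nonneg_right hA h2.le
      _ = P * (1 / 2) ^ g.natDegree * (-2 ^ (7 * k)) := by ring
      _ ≤ _ := mul_le_mul_of_nonneg_left hb hA0
  · push Not at hD
    have h1 : ∀ n ∈ Finset.Ico (7 * k) (8 * k), -(4 ^ (PP g).card * 2 ^ (7 * k) : ℝ) ≤ Sn l g k n := by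
      intro n hn
      rw [Finset.mem_Ico] at hn
      have := (abs_le.1 (Sn_large hg hD hn.1)).1
      refine le_trans (neg_le_neg ?_) this
      exact mul_le_mul_of_nonneg_left (pow_le_pow_right₀ (by norm_num) (by omega)) (by positivity)
    have := Finset.sum_le_sum h1
    rw [Finset.sum_const, Nat.card_Ico, show 8 * k - 7 * k = k by omega, nsmul_eq_mul] at this
    linarith

lemma sum_mult1 {d : (ZMod 2)[X]} (hd : d ≠ 0) {n : ℕ} (hn : 1 ≤ n) (hn' : d.natDegree ≤ n) (F : (ZMod 2)[X] → ℝ) :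
    ∑ f ∈ Mn n, (if d ∣ 1 + f then F f else 0) = ∑ h ∈ Mn (n - d.natDegree), F (1 + d * h) := by
  have h2 : ∀ f : (ZMod 2)[X], 1 + (1 + f) = f := by
    intro f; rw [← add_assoc, CharTwo.add_self_eq_zero, zero_add]
  have h1P : (1 : (ZMod 2)[X]) ∈ Pl n := by
    rw [mem_Pl']; right; rw [natDegree_one]; omega
  rw [← sum_mult hd hn' (fun f => F (1 + f))]
  apply Finset.sum_bij (fun f _ => 1 + f)
  · intro f hf; rw [add_comm]; exact Mn_add_Pl hf h1P
  · intro a _ b _ hab; exact add_left_cancel hab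
  · intro f hf
    exact ⟨1 + f, by rw [add_comm]; exact Mn_add_Pl hf h1P, h2 f⟩
  · intro f _
    rw [h2]

lemma err_term {g : (ZMod 2)[X]} {k n : ℕ} (hk : 1 ≤ k) (hg : IsMin l (4 * k) g) (hn : 7 * k ≤ n) (hn8 : n < 8 * k)
    {d : (ZMod 2)[X]} (hd : d ∈ Mn k) :
    |n * ∑ r ∈ Irr n, (if d ∣ 1 + r then e1 (l (1 + r)) else 0) -
      1 / th (d * g) * ∑ h ∈ Mn (n - k), (if IsCoprime (1 + d * h) g then e1 (l (d * h)) else 0)| ≤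
      (8 * k + 3) * 2 ^ (6 * k) := by
  have hd0 := Mn_ne_zero hd
  have hdk := Mn_natDegree hd
  have hdeg := hg.deg
  have hh : d * g ≠ 0 := mul_ne_zero hd0 hg.ne
  have hhd : (d * g).natDegree = k + g.natDegree := by rw [natDegree_mul hd0 hg.ne, hdk]
  set K := max 1 (n + 1 - g.natDegree - 4 * k) with hK
  have hK1 : 1 ≤ K := le_max_left _ _
  have hK2 : n + 1 - g.natDegree - 4 * k ≤ K := le_max_right _ _
  have hK3 : K + g.natDegree ≤ 4 * k + 1 := by
    rcases max_choice 1 (n + 1 - g.natDegree - 4 * k) with h | h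
    · rw [hK, h]; omega
    · rw [hK, h]; omega
  set φ : (ZMod 2)[X] → ℝ := fun f => if d ∣ 1 + f then (if IsCoprime f (d * g) then e1 (l (1 + f)) else 0) else 0
    with hφ
  have main := equi hh K hK1 n (by omega) (by rw [hhd]; omega) φ (by
    intro f _ f' _ h1 h2
    obtain ⟨q, hq⟩ := h1
    have e1' : f = f' + d * g * q := by rw [← hq]; ring
    have hd1 : d ∣ 1 + f ↔ d ∣ 1 + f' := by
      rw [e1', show 1 + (f' + d * g * q) = (1 + f') + d * (g * q) by ring]
      exact dvd_add_left (dvd_mul_right d (g * q))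
    have hc1 : IsCoprime f (d * g) ↔ IsCoprime f' (d * g) := by
      rw [e1']; exact IsCoprime.add_mul_left_left_iff
    have hl : l (1 + f) = l (1 + f') := by
      have h3 : l (g * (d * q)) = 0 := by
        apply hg.van
        apply Pl_of_mul hg.ne
        rw [show d * q * g = f - f' by rw [hq]; ring]
        exact Pl_mono (by omega) h2
      rw [e1', show 1 + (f' + d * g * q) = (1 + f') + g * (d * q) by ring, map_add, h3, add_zero]
    simp only [hφ, hd1, hc1, hl]) (by
    intro f _ h1
    simp only [hφ, if_neg h1, ite_self])
  rw [count_coprime hh (by rw [hhd]; omega)] at main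
  have t1 : ∑ r ∈ Irr n, φ r = ∑ r ∈ Irr n, (if d ∣ 1 + r then e1 (l (1 + r)) else 0) := by
    refine Finset.sum_congr rfl fun r hr => ?_
    rw [Irr, Finset.mem_filter] at hr
    have : IsCoprime r (d * g) := by
      rw [hr.2.coprime_iff_not_dvd]
      intro hdv
      have := natDegree_le_of_dvd hdv hh
      rw [hhd, Mn_natDegree hr.1] at this
      omega
    simp only [hφ, if_pos this]
  have t2 : ∑ f ∈ Mn n, φ f = ∑ h ∈ Mn (n - k), (if IsCoprime (1 + d * h) g then e1 (l (d * h)) else 0) := by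
    have h2 : ∀ f : (ZMod 2)[X], 1 + (1 + f) = f := by
      intro f; rw [← add_assoc, CharTwo.add_self_eq_zero, zero_add]
    rw [hφ, sum_mult1 hd0 (by omega) (by omega), hdk]
    refine Finset.sum_congr rfl fun h _ => ?_
    have hc : IsCoprime (1 + d * h) (d * g) ↔ IsCoprime (1 + d * h) g := by
      rw [IsCoprime.mul_right_iff, and_iff_right_iff_imp]
      intro _
      exact IsCoprime.add_mul_left_left_iff.2 isCoprime_one_left
    simp only [hc, h2]
  have t3 : ∑ f ∈ Mn n, φ f ^ 2 ≤ 2 ^ (n - k) := by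
    calc _ ≤ ∑ f ∈ Mn n, (if d ∣ 1 + f then (1 : ℝ) else 0) := by
          refine Finset.sum_le_sum fun f _ => ?_
          simp only [hφ]
          split_ifs
          · rw [e1_sq]
          · simp
          · simp
      _ = _ := by
          rw [sum_mult1 hd0 (by omega) (by omega) (fun _ => 1), hdk, Finset.sum_const, card_Mn]
          simp
  have t4 : Real.sqrt ((∑ f ∈ Mn n, φ f ^ 2) / 2 ^ (n + 1 - ((d * g).natDegree + K))) ≤ 2 ^ (2 * k) := by
    apply Real.sqrt_le_iff.2
    refine ⟨by positivity, ?_⟩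
    rw [div_le_iff₀ (by positivity)]
    refine t3.trans ?_
    rw [← pow_mul, ← pow_add]
    exact pow_le_pow_right₀ (by norm_num) (by rw [hhd]; omega)
  have t5 : Real.sqrt 2 ^ n ≤ 2 ^ (4 * k) := by
    calc Real.sqrt 2 ^ n ≤ Real.sqrt 2 ^ (2 * (4 * k)) :=
          pow_le_pow_right₀ (by rw [Real.one_le_sqrt]; norm_num) (by omega)
      _ = _ := by rw [pow_mul, Real.sq_sqrt (by norm_num)]
  have t6 : (((d * g).natDegree : ℝ) + K + 2) ≤ 8 * k + 3 := by
    have : (d * g).natDegree + K + 2 ≤ 8 * k + 3 := by rw [hhd]; omega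
    exact_mod_cast this
  rw [t1, t2] at main
  have t7 : (2 : ℝ) ^ n / (2 ^ n * th (d * g)) = 1 / th (d * g) := by
    have := th_pos (d * g)
    field_simp
  rw [t7] at main
  refine main.trans ?_
  calc _ ≤ ((8 * k + 3 : ℝ) * 2 ^ (4 * k)) * 2 ^ (2 * k) := by gcongr
    _ = _ := by rw [mul_assoc, ← pow_add]; congr 2; omega

def What (l : (ZMod 2)[X] →ₗ[ZMod 2] ZMod 2) (k : ℕ) : ℝ :=
  ∑ n ∈ Finset.Ico (7 * k) (8 * k), ∑ d ∈ Mn k, th d * (n * ∑ r ∈ Irr n, (if d ∣ 1 + r then e1 (l (1 + r)) else 0))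

lemma What_err {g : (ZMod 2)[X]} {k : ℕ} (hk : 1 ≤ k) (hg : IsMin l (4 * k) g) :
    |What l k - ∑ n ∈ Finset.Ico (7 * k) (8 * k), Sn l g k n| ≤ k * (8 * k + 3) * 2 ^ (7 * k) := by
  rw [What, ← Finset.sum_sub_distrib]
  have h1 : ∀ n ∈ Finset.Ico (7 * k) (8 * k),
      |∑ d ∈ Mn k, th d * (n * ∑ r ∈ Irr n, (if d ∣ 1 + r then e1 (l (1 + r)) else 0)) - Sn l g k n| ≤
        (8 * k + 3) * 2 ^ (7 * k) := by
    intro n hn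
    rw [Finset.mem_Ico] at hn
    rw [Sn, ← Finset.sum_sub_distrib]
    calc _ ≤ ∑ d ∈ Mn k, (8 * k + 3 : ℝ) * 2 ^ (6 * k) := by
          refine (Finset.abs_sum_le_sum_abs _ _).trans (Finset.sum_le_sum fun d hd => ?_)
          have := err_term hk hg hn.1 hn.2 hd
          rw [div_eq_mul_one_div, mul_assoc (th d), ← mul_sub, abs_mul, abs_of_pos (th_pos d)]
          calc _ ≤ 1 * _ := mul_le_mul_of_nonneg_right (th_le_one d) (abs_nonneg _)
            _ ≤ _ := by rw [one_mul]; exact this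
      _ = _ := by
          rw [Finset.sum_const, card_Mn, nsmul_eq_mul]
          push_cast
          rw [show 7 * k = k + 6 * k by omega, pow_add]; ring
  refine (Finset.abs_sum_le_sum_abs _ _).trans ((Finset.sum_le_sum h1).trans ?_)
  rw [Finset.sum_const, Nat.card_Ico, show 8 * k - 7 * k = k by omega, nsmul_eq_mul, mul_assoc]

lemma omega_bound {g : (ZMod 2)[X]} (hg : g ≠ 0) (m : ℕ) : m * (PP g).card ≤ g.natDegree + m * 2 ^ m := by
  have h1 := natDegree_le_of_dvd (sT_dvd (Finset.filter_subset (fun p => ¬ p.natDegree < m) (PP g))) hg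
  rw [sT_natDegree (PP_irr (Finset.filter_subset _ _))] at h1
  have h2 : m * ((PP g).filter (fun p => ¬ p.natDegree < m)).card ≤
      ∑ p ∈ (PP g).filter (fun p => ¬ p.natDegree < m), p.natDegree := by
    rw [mul_comm, ← smul_eq_mul]
    apply Finset.card_nsmul_le_sum
    intro p hp
    have := (Finset.mem_filter.1 hp).2
    omega
  have h3 : ((PP g).filter (fun p => p.natDegree < m)).card ≤ 2 ^ m := by
    rw [← card_Pl m]
    apply Finset.card_le_card
    intro p hp
    rw [mem_Pl']
    exact Or.inr (Finset.mem_filter.1 hp).2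
  have h4 := Finset.card_filter_add_card_filter_not (s := PP g) (fun p => p.natDegree < m)
  rw [← h4, mul_add]
  have := Nat.mul_le_mul_left m h3
  omega

end Sark

namespace Sark

def ell (N : ℕ) (v : (ZMod 2)[X]) : (ZMod 2)[X] →ₗ[ZMod 2] ZMod 2 :=
  ∑ i ∈ Finset.range N, v.coeff i • lcoeff (ZMod 2) i

lemma ell_apply (N : ℕ) (v f : (ZMod 2)[X]) :
    ell N v f = ∑ i ∈ Finset.range N, v.coeff i * f.coeff i := by
  simp [ell]

lemma ell_comm (N : ℕ) (v f : (ZMod 2)[X]) : ell N v f = ell N f v := by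
  rw [ell_apply, ell_apply]
  exact Finset.sum_congr rfl fun i _ => mul_comm _ _

lemma ell_zero (N : ℕ) : ell N 0 = 0 := by
  simp [ell]

lemma ell_sum {N : ℕ} {f : (ZMod 2)[X]} (hf : f ∈ Pl N) :
    ∑ v ∈ Pl N, e1 (ell N v f) = if f = 0 then (2 : ℝ) ^ N else 0 := by
  have h := sum_e1 (ell N f).toAddMonoidHom N
  have h1 : ∑ v ∈ Pl N, e1 (ell N v f) = ∑ v ∈ Pl N, e1 ((ell N f).toAddMonoidHom v) :=
    Finset.sum_congr rfl fun v _ => by rw [ell_comm]; rfl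
  rw [h1, h]
  by_cases hf0 : f = 0
  · rw [if_pos hf0, if_pos]
    intro j _
    subst hf0
    rw [ell_zero]; rfl
  · rw [if_neg hf0, if_neg]
    intro hc
    have hd : f.natDegree < N := by
      rcases mem_Pl'.1 hf with h | h
      · exact absurd h hf0
      · exact h
    have := hc (X ^ f.natDegree) (by rw [mem_Pl']; right; rwa [natDegree_X_pow])
    change ell N f (X ^ f.natDegree) = 0 at this
    rw [ell_apply, Finset.sum_eq_single f.natDegree] at this
    · rw [coeff_X_pow_self, mul_one] at this
      exact hf0 (leadingCoeff_eq_zero.1 this)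
    · intro i _ hi
      rw [coeff_X_pow, if_neg hi, mul_zero]
    · intro h
      exact absurd (Finset.mem_range.2 hd) h

def Ah (N : ℕ) (A : Finset (ZMod 2)[X]) (v : (ZMod 2)[X]) : ℝ := ∑ a ∈ A, e1 (ell N v a)

lemma Ah_zero (N : ℕ) (A : Finset (ZMod 2)[X]) : Ah N A 0 = A.card := by
  rw [Ah, ell_zero]
  simp [e1_zero]

lemma Ah_corr {N : ℕ} {A : Finset (ZMod 2)[X]} (hA : ∀ a ∈ A, a ∈ Pl N) {b : (ZMod 2)[X]} (hb : b ∈ Pl N) :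
    ∑ v ∈ Pl N, e1 (ell N v b) * Ah N A v ^ 2 =
      ∑ a₁ ∈ A, ∑ a₂ ∈ A, if b + a₁ + a₂ = 0 then (2 : ℝ) ^ N else 0 := by
  have h1 : ∀ v, e1 (ell N v b) * Ah N A v ^ 2 = ∑ a₁ ∈ A, ∑ a₂ ∈ A, e1 (ell N v (b + a₁ + a₂)) := by
    intro v
    rw [Ah, pow_two, Finset.sum_mul_sum, Finset.mul_sum]
    refine Finset.sum_congr rfl fun a₁ _ => ?_
    rw [Finset.mul_sum]
    refine Finset.sum_congr rfl fun a₂ _ => ?_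
    rw [map_add, map_add, e1_add, e1_add, mul_assoc]
  simp_rw [h1]
  rw [Finset.sum_comm]
  refine Finset.sum_congr rfl fun a₁ h₁ => ?_
  rw [Finset.sum_comm]
  refine Finset.sum_congr rfl fun a₂ h₂ => ?_
  exact ell_sum (Pl_add (Pl_add hb (hA _ h₁)) (hA _ h₂))

lemma parseval {N : ℕ} {A : Finset (ZMod 2)[X]} (hA : ∀ a ∈ A, a ∈ Pl N) :
    ∑ v ∈ Pl N, Ah N A v ^ 2 = 2 ^ N * A.card := by
  have h := Ah_corr hA (b := 0) (by rw [mem_Pl']; exact Or.inl rfl)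
  have h1 : ∑ v ∈ Pl N, Ah N A v ^ 2 = ∑ v ∈ Pl N, e1 (ell N v 0) * Ah N A v ^ 2 :=
    Finset.sum_congr rfl fun v _ => by rw [map_zero, e1_zero, one_mul]
  rw [h1, h]
  have h2 : ∀ a₁ ∈ A, (∑ a₂ ∈ A, if 0 + a₁ + a₂ = 0 then (2 : ℝ) ^ N else 0) = 2 ^ N := by
    intro a₁ h₁
    rw [Finset.sum_eq_single a₁]
    · rw [zero_add, if_pos (CharTwo.add_self_eq_zero a₁)]
    · intro a₂ _ hne
      rw [zero_add, if_neg]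
      intro hc
      exact hne (CharTwo.add_eq_zero.1 hc).symm
    · intro h; exact absurd h₁ h
  rw [Finset.sum_congr rfl h2, Finset.sum_const, nsmul_eq_mul, mul_comm]

lemma What_corr {k : ℕ} {A : Finset (ZMod 2)[X]} (hA : ∀ a ∈ A, a ∈ Pl (8 * k)) (hk : 1 ≤ k)
    (hd : ∀ a₁ ∈ A, ∀ a₂ ∈ A, ∀ r : (ZMod 2)[X], Irreducible r → a₁ - a₂ ≠ r - 1) :
    ∑ v ∈ Pl (8 * k), What (ell (8 * k) v) k * Ah (8 * k) A v ^ 2 = 0 := by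
  simp only [What, Finset.sum_mul]
  rw [Finset.sum_comm]
  refine Finset.sum_eq_zero fun n hn => ?_
  rw [Finset.sum_comm]
  refine Finset.sum_eq_zero fun d _ => ?_
  have h1 : ∀ v, th d * (n * ∑ r ∈ Irr n, (if d ∣ 1 + r then e1 (ell (8 * k) v (1 + r)) else 0)) * Ah (8 * k) A v ^ 2 =
      ∑ r ∈ Irr n, (th d * n) * ((if d ∣ 1 + r then 1 else 0) * (e1 (ell (8 * k) v (1 + r)) * Ah (8 * k) A v ^ 2)) := by
    intro v
    rw [← mul_assoc, mul_assoc, Finset.sum_mul, Finset.mul_sum]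
    refine Finset.sum_congr rfl fun r _ => ?_
    split_ifs <;> ring
  simp_rw [h1]
  rw [Finset.sum_comm]
  refine Finset.sum_eq_zero fun r hr => ?_
  rw [← Finset.mul_sum, ← Finset.mul_sum]
  rw [Irr, Finset.mem_filter] at hr
  rw [Finset.mem_Ico] at hn
  have hb : 1 + r ∈ Pl (8 * k) := by
    apply Pl_add
    · rw [mem_Pl']; right; rw [natDegree_one]; omega
    · rw [mem_Pl']; right; rw [Mn_natDegree hr.1]; exact hn.2
  rw [Ah_corr hA hb]
  have : (∑ a₁ ∈ A, ∑ a₂ ∈ A, if 1 + r + a₁ + a₂ = 0 then (2 : ℝ) ^ (8 * k) else 0) = 0 := by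
    refine Finset.sum_eq_zero fun a₁ h₁ => Finset.sum_eq_zero fun a₂ h₂ => if_neg fun hc => ?_
    refine hd a₁ h₁ a₂ h₂ r hr.2 ?_
    rw [CharTwo.sub_eq_add, CharTwo.sub_eq_add]
    rw [add_assoc] at hc
    rw [← CharTwo.add_eq_zero.1 hc, add_comm]
  rw [this, mul_zero, mul_zero]

lemma What_lower {k : ℕ} (hk : 1 ≤ k) {M : ℝ}
    (hM : ∀ g : (ZMod 2)[X], g ≠ 0 → g.natDegree ≤ 4 * k → (4 : ℝ) ^ (PP g).card ≤ M)
    (l : (ZMod 2)[X] →ₗ[ZMod 2] ZMod 2) :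
    -((k * (8 * k + 3) + k * M) * 2 ^ (7 * k)) ≤ What l k := by
  obtain ⟨g, hg⟩ := exists_min (l := l) (4 * k)
  have h1 := Sn_total hk hg
  have h2 := (abs_le.1 (What_err hk hg)).1
  have h3 : (k : ℝ) * 4 ^ (PP g).card * 2 ^ (7 * k) ≤ k * M * 2 ^ (7 * k) := by
    gcongr
    exact hM g hg.ne hg.deg
  nlinarith

lemma What_zero {k : ℕ} (hk : 1 ≤ k) :
    (2 : ℝ) ^ (8 * k) - 2 ^ (7 * k) - k * (8 * k + 3) * 2 ^ (7 * k) ≤ What 0 k := by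
  have hg : IsMin (0 : (ZMod 2)[X] →ₗ[ZMod 2] ZMod 2) (4 * k) 1 :=
    ⟨one_ne_zero, by simp, fun _ _ => rfl, fun w _ hw => by simp at hw⟩
  have h2 := (abs_le.1 (What_err hk hg)).1
  obtain ⟨P, -, -, hP, hS⟩ := Sn_small hg (by simp)
  have hPP : PP (1 : (ZMod 2)[X]) = ∅ := by
    rw [← Finset.card_eq_zero]
    have := omega_bound (one_ne_zero : (1 : (ZMod 2)[X]) ≠ 0) 0
    by_contra hc
    obtain ⟨p, hp⟩ := Finset.card_pos.1 (Nat.pos_of_ne_zero hc)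
    have h1 := (PP_irr (Finset.Subset.refl _)) p hp
    have h2 := sT_dvd (Finset.singleton_subset_iff.2 hp)
    simp [sT] at h2
    exact h1.not_isUnit (isUnit_of_dvd_one h2)
  have hc := (cc_sum (l := (0 : (ZMod 2)[X] →ₗ[ZMod 2] ZMod 2)) (g := 1) (n0 := 7 * k) (by simp) (8 * k) (by omega)).2
    (fun _ _ => rfl)
  have h3 : ∑ n ∈ Finset.Ico (7 * k) (8 * k), Sn (0 : (ZMod 2)[X] →ₗ[ZMod 2] ZMod 2) 1 k n = 2 ^ (8 * k) - 2 ^ (7 * k) := by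
    rw [← hc]
    refine Finset.sum_congr rfl fun n hn => ?_
    rw [hS n (Finset.mem_Ico.1 hn).1, hP hPP, natDegree_one, Nat.sub_zero, mul_one]
  rw [h3] at h2
  linarith

lemma main_bound {k : ℕ} (hk : 1 ≤ k) {M : ℝ} (hM1 : 1 ≤ M)
    (hM : ∀ g : (ZMod 2)[X], g ≠ 0 → g.natDegree ≤ 4 * k → (4 : ℝ) ^ (PP g).card ≤ M)
    {A : Finset (ZMod 2)[X]} (hA : ∀ a ∈ A, a ∈ Pl (8 * k))
    (hd : ∀ a₁ ∈ A, ∀ a₂ ∈ A, ∀ r : (ZMod 2)[X], Irreducible r → a₁ - a₂ ≠ r - 1) :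
    (A.card : ℝ) ≤ 36 * (k : ℝ) ^ 2 * M * 2 ^ (7 * k) := by
  have hk' : (1 : ℝ) ≤ k := by exact_mod_cast hk
  set B : ℝ := (k * (8 * k + 3) + k * M) * 2 ^ (7 * k) with hB
  have h2p : (0 : ℝ) < 2 ^ (7 * k) := by positivity
  have h8p : (0 : ℝ) < 2 ^ (8 * k) := by positivity
  have hcard : (A.card : ℝ) ≤ 2 ^ (8 * k) := by
    have := Finset.card_le_card (show A ⊆ Pl (8 * k) from hA)
    rw [card_Pl] at this
    exact_mod_cast this
  have hB36 : 3 * B ≤ 36 * (k : ℝ) ^ 2 * M * 2 ^ (7 * k) := by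
    rw [hB, ← mul_assoc]
    apply mul_le_mul_of_nonneg_right _ h2p.le
    have a1 : (k : ℝ) ≤ k ^ 2 := by nlinarith
    have a2 : (k : ℝ) ^ 2 ≤ k ^ 2 * M := by nlinarith
    have a3 : (k : ℝ) * M ≤ k ^ 2 * M := by nlinarith
    nlinarith
  refine le_trans ?_ hB36
  have hmem0 : (0 : (ZMod 2)[X]) ∈ Pl (8 * k) := by rw [mem_Pl']; exact Or.inl rfl
  have hsum := What_corr hA hk hd
  have hpar := parseval hA
  have hnn : ∀ v ∈ Pl (8 * k), 0 ≤ (What (ell (8 * k) v) k + B) * Ah (8 * k) A v ^ 2 := by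
    intro v _
    have := What_lower hk hM (ell (8 * k) v)
    exact mul_nonneg (by linarith) (pow_two_nonneg _)
  have h0 := Finset.single_le_sum hnn hmem0
  simp only [add_mul, Finset.sum_add_distrib, ← Finset.mul_sum] at h0
  rw [hsum, hpar, ell_zero, Ah_zero, zero_add] at h0
  have hW := What_zero hk
  have hB0 : 0 ≤ B := by positivity
  have hBE : (2 : ℝ) ^ (7 * k) + k * (8 * k + 3) * 2 ^ (7 * k) ≤ 2 * B := by
    have : 1 ≤ k * M := by nlinarith
    have b1 : 0 ≤ k * (8 * (k : ℝ) + 3) := by positivity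
    rw [hB]
    nlinarith
  rcases Nat.eq_zero_or_pos A.card with hz | hz
  · rw [hz]; push_cast; linarith
  have hc0 : (0 : ℝ) < A.card := by exact_mod_cast hz
  set c : ℝ := (A.card : ℝ) with hc9
  have h3 : What 0 k * c ≤ B * 2 ^ (8 * k) := by
    have : What 0 k * c * c ≤ B * 2 ^ (8 * k) * c := by nlinarith [mul_nonneg hB0 (pow_two_nonneg c)]
    exact le_of_mul_le_mul_right this hc0
  have h4 : (2 ^ (8 * k) - 2 * B) * c ≤ B * 2 ^ (8 * k) := by
    refine le_trans (mul_le_mul_of_nonneg_right ?_ hc0.le) h3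
    linarith
  have h5 : 2 * B * c ≤ 2 * B * 2 ^ (8 * k) := by gcongr
  have h6 : c * 2 ^ (8 * k) ≤ 3 * B * 2 ^ (8 * k) := by nlinarith
  exact le_of_mul_le_mul_right h6 h8p

lemma pow_card_bound {m k : ℕ} (hm : 1 ≤ m) (g : (ZMod 2)[X]) (hg : g ≠ 0) (hdeg : g.natDegree ≤ 4 * k) :
    (4 : ℝ) ^ (PP g).card ≤ (2 : ℝ) ^ ((8 * k : ℝ) / m + 2 ^ (m + 1)) := by
  have h := omega_bound hg m
  have h1 : (m : ℝ) * (PP g).card ≤ 4 * k + m * 2 ^ m := by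
    have : m * (PP g).card ≤ 4 * k + m * 2 ^ m := by omega
    exact_mod_cast this
  have hm' : (0 : ℝ) < m := by exact_mod_cast hm
  rw [show (4 : ℝ) = 2 ^ 2 by norm_num, ← pow_mul, ← Real.rpow_natCast]
  apply Real.rpow_le_rpow_of_exponent_le (by norm_num)
  push_cast
  rw [pow_succ, div_add' _ _ _ hm'.ne', le_div_iff₀ hm']
  nlinarith

lemma sq_bound {δ : ℝ} (hδ : 0 < δ) (k : ℕ) :
    (k : ℝ) ^ 2 ≤ (1 / (δ * Real.log 2)) ^ 2 * (2 : ℝ) ^ (2 * δ * k) := by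
  have hl : 0 < Real.log 2 := Real.log_pos (by norm_num)
  have h1 : δ * Real.log 2 * k ≤ (2 : ℝ) ^ (δ * k) := by
    rw [Real.rpow_def_of_pos (by norm_num)]
    have := Real.add_one_le_exp (Real.log 2 * (δ * k))
    linarith
  have h2 : (k : ℝ) ≤ 1 / (δ * Real.log 2) * (2 : ℝ) ^ (δ * k) := by
    rw [one_div, inv_mul_eq_div, le_div_iff₀ (by positivity)]
    linarith
  calc (k : ℝ) ^ 2 ≤ (1 / (δ * Real.log 2) * (2 : ℝ) ^ (δ * k)) ^ 2 := by gcongr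
    _ = _ := by
      rw [mul_pow, ← Real.rpow_mul_natCast (by norm_num)]
      congr 2
      push_cast; ring

theorem final : ∀ ε : ℝ, 0 < ε → ∃ C : ℝ, 0 < C ∧ ∀ N : ℕ, ∀ A : Finset (ZMod 2)[X],
    (∀ f ∈ A, f.degree < (N : ℕ)) →
    (∀ a₁ ∈ A, ∀ a₂ ∈ A, ∀ r : (ZMod 2)[X], Irreducible r → a₁ - a₂ ≠ r - 1) →
    (A.card : ℝ) ≤ C * (2 : ℝ) ^ ((7 / 8 + ε) * (N : ℝ)) := by
  intro ε hε
  obtain ⟨m, hm⟩ := exists_nat_gt (2 / ε)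
  have hm0 : (0 : ℝ) < m := lt_trans (by positivity) hm
  have hm1 : 1 ≤ m := by exact_mod_cast hm0
  have hl : 0 < Real.log 2 := Real.log_pos (by norm_num)
  set c1 : ℝ := (1 / (2 * ε * Real.log 2)) ^ 2 with hc1
  have hc1p : 0 < c1 := by positivity
  set c2 : ℝ := (2 : ℝ) ^ ((2 : ℝ) ^ (m + 1)) with hc2
  have hc2p : 0 < c2 := by positivity
  refine ⟨36 * c1 * c2 * (2 : ℝ) ^ ((7 / 8 + ε) * 8), by positivity, ?_⟩
  intro N A hA hd
  set k := N / 8 + 1 with hk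
  have hNk : N ≤ 8 * k := by omega
  have hkN : 8 * k ≤ N + 8 := by omega
  have hA' : ∀ a ∈ A, a ∈ Pl (8 * k) := fun a ha => Pl_mono hNk (mem_Pl.2 (hA a ha))
  have hb := main_bound (k := k) (by omega) (M := (2 : ℝ) ^ ((8 * k : ℝ) / m + 2 ^ (m + 1)))
    (Real.one_le_rpow (by norm_num) (by positivity)) (fun g hg hdg => pow_card_bound hm1 g hg hdg) hA' hd
  refine hb.trans ?_
  have hs := sq_bound (show 0 < 2 * ε by positivity) k
  rw [← hc1] at hs
  have hkN' : 8 * (k : ℝ) ≤ N + 8 := by exact_mod_cast hkN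
  have hM : (2 : ℝ) ^ ((8 * k : ℝ) / m + 2 ^ (m + 1)) ≤ (2 : ℝ) ^ (4 * ε * k) * c2 := by
    rw [Real.rpow_add (by norm_num)]
    apply mul_le_mul_of_nonneg_right _ hc2p.le
    apply Real.rpow_le_rpow_of_exponent_le (by norm_num)
    rw [div_le_iff₀ hm0]
    rw [div_lt_iff₀ hε] at hm
    have hk0 : (0 : ℝ) ≤ k := by positivity
    nlinarith
  calc 36 * (k : ℝ) ^ 2 * (2 : ℝ) ^ ((8 * k : ℝ) / m + 2 ^ (m + 1)) * 2 ^ (7 * k)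
      ≤ 36 * (c1 * (2 : ℝ) ^ (2 * (2 * ε) * k)) * ((2 : ℝ) ^ (4 * ε * k) * c2) * 2 ^ (7 * k) := by
        gcongr
    _ = 36 * c1 * c2 * (2 : ℝ) ^ ((7 / 8 + ε) * (8 * k)) := by
        rw [show (7 / 8 + ε) * (8 * k) = 2 * (2 * ε) * k + 4 * ε * k + ((7 * k : ℕ) : ℝ) by push_cast; ring,
          Real.rpow_add (by norm_num), Real.rpow_add (by norm_num), Real.rpow_natCast]
        ring
    _ ≤ 36 * c1 * c2 * (2 : ℝ) ^ ((7 / 8 + ε) * 8 + (7 / 8 + ε) * N) := by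
        apply mul_le_mul_of_nonneg_left _ (by positivity)
        apply Real.rpow_le_rpow_of_exponent_le (by norm_num)
        nlinarith
    _ = _ := by rw [Real.rpow_add (by norm_num)]; ring

end Sark

/-- For every `ε > 0` there is `C_ε` such that for all `N`: if `A ⊆ G_N` and `A − A`
contains no `r − 1` with `r` irreducible (prime), then `|A| ≤ C_ε · 2^{(7/8+ε)N}`. -/
theorem statement_0 :
    ∀ ε : ℝ, 0 < ε → ∃ C : ℝ, 0 < C ∧ ∀ N : ℕ, ∀ A : Finset F2[X],
      (∀ f ∈ A, f.degree < (N : ℕ)) →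
      (∀ a₁ ∈ A, ∀ a₂ ∈ A, ∀ r : F2[X], Irreducible r → a₁ - a₂ ≠ r - 1) →
      (A.card : ℝ) ≤ C * (2 : ℝ) ^ ((7 / 8 + ε) * (N : ℝ)) := by
  exact Sark.final
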